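/- Let d > 2 be an odd squarefree integer and n ≥ 2 an integer. Then the 2-class group of L_{n,d} is cyclic and nontrivial if and only if either d is a prime congruent to 7 (mod 16), or d = pq for two primes p and q with p ≡ 5 (mod 8) and q ≡ 3 (mod 8). -/

import Mathlib

open IntermediateField NumberField

/-- The quadratic field `ℚ(√m)` realized inside `ℂ` (for `m` of either sign). -/
noncomputable def quadField (m : ℤ) : IntermediateField ℚ ℂ :=
  IntermediateField.adjoin ℚ {z : ℂ | z ^ 2 = (m : ℂ)}

/-- The 2-class group of a number field `K ⊆ ℂ`: the 2-primary component
(= 2-Sylow subgroup) of the ideal class group of its ring of integers. -/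
noncomputable def twoClassGroup (K : IntermediateField ℚ ℂ) :
    Subgroup (ClassGroup (𝓞 K)) :=
  CommGroup.primaryComponent _ 2

/-- `h₂(m)`: the 2-class number of the quadratic field `ℚ(√m)`. -/
noncomputable def h2 (m : ℤ) : ℕ := Nat.card (twoClassGroup (quadField m))

/-- `L_{n,d} = ℚ(ζ_{2^{n+2}}, √d)`, the `n`-th layer of the cyclotomic
`ℤ₂`-extension of `ℚ(√d, √-1)`. -/
noncomputable def Lfield (n : ℕ) (d : ℤ) : IntermediateField ℚ ℂ :=
  IntermediateField.adjoin ℚ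
    ({z : ℂ | z ^ 2 ^ (n + 2) = 1} ∪ {z : ℂ | z ^ 2 = (d : ℂ)})

/-- `ℚ(ζ_{2^{n+2}} + ζ_{2^{n+2}}⁻¹, √d) = ℚ(2cos(2π/2^{n+2}), √d)`.
For `d > 0` this is the maximal real subfield `L_{n,d}⁺` of `L_{n,d}`;
for `d < 0` it is the `n`-th layer `K_{n,|d|}` of the cyclotomic
`ℤ₂`-extension of the imaginary quadratic field `ℚ(√d)`. -/
noncomputable def LplusField (n : ℕ) (d : ℤ) : IntermediateField ℚ ℂ :=
  IntermediateField.adjoin ℚ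
    ({((2 * Real.cos (2 * Real.pi / 2 ^ (n + 2)) : ℝ) : ℂ)} ∪ {z : ℂ | z ^ 2 = (d : ℂ)})


namespace CG

section Abstract

variable {X I : Type*} [CommGroup X] [CommGroup I]

/-- The norm map `x ↦ x * s x`. -/
def nm (s : X →* X) : X →* X := MonoidHom.id X * s

/-- The map `x ↦ x / s x`. -/
def df (s : X →* X) : X →* X := MonoidHom.id X / s

@[simp] lemma nm_apply (s : X →* X) (x : X) : nm s x = x * s x := rfl
@[simp] lemma df_apply (s : X →* X) (x : X) : df s x = x / s x := rfl

/-- Abstract form of Chevalley's ambiguous class number inequality. -/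
theorem chevalley_abstract (s : X →* X) (τ : I →* I) (dv : X →* I)
    (hs : ∀ x, s (s x) = x) (hτ : ∀ x, dv (s x) = τ (dv x))
    (h90 : ∀ x, x * s x = 1 → ∃ y, x = y / s y)
    (hττ : ∀ a, τ (τ a) = a)
    (J : Subgroup I) (hJ : J ≤ (df τ).ker) (hJ0 : (df s).ker.map dv ≤ J)
    (h t : ℕ) (hh : ((df s).ker.map dv).relIndex J ≤ h)
    (hh0 : ((df s).ker.map dv).relIndex J ≠ 0)
    (ht : J.relIndex (df τ).ker ≤ t) (ht0 : J.relIndex (df τ).ker ≠ 0)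
    (hH : (dv.ker.map (df s)).relIndex (dv.ker ⊓ (nm s).ker) =
      2 * (dv.ker.map (nm s)).relIndex (dv.ker ⊓ (df s).ker))
    (hH0 : (dv.ker.map (nm s)).relIndex (dv.ker ⊓ (df s).ker) ≠ 0) :
    dv.range.relIndex (dv.range.comap (df τ)) * 2 *
      (nm s).range.relIndex (dv.ker ⊓ (df s).ker) ≤ t * h := by
  set E := dv.ker with hE
  set X0 := (df s).ker with hX0
  set IG := (df τ).ker with hIG
  set P := dv.range with hP
  set P0 := X0.map dv with hP0
  set Q := P.comap (df τ) with hQ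
  set E0 := E ⊓ X0 with hE0
  set NE := E.map (nm s) with hNE
  set NX := (nm s).range with hNX
  set Em := E ⊓ (nm s).ker with hEm
  set Ed := E.map (df s) with hEd
  have memX0 : ∀ x, x ∈ X0 ↔ s x = x := fun x => by
    rw [hX0, MonoidHom.mem_ker, df_apply, div_eq_one, eq_comm]
  have memIG : ∀ x, x ∈ IG ↔ τ x = x := fun x => by
    rw [hIG, MonoidHom.mem_ker, df_apply, div_eq_one, eq_comm]
  -- step 1
  have s1 : P0.relIndex (P ⊓ IG) = Ed.relIndex Em := by
    set B : Subgroup X := IG.comap dv with hB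
    have hB1 : B.map dv = P ⊓ IG := by
      ext a
      constructor
      · rintro ⟨x, hx, rfl⟩
        exact ⟨⟨x, rfl⟩, hx⟩
      · rintro ⟨⟨x, rfl⟩, hx⟩
        exact ⟨x, hx, rfl⟩
    have hB2 : B.map (df s) = Em := by
      ext a
      constructor
      · rintro ⟨x, hx, rfl⟩
        have hx' : τ (dv x) = dv x := (memIG _).1 hx
        refine ⟨?_, ?_⟩
        · change dv (x / s x) = 1
          rw [map_div, hτ, hx', div_self']
        · change (x / s x) * s (x / s x) = 1
          rw [map_div, hs]; simp
      · rintro ⟨ha, ha'⟩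
        obtain ⟨y, rfl⟩ := h90 a ha'
        refine ⟨y, ?_, rfl⟩
        change dv y ∈ IG
        rw [memIG, ← hτ]
        have : dv (y / s y) = 1 := ha
        rw [map_div, div_eq_one] at this
        exact this.symm
    rw [← hB1, ← hB2, ← Subgroup.relIndex_comap, ← Subgroup.relIndex_comap,
      ← Subgroup.inf_relIndex_right, ← Subgroup.inf_relIndex_right (Ed.comap _)]
    congr 1
    ext x
    constructor
    · rintro ⟨⟨y, hy, hyx⟩, hx⟩
      refine ⟨⟨x / y, ?_, ?_⟩, hx⟩
      · change dv (x / y) = 1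
        rw [map_div, hyx, div_self']
      · have : s y = y := (memX0 _).1 hy
        simp [this]
    · rintro ⟨⟨y, hy, hyx⟩, hx⟩
      refine ⟨⟨x / y, ?_, ?_⟩, hx⟩
      · change x / y ∈ X0
        rw [memX0, map_div]
        simp only [df_apply] at hyx
        rw [div_eq_div_iff_mul_eq_mul] at hyx ⊢
        rw [mul_comm (s x), hyx, mul_comm]
      · have : dv y = 1 := hy
        rw [map_div, this, div_one]
  have hNX0 : NE ≤ NX ⊓ E0 := by
    rintro _ ⟨x, hx, rfl⟩
    have hx' : dv x = 1 := hx
    refine ⟨⟨x, rfl⟩, ?_, ?_⟩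
    · change dv (x * s x) = 1
      rw [map_mul, hτ, hx']; simp
    · exact (memX0 _).2 (by simp [hs, mul_comm])
  -- step 2
  have s2 : (IG ⊔ P).relIndex Q ≤ NE.relIndex (NX ⊓ E0) := by
    let R : Subgroup (I × X) :=
      ((df τ).comp (MonoidHom.fst I X)).eqLocus (dv.comp (MonoidHom.snd I X))
    have memR : ∀ z, z ∈ R ↔ z.1 / τ z.1 = dv z.2 := fun z => Iff.rfl
    have hR1 : R.map (MonoidHom.fst I X) = Q := by
      ext a
      constructor
      · rintro ⟨z, hz, rfl⟩
        exact ⟨z.2, ((memR z).1 hz).symm⟩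
      · rintro ⟨x, hx⟩
        exact ⟨(a, x), hx.symm, rfl⟩
    have hR2 : R.map ((nm s).comp (MonoidHom.snd I X)) ≤ NX ⊓ E0 := by
      rintro _ ⟨⟨a, x⟩, hz, rfl⟩
      have hz' : a / τ a = dv x := hz
      refine ⟨⟨x, rfl⟩, ?_, ?_⟩
      · change dv (x * s x) = 1
        rw [map_mul, hτ, ← hz', map_div, hττ]; simp
      · exact (memX0 _).2 (by simp [hs, mul_comm])
    have hfin : NE.relIndex (NX ⊓ E0) ≠ 0 := fun h0 => hH0 (by
      exact Subgroup.relIndex_eq_zero_of_le_right inf_le_right h0)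
    calc (IG ⊔ P).relIndex Q = ((IG ⊔ P).comap (MonoidHom.fst I X)).relIndex R := by
          rw [Subgroup.relIndex_comap, hR1]
      _ ≤ (NE.comap ((nm s).comp (MonoidHom.snd I X))).relIndex R := by
          rw [← Subgroup.inf_relIndex_right (NE.comap _)]
          apply Subgroup.relIndex_le_of_le_left
          · rintro ⟨a, x⟩ ⟨⟨e, he, hex⟩, hz⟩
            have hz' : a / τ a = dv x := hz
            have hex' : e * s e = x * s x := hex
            obtain ⟨y, hy⟩ := h90 (x / e) (by
              rw [map_div, div_mul_div_comm, hex', div_self'])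
            have he' : dv e = 1 := he
            have h3 : a / τ a = dv y / τ (dv y) := by
              rw [hz', ← hτ, ← map_div, ← hy, map_div, he', div_one]
            change a ∈ IG ⊔ P
            have : a = (a / dv y) * dv y := by simp
            rw [this]
            refine Subgroup.mul_mem_sup ?_ ⟨y, rfl⟩
            rw [memIG, map_div]
            rw [div_eq_div_iff_mul_eq_mul] at h3 ⊢
            rw [mul_comm (τ a), ← h3, mul_comm]
          · rw [Subgroup.inf_relIndex_right, Subgroup.relIndex_comap]
            exact fun h0 => hfin (Subgroup.relIndex_eq_zero_of_le_right hR2 h0)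
      _ = NE.relIndex (R.map ((nm s).comp (MonoidHom.snd I X))) := Subgroup.relIndex_comap _ _ _
      _ ≤ _ := Subgroup.relIndex_le_of_le_right hR2 hfin
  have hPQ : P ≤ Q := by
    rintro _ ⟨x, rfl⟩
    exact ⟨x / s x, by rw [map_div, hτ]; rfl⟩
  have hIGQ : IG ≤ Q := by
    intro a ha
    change df τ a ∈ P
    rw [(MonoidHom.mem_ker).1 ha]; exact one_mem _
  have s3 : P.relIndex Q = P.relIndex IG * (IG ⊔ P).relIndex Q := by
    rw [← Subgroup.relIndex_sup_right (K := P) (H := IG),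
      Subgroup.relIndex_mul_relIndex _ _ _ le_sup_right (sup_le hIGQ hPQ)]
  have hP0 : P0 ≤ P ⊓ IG := le_inf (by rintro _ ⟨x, _, rfl⟩; exact ⟨x, rfl⟩) (hJ0.trans hJ)
  have s4 : P0.relIndex (P ⊓ IG) * P.relIndex IG = P0.relIndex J * J.relIndex IG := by
    rw [Subgroup.relIndex_mul_relIndex _ _ _ hJ0 hJ, ← Subgroup.inf_relIndex_right P IG,
      Subgroup.relIndex_mul_relIndex _ _ _ hP0 inf_le_right]
  have s5 : NE.relIndex (NX ⊓ E0) * NX.relIndex E0 = NE.relIndex E0 := by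
    rw [← Subgroup.inf_relIndex_right NX E0,
      Subgroup.relIndex_mul_relIndex _ _ _ hNX0 inf_le_right]
  rw [s1, hH] at s4
  set a := P.relIndex IG
  set b := (IG ⊔ P).relIndex Q
  set c := NE.relIndex (NX ⊓ E0)
  set e := NX.relIndex E0
  set f := NE.relIndex E0
  have hf : 0 < f := Nat.pos_of_ne_zero hH0
  rw [s3]
  have : f * (a * b * 2 * e) ≤ f * (t * h) := by
    calc f * (a * b * 2 * e) = (2 * f * a) * (b * e) := by ring
      _ ≤ (2 * f * a) * (c * e) := by gcongr
      _ = (P0.relIndex J * J.relIndex IG) * f := by rw [s4, s5]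
      _ ≤ (h * t) * f := by gcongr
      _ = f * (t * h) := by ring
  exact Nat.le_of_mul_le_mul_left this hf

/-- Herbrand quotient computation from the indices of the squares. -/
theorem herbrand_abstract (s : X →* X) (hs : ∀ x, s (s x) = x) (E : Subgroup X)
    (hE : ∀ x ∈ E, s x ∈ E) (k : ℕ) (hk : k ≠ 0)
    (h0 : ((E ⊓ (df s).ker).map (powMonoidHom 2)).relIndex (E ⊓ (df s).ker) = k)
    (h1 : ((E ⊓ (nm s).ker).map (powMonoidHom 2)).relIndex (E ⊓ (nm s).ker) = 2 * k) :
    (E.map (df s)).relIndex (E ⊓ (nm s).ker) = 2 * (E.map (nm s)).relIndex (E ⊓ (df s).ker) ∧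
      (E.map (nm s)).relIndex (E ⊓ (df s).ker) ≠ 0 := by
  set E0 := E ⊓ (df s).ker with hE0
  set Em := E ⊓ (nm s).ker with hEm
  have mem0 : ∀ x, x ∈ E0 ↔ x ∈ E ∧ s x = x := fun x => by
    rw [hE0, Subgroup.mem_inf, MonoidHom.mem_ker, df_apply, div_eq_one, eq_comm (a := x)]
  have memm : ∀ x, x ∈ Em ↔ x ∈ E ∧ x * s x = 1 := fun x => by
    rw [hEm, Subgroup.mem_inf, MonoidHom.mem_ker, nm_apply]
  have a1 : E0.map (powMonoidHom 2) ≤ E.map (nm s) := by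
    rintro _ ⟨x, hx, rfl⟩
    obtain ⟨hx1, hx2⟩ := (mem0 x).1 hx
    exact ⟨x, hx1, by simp [hx2, sq]⟩
  have a2 : E.map (nm s) ≤ E0 := by
    rintro _ ⟨x, hx, rfl⟩
    exact (mem0 _).2 ⟨E.mul_mem hx (hE x hx), by simp [hs, mul_comm]⟩
  have b1 : Em.map (powMonoidHom 2) ≤ E.map (df s) := by
    rintro _ ⟨x, hx, rfl⟩
    obtain ⟨hx1, hx2⟩ := (memm x).1 hx
    refine ⟨x, hx1, ?_⟩
    have : s x = x⁻¹ := (eq_inv_of_mul_eq_one_right hx2)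
    simp [this, sq]
  have b2 : E.map (df s) ≤ Em := by
    rintro _ ⟨x, hx, rfl⟩
    exact (memm _).2 ⟨E.div_mem hx (hE x hx), by simp [hs]⟩
  have e1 : (E0.map (powMonoidHom 2)).relIndex (E.map (nm s)) = (E0 ⊔ Em).relIndex E := by
    rw [← Subgroup.relIndex_comap, ← Subgroup.inf_relIndex_right]
    congr 1
    ext x
    constructor
    · rintro ⟨⟨y, hy, hyx⟩, hx⟩
      have hyx' : y ^ 2 = x * s x := hyx
      obtain ⟨hy1, hy2⟩ := (mem0 y).1 hy
      have : x = y * (x / y) := by simp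
      rw [this]
      refine Subgroup.mul_mem_sup hy ((memm _).2 ⟨E.div_mem hx hy1, ?_⟩)
      rw [map_div, hy2, div_mul_div_comm, ← hyx', sq, div_self']
    · intro hx
      obtain ⟨y, hy, z, hz, rfl⟩ := Subgroup.mem_sup.1 hx
      obtain ⟨hy1, hy2⟩ := (mem0 y).1 hy
      obtain ⟨hz1, hz2⟩ := (memm z).1 hz
      refine ⟨⟨y, hy, ?_⟩, E.mul_mem hy1 hz1⟩
      change y ^ 2 = (y * z) * s (y * z)
      rw [map_mul, hy2, mul_mul_mul_comm, hz2, mul_one, sq]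
  have e2 : (Em.map (powMonoidHom 2)).relIndex (E.map (df s)) = (E0 ⊔ Em).relIndex E := by
    rw [← Subgroup.relIndex_comap, ← Subgroup.inf_relIndex_right]
    congr 1
    ext x
    constructor
    · rintro ⟨⟨y, hy, hyx⟩, hx⟩
      have hyx' : y ^ 2 = x / s x := hyx
      obtain ⟨hy1, hy2⟩ := (memm y).1 hy
      have : x = (x / y) * y := by simp
      rw [this]
      refine Subgroup.mul_mem_sup ((mem0 _).2 ⟨E.div_mem hx hy1, ?_⟩) hy
      have : s y = y⁻¹ := (eq_inv_of_mul_eq_one_right hy2)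
      rw [map_div, this, div_inv_eq_mul, eq_div_iff_mul_eq', mul_assoc, ← sq, hyx']
      simp
    · intro hx
      obtain ⟨y, hy, z, hz, rfl⟩ := Subgroup.mem_sup.1 hx
      obtain ⟨hy1, hy2⟩ := (mem0 y).1 hy
      obtain ⟨hz1, hz2⟩ := (memm z).1 hz
      refine ⟨⟨z, hz, ?_⟩, E.mul_mem hy1 hz1⟩
      change z ^ 2 = (y * z) / s (y * z)
      have : s z = z⁻¹ := (eq_inv_of_mul_eq_one_right hz2)
      rw [map_mul, hy2, mul_div_mul_left_eq_div, this, div_inv_eq_mul, sq]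
  have f1 := Subgroup.relIndex_mul_relIndex _ _ _ a1 a2
  have f2 := Subgroup.relIndex_mul_relIndex _ _ _ b1 b2
  rw [e1, h0] at f1
  rw [e2, h1] at f2
  have hg : (E0 ⊔ Em).relIndex E ≠ 0 := by
    intro h; rw [h, zero_mul] at f1; exact hk f1.symm
  constructor
  · apply Nat.eq_of_mul_eq_mul_left (Nat.pos_of_ne_zero hg)
    rw [f2, ← f1]; ring
  · intro h; rw [h, mul_zero] at f1; exact hk f1.symm

end Abstract

end CG

open NumberField nonZeroDivisors

set_option linter.all false

namespace CG

/-- Invertible fractional ideals. -/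
abbrev Fr (L : Type*) [Field L] := (FractionalIdeal (𝓞 L)⁰ L)ˣ

/-- Principal fractional ideals. -/
noncomputable abbrev pr (L : Type*) [Field L] [NumberField L] : Lˣ →* Fr L := toPrincipalIdeal (𝓞 L) L

section
variable {L M N : Type*} [Field L] [NumberField L] [Field M] [NumberField M] [Field N] [NumberField N]

lemma mapRingHom_inj (φ : L →+* M) : Function.Injective (RingOfIntegers.mapRingHom φ) := by
  intro x y h
  apply RingOfIntegers.ext
  have := congrArg (fun z : 𝓞 M => (z : M)) h
  exact φ.injective this

lemma nzd_le (φ : L →+* M) : (𝓞 L)⁰ ≤ Submonoid.comap (RingOfIntegers.mapRingHom φ) (𝓞 M)⁰ :=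
  nonZeroDivisors_le_comap_nonZeroDivisors_of_injective _ (mapRingHom_inj φ)

/-- Extension of fractional ideals along a field embedding. -/
noncomputable def jm (φ : L →+* M) : Fr L →* Fr M :=
  Units.map (FractionalIdeal.extendedHom' (K := L) M (nzd_le φ)).toMonoidHom

lemma jm_val (φ : L →+* M) (a : Fr L) :
    (jm φ a : FractionalIdeal (𝓞 M)⁰ M) = FractionalIdeal.extended M (nzd_le φ) (a : FractionalIdeal (𝓞 L)⁰ L) := rfl

lemma loc_map (φ : L →+* M) (x : L) :
    IsLocalization.map (S := L) M (RingOfIntegers.mapRingHom φ) (nzd_le φ) x = φ x := by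
  have : IsLocalization.map (S := L) M (RingOfIntegers.mapRingHom φ) (nzd_le φ) = φ := by
    apply IsLocalization.ringHom_ext (𝓞 L)⁰
    ext y
    simp only [RingHom.comp_apply, IsLocalization.map_eq]
    rfl
  rw [this]

lemma jm_pr (φ : L →+* M) (x : Lˣ) : jm φ (pr L x) = pr M (Units.map (φ : L →* M) x) := by
  apply Units.ext
  rw [jm_val, coe_toPrincipalIdeal, coe_toPrincipalIdeal, FractionalIdeal.extended_spanSingleton,
    loc_map]
  rfl

lemma jm_jm (φ : L →+* M) (ψ : M →+* N) (a : Fr L) : jm ψ (jm φ a) = jm (ψ.comp φ) a := by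
  apply Units.ext
  rw [jm_val, jm_val, jm_val, FractionalIdeal.extended_extended]
  rfl

/-- The integral ideal as a unit. -/
noncomputable def mk (A : Ideal (𝓞 L)) (hA : A ≠ ⊥) : Fr L :=
  Units.mk0 (A : FractionalIdeal (𝓞 L)⁰ L) (by simpa using hA)

lemma mk_val (A : Ideal (𝓞 L)) (hA : A ≠ ⊥) : (mk A hA : FractionalIdeal (𝓞 L)⁰ L) = A := rfl

lemma map_ne_bot (φ : L →+* M) {A : Ideal (𝓞 L)} (hA : A ≠ ⊥) :
    A.map (RingOfIntegers.mapRingHom φ) ≠ ⊥ := by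
  rwa [Ne, Ideal.map_eq_bot_iff_of_injective (mapRingHom_inj φ)]

lemma jm_mk (φ : L →+* M) (A : Ideal (𝓞 L)) (hA : A ≠ ⊥) :
    jm φ (mk A hA) = mk (A.map (RingOfIntegers.mapRingHom φ)) (map_ne_bot φ hA) := by
  apply Units.ext
  rw [jm_val, mk_val, mk_val, FractionalIdeal.extended_coeIdeal_eq_map]

lemma mk_mul (A B : Ideal (𝓞 L)) (hA : A ≠ ⊥) (hB : B ≠ ⊥) :
    mk (A * B) (mul_ne_zero hA hB) = mk A hA * mk B hB := by
  apply Units.ext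
  simp [mk_val]

lemma mk_inj {A B : Ideal (𝓞 L)} {hA : A ≠ ⊥} {hB : B ≠ ⊥} (h : mk A hA = mk B hB) : A = B := by
  have := congrArg Units.val h
  rw [mk_val, mk_val] at this
  exact FractionalIdeal.coeIdeal_injective this

lemma mk_congr {A B : Ideal (𝓞 L)} {hA : A ≠ ⊥} (h : A = B) : mk A hA = mk B (h ▸ hA) := by
  subst h; rfl

lemma mk_top : mk (⊤ : Ideal (𝓞 L)) (by simp) = 1 := by
  apply Units.ext
  simp [mk_val]

lemma jm_id (a : Fr L) : jm (RingHom.id L) a = a := by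
  apply Units.ext
  rw [jm_val]
  apply FractionalIdeal.coeToSubmodule_injective
  simp only [FractionalIdeal.coe_extended_eq_span]
  have : (⇑(IsLocalization.map (S := L) L (RingOfIntegers.mapRingHom (RingHom.id L))
      (nzd_le (RingHom.id L)))) = id := by
    funext x; rw [loc_map]; rfl
  rw [this, Set.image_id]
  exact Submodule.span_eq ((a : FractionalIdeal (𝓞 L)⁰ L) : Submodule (𝓞 L) L)

lemma exists_mk_div (a : Fr L) : ∃ (A : Ideal (𝓞 L)) (hA : A ≠ ⊥) (x : Lˣ),
    a * pr L x = mk A hA ∧ ∃ y : 𝓞 L, (x : L) = y := by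
  have h1 := FractionalIdeal.den_mul_self_eq_num' (𝓞 L)⁰ L (a : FractionalIdeal (𝓞 L)⁰ L)
  have hd : algebraMap (𝓞 L) L (a : FractionalIdeal (𝓞 L)⁰ L).den ≠ 0 := by
    have := nonZeroDivisors.ne_zero (a : FractionalIdeal (𝓞 L)⁰ L).den.2
    simpa using this
  have hA : (a : FractionalIdeal (𝓞 L)⁰ L).num ≠ ⊥ := by
    intro h
    have := FractionalIdeal.zero_of_num_eq_bot (zero_notMem_nonZeroDivisors) h
    exact a.ne_zero this
  refine ⟨_, hA, Units.mk0 _ hd, ?_, _, rfl⟩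
  apply Units.ext
  rw [Units.val_mul, mk_val, coe_toPrincipalIdeal, mul_comm, ← h1, Units.val_mk0]

lemma pr_mem_iff (a : Fr L) : a ∈ (pr L).range ↔ ∃ x, pr L x = a := Iff.rfl

/-- class number via fractional ideals -/
lemma card_cl : Nat.card (ClassGroup (𝓞 L)) = (pr L).range.index := by
  rw [Nat.card_congr (ClassGroup.equiv (R := 𝓞 L) L).toEquiv]
  rfl

lemma pr_eq_one (x : Lˣ) : pr L x = 1 ↔ ∃ u : (𝓞 L)ˣ, (x : L) = ((u : 𝓞 L) : L) := by
  constructor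
  · intro h
    have key : ∀ y : Lˣ, pr L y = 1 → ∃ z : 𝓞 L, (y : L) = z := by
      intro y hy
      rw [toPrincipalIdeal_eq_iff, Units.val_one] at hy
      have : (y : L) ∈ (1 : FractionalIdeal (𝓞 L)⁰ L) := by
        rw [← hy]; exact FractionalIdeal.mem_spanSingleton_self _ _
      obtain ⟨z, hz⟩ := (FractionalIdeal.mem_one_iff _).1 this
      exact ⟨z, hz.symm⟩
    obtain ⟨a, ha⟩ := key x h
    obtain ⟨b, hb⟩ := key x⁻¹ (by rw [map_inv, h, inv_one])
    have hab : a * b = 1 := by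
      apply RingOfIntegers.ext
      change (a : L) * (b : L) = 1
      rw [← ha, ← hb]; simp
    exact ⟨Units.mkOfMulEqOne a b hab, ha⟩
  · rintro ⟨u, hu⟩
    rw [toPrincipalIdeal_eq_iff, Units.val_one, hu]
    apply le_antisymm
    · rw [FractionalIdeal.spanSingleton_le_iff_mem]
      exact (FractionalIdeal.mem_one_iff _).2 ⟨_, rfl⟩
    · rw [FractionalIdeal.one_le, FractionalIdeal.mem_spanSingleton]
      refine ⟨((u⁻¹ : (𝓞 L)ˣ) : 𝓞 L), ?_⟩
      rw [Algebra.smul_def, ← map_mul, Units.inv_mul, map_one]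

end
end CG

open NumberField nonZeroDivisors
set_option linter.all false
namespace CG

section
variable {L M : Type*} [Field L] [NumberField L] [Field M] [NumberField M] [Algebra L M]
  [Algebra.IsQuadraticExtension L M]

/-- action of an automorphism on ideals of the ring of integers -/
noncomputable abbrev sI (σ : M ≃ₐ[L] M) (A : Ideal (𝓞 M)) : Ideal (𝓞 M) :=
  A.map (RingOfIntegers.mapRingHom (σ : M →+* M))

/-- `σ` on `𝓞 M`. -/
noncomputable abbrev sO (σ : M ≃ₐ[L] M) : 𝓞 M →+* 𝓞 M := RingOfIntegers.mapRingHom (σ : M →+* M)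

/-- `P` is (totally) ramified: inertia contains `σ`. -/
def Ram (σ : M ≃ₐ[L] M) (P : Ideal (𝓞 M)) : Prop :=
  P.IsPrime ∧ P ≠ ⊥ ∧ ∀ x, sO σ x - x ∈ P

lemma card_gal : Nat.card (M ≃ₐ[L] M) = 2 := by
  rw [IsGalois.card_aut_eq_finrank, Algebra.IsQuadraticExtension.finrank_eq_two]

lemma gal_eq {σ : M ≃ₐ[L] M} (hσ : σ ≠ 1) (g : M ≃ₐ[L] M) : g = 1 ∨ g = σ := by
  have h2 := card_gal (L := L) (M := M)
  rw [Nat.card_eq_two_iff] at h2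
  obtain ⟨x, y, hxy, h⟩ := h2
  have : ∀ z : M ≃ₐ[L] M, z = x ∨ z = y := fun z => by
    have : z ∈ ({x, y} : Set (M ≃ₐ[L] M)) := by rw [h]; trivial
    simpa using this
  rcases this 1 with h1 | h1 <;> rcases this σ with h3 | h3 <;> rcases this g with h4 | h4 <;>
    simp_all

lemma sig_sig {σ : M ≃ₐ[L] M} (hσ : σ ≠ 1) (x : M) : σ (σ x) = x := by
  have h : σ * σ = 1 := by
    rcases gal_eq hσ (σ * σ) with h | h
    · exact h
    · exact absurd (mul_eq_left.1 h) hσ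
  have := congrArg (fun g : M ≃ₐ[L] M => g x) h
  simpa using this

lemma sI_sI {σ : M ≃ₐ[L] M} (hσ : σ ≠ 1) (A : Ideal (𝓞 M)) : sI σ (sI σ A) = A := by
  unfold sI
  rw [Ideal.map_map]
  have : (RingOfIntegers.mapRingHom (σ : M →+* M)).comp (RingOfIntegers.mapRingHom (σ : M →+* M))
      = RingHom.id _ := by
    ext x
    exact sig_sig hσ _
  rw [this, Ideal.map_id]

lemma fixed_mem {σ : M ≃ₐ[L] M} (hσ : σ ≠ 1) (x : M) (hx : σ x = x) : ∃ y : L, algebraMap L M y = x := by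
  have : x ∈ (⊥ : IntermediateField L M) := by
    rw [IsGalois.mem_bot_iff_fixed]
    intro g
    rcases gal_eq hσ g with rfl | rfl
    · rfl
    · exact hx
  exact IntermediateField.mem_bot.1 this

open scoped Pointwise in
lemma local_fact {σ : M ≃ₐ[L] M} (hσ : σ ≠ 1) (P : Ideal (𝓞 M)) [hP : P.IsPrime] (hP0 : P ≠ ⊥) :
    ∃ p : Ideal (𝓞 L), p ≠ ⊥ ∧ ((sI σ P ≠ P ∧ P * sI σ P = p.map (algebraMap (𝓞 L) (𝓞 M))) ∨
      (sI σ P = P ∧ P = p.map (algebraMap (𝓞 L) (𝓞 M))) ∨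
      (sI σ P = P ∧ Ram σ P ∧ P * P = p.map (algebraMap (𝓞 L) (𝓞 M)))) := by
  set p := P.under (𝓞 L) with hp
  have hp0 : p ≠ ⊥ := Ideal.IsIntegral.comap_ne_bot _ hP0
  have : p.IsMaximal := Ideal.IsPrime.isMaximal inferInstance hp0
  have hover : P.LiesOver p := ⟨rfl⟩
  have hsm : σ • P = sI σ P := rfl
  have hσP : (sI σ P).LiesOver p := by rw [← hsm]; infer_instance
  have hσP' : (sI σ P).IsPrime := by rw [← hsm]; infer_instance
  have key := Ideal.ncard_primesOver_mul_ramificationIdxIn_mul_inertiaDegIn p (𝓞 M) (M ≃ₐ[L] M)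
  rw [card_gal] at key
  have hprod := Ideal.map_algebraMap_eq_finsetProd_pow (R := 𝓞 M) (p := p) hp0
  have hset : p.primesOver (𝓞 M) = {P, sI σ P} := by
    ext Q
    constructor
    · rintro ⟨hQ, hQ'⟩
      obtain ⟨g, hg⟩ := Ideal.exists_smul_eq_of_isGaloisGroup p P Q (M ≃ₐ[L] M)
      rcases gal_eq hσ g with rfl | rfl
      · left; rw [← hg, one_smul]
      · right; rw [← hg]; exact hsm
    · rintro (rfl | rfl)
      · exact ⟨hP, hover⟩
      · exact ⟨hσP', hσP⟩
  have hset' : (p.primesOver (𝓞 M)).toFinset = ({P, sI σ P} : Finset _) := by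
    ext Q; simp [hset]
  have hram : ∀ Q : Ideal (𝓞 M), Q.IsPrime → Q.LiesOver p →
      Q.ramificationIdx (𝓞 L) = p.ramificationIdxIn (𝓞 M) := fun Q h1 h2 =>
    (Ideal.ramificationIdxIn_eq_ramificationIdx p Q (M ≃ₐ[L] M)).symm
  refine ⟨p, hp0, ?_⟩
  rw [hset'] at hprod
  by_cases hne : sI σ P = P
  · rw [hne] at hset hprod
    simp only [Set.pair_eq_singleton, Finset.pair_eq_singleton, Finset.prod_singleton] at hset hprod
    rw [hset, Set.ncard_singleton, one_mul] at key
    rw [hram P hP hover] at hprod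
    right
    have he : p.ramificationIdxIn (𝓞 M) = 1 ∨ p.ramificationIdxIn (𝓞 M) = 2 :=
      (Nat.dvd_prime Nat.prime_two).1 ⟨_, key.symm⟩
    rcases he with he | he
    · left
      rw [he, pow_one] at hprod
      exact ⟨hne, hprod.symm⟩
    · right
      refine ⟨hne, ⟨hP, hP0, ?_⟩, by rw [hprod, he, sq]⟩
      have hi := Ideal.card_inertia_eq_ramificationIdxIn (G := M ≃ₐ[L] M) p P
      rw [he, ← card_gal (L := L) (M := M)] at hi
      have : σ ∈ Ideal.inertia (M ≃ₐ[L] M) P := by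
        rw [Subgroup.eq_top_of_card_eq _ hi]; trivial
      intro x
      exact this x
  · left
    refine ⟨hne, ?_⟩
    have hne' : P ≠ sI σ P := fun h => hne h.symm
    rw [hset, Set.ncard_pair hne'] at key
    have he : p.ramificationIdxIn (𝓞 M) = 1 := by
      have : p.ramificationIdxIn (𝓞 M) * p.inertiaDegIn (𝓞 M) = 1 := by omega
      exact Nat.eq_one_of_mul_eq_one_right this
    rw [Finset.prod_pair hne', hram P hP hover, hram _ hσP' hσP, he, pow_one, pow_one] at hprod
    exact hprod.symm

end
end CG

open NumberField nonZeroDivisors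
set_option linter.all false
namespace CG

section
variable {L M : Type*} [Field L] [NumberField L] [Field M] [NumberField M] [Algebra L M]
  [Algebra.IsQuadraticExtension L M]

/-- the action of `σ` on fractional ideals -/
noncomputable abbrev ta (σ : M ≃ₐ[L] M) : Fr M →* Fr M := jm (σ : M →+* M)

variable (L M) in
/-- ideals extended from `L` -/
noncomputable abbrev JJ : Subgroup (Fr M) := (jm (algebraMap L M)).range

/-- the action of `σ` on units -/
noncomputable abbrev su (σ : M ≃ₐ[L] M) : Mˣ →* Mˣ := Units.map ((σ : M →+* M) : M →* M)

lemma su_val (σ : M ≃ₐ[L] M) (x : Mˣ) : (su σ x : M) = σ x := rfl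

lemma su_su {σ : M ≃ₐ[L] M} (hσ : σ ≠ 1) (x : Mˣ) : su σ (su σ x) = x :=
  Units.ext (sig_sig hσ x)

lemma ta_ta {σ : M ≃ₐ[L] M} (hσ : σ ≠ 1) (a : Fr M) : ta σ (ta σ a) = a := by
  rw [jm_jm]
  have : (σ : M →+* M).comp (σ : M →+* M) = RingHom.id M := by
    ext x; exact sig_sig hσ x
  rw [this, jm_id]

lemma ta_pr (σ : M ≃ₐ[L] M) (x : Mˣ) : pr M (su σ x) = ta σ (pr M x) := (jm_pr _ _).symm

lemma ta_j (σ : M ≃ₐ[L] M) (a : Fr L) : ta σ (jm (algebraMap L M) a) = jm (algebraMap L M) a := by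
  rw [jm_jm]
  have : (σ : M →+* M).comp (algebraMap L M) = algebraMap L M := RingHom.ext fun x => σ.commutes x
  rw [this]

lemma JJ_le (σ : M ≃ₐ[L] M) : JJ L M ≤ (df (ta σ)).ker := by
  rintro _ ⟨a, rfl⟩
  rw [MonoidHom.mem_ker, df_apply, ta_j, div_self']

lemma ta_mk (σ : M ≃ₐ[L] M) (A : Ideal (𝓞 M)) (hA : A ≠ ⊥) :
    ta σ (mk A hA) = mk (sI σ A) (map_ne_bot _ hA) := jm_mk _ _ _

lemma map_mem_JJ (p : Ideal (𝓞 L)) (hp : p ≠ ⊥) (A : Ideal (𝓞 M)) (hA : A ≠ ⊥)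
    (h : A = p.map (algebraMap (𝓞 L) (𝓞 M))) : mk A hA ∈ JJ L M := by
  subst h
  exact ⟨mk p hp, jm_mk _ _ _⟩

lemma norm_unit_mem {σ : M ≃ₐ[L] M} (hσ : σ ≠ 1) (x : Mˣ) : ∃ y : Lˣ, Units.map (algebraMap L M : L →* M) y = x * su σ x := by
  obtain ⟨y, hy⟩ := fixed_mem hσ ((x * su σ x : Mˣ) : M) (by
    rw [Units.val_mul, su_val, map_mul, sig_sig hσ, mul_comm])
  have hy0 : y ≠ 0 := by
    rintro rfl
    rw [map_zero] at hy
    exact (x * su σ x).ne_zero hy.symm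
  exact ⟨Units.mk0 y hy0, Units.ext hy⟩

lemma pr_norm_mem {σ : M ≃ₐ[L] M} (hσ : σ ≠ 1) (x : Mˣ) : pr M (x * su σ x) ∈ JJ L M := by
  obtain ⟨y, hy⟩ := norm_unit_mem hσ x
  rw [← hy]
  exact ⟨pr L y, jm_pr _ _⟩

lemma prime_norm_mem {σ : M ≃ₐ[L] M} (hσ : σ ≠ 1) (P : Ideal (𝓞 M)) [P.IsPrime] (hP0 : P ≠ ⊥) :
    mk P hP0 * ta σ (mk P hP0) ∈ JJ L M := by
  obtain ⟨p, hp0, h | h | h⟩ := local_fact hσ P hP0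
  · rw [ta_mk, ← mk_mul]
    exact map_mem_JJ p hp0 _ _ h.2
  · have : mk P hP0 ∈ JJ L M := map_mem_JJ p hp0 _ _ h.2
    have h2 := (MonoidHom.mem_ker).1 (JJ_le σ this)
    rw [df_apply, div_eq_one] at h2
    rw [← h2]
    exact mul_mem this this
  · rw [ta_mk, mk_congr h.1, ← mk_mul]
    exact map_mem_JJ p hp0 _ _ h.2.2

lemma ideal_norm_mem {σ : M ≃ₐ[L] M} (hσ : σ ≠ 1) (A : Ideal (𝓞 M)) (hA : A ≠ ⊥) :
    mk A hA * ta σ (mk A hA) ∈ JJ L M := by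
  induction A using UniqueFactorizationMonoid.induction_on_prime with
  | h₁ => exact absurd rfl hA
  | h₂ x hx =>
    rw [Ideal.isUnit_iff] at hx
    subst hx
    rw [mk_top, map_one, mul_one]; exact one_mem _
  | h₃ a p ha hp ih =>
    have hp' : p.IsPrime := Ideal.isPrime_of_prime hp
    rw [mk_mul p a hp.ne_zero ha, map_mul, mul_mul_mul_comm]
    exact mul_mem (prime_norm_mem hσ p hp.ne_zero) (ih ha)

lemma norm_mem {σ : M ≃ₐ[L] M} (hσ : σ ≠ 1) (a : Fr M) : a * ta σ a ∈ JJ L M := by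
  obtain ⟨A, hA, x, h, -⟩ := exists_mk_div a
  have h1 := ideal_norm_mem hσ A hA
  rw [← h, map_mul, mul_mul_mul_comm, ← ta_pr, ← map_mul] at h1
  exact (Subgroup.mul_mem_cancel_right _ (pr_norm_mem hσ x)).1 h1

/-- ramified primes as fractional ideals -/
def ramS (σ : M ≃ₐ[L] M) : Set (Fr M) := {a | ∃ P : Ideal (𝓞 M), ∃ h : P ≠ ⊥, Ram σ P ∧ a = mk P h}

lemma inv_ideal {σ : M ≃ₐ[L] M} (hσ : σ ≠ 1) (n : ℕ) : ∀ (A : Ideal (𝓞 M)) (hA : A ≠ ⊥),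
    Ideal.absNorm A ≤ n → sI σ A = A → mk A hA ∈ JJ L M ⊔ Subgroup.closure (ramS σ) := by
  induction n with
  | zero =>
    intro A hA h
    have := Nat.le_zero.1 h
    rw [Ideal.absNorm_eq_zero_iff] at this
    exact absurd this hA
  | succ n ih =>
    intro A hA hn hinv
    by_cases htop : A = ⊤
    · subst htop
      rw [mk_top]; exact one_mem _
    obtain ⟨P, hPm, hAP⟩ := Ideal.exists_le_maximal A htop
    have hP : P.IsPrime := hPm.isPrime
    have hP0 : P ≠ ⊥ := by rintro rfl; exact hA (le_bot_iff.1 hAP)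
    have hlt : ∀ B C : Ideal (𝓞 M), C ≠ ⊤ → A = C * B → B ≠ ⊥ → Ideal.absNorm B ≤ n := by
      intro B C hC hAB hB
      have h1 : Ideal.absNorm A = Ideal.absNorm C * Ideal.absNorm B := by rw [hAB, map_mul]
      have hC0 : C ≠ ⊥ := by rintro rfl; simp at hAB; exact hA hAB
      have hC1 : Ideal.absNorm C ≠ 1 := fun h => hC (Ideal.absNorm_eq_one_iff.1 h)
      have hC2 : Ideal.absNorm C ≠ 0 := fun h => hC0 (Ideal.absNorm_eq_zero_iff.1 h)
      have hB2 : Ideal.absNorm B ≠ 0 := fun h => hB (Ideal.absNorm_eq_zero_iff.1 h)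
      have : 2 ≤ Ideal.absNorm C := by omega
      nlinarith [Nat.pos_of_ne_zero hB2]
    have step : ∀ C : Ideal (𝓞 M), ∀ hC0 : C ≠ ⊥, C ≠ ⊤ → C ∣ A → sI σ C = C →
        mk C hC0 ∈ JJ L M ⊔ Subgroup.closure (ramS σ) →
        mk A hA ∈ JJ L M ⊔ Subgroup.closure (ramS σ) := by
      rintro C hC0 hC ⟨B, hB⟩ hinvC hmem
      have hB0 : B ≠ ⊥ := by rintro rfl; simp at hB; exact hA hB
      have hinvB : sI σ B = B := by
        have h1 : sI σ A = sI σ C * sI σ B := by rw [hB]; exact Ideal.map_mul _ _ _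
        rw [hinv, hinvC, hB] at h1
        exact (mul_left_cancel₀ hC0 h1).symm
      rw [mk_congr hB, mk_mul C B hC0 hB0]
      exact mul_mem hmem (ih B hB0 (hlt B C hC hB hB0) hinvB)
    obtain ⟨p, hp0, h | h | h⟩ := local_fact hσ P hP0
    · have hσA : A ≤ sI σ P := by
        rw [← hinv]; exact Ideal.map_mono hAP
      have hσP : (sI σ P).IsPrime := by
        have : (sO σ : 𝓞 M →+* 𝓞 M) = ((RingOfIntegers.mapRingEquiv (σ : M ≃+* M) : 𝓞 M ≃+* 𝓞 M) : 𝓞 M →+* 𝓞 M) := rfl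
        exact Ideal.map_isPrime_of_equiv (RingOfIntegers.mapRingEquiv (σ : M ≃+* M))
      refine step (P * sI σ P) (mul_ne_zero hP0 (map_ne_bot _ hP0)) ?_ ?_ ?_ ?_
      · intro ht
        have : (⊤ : Ideal (𝓞 M)) ≤ P := ht ▸ Ideal.mul_le_left
        exact hP.ne_top (top_le_iff.1 this)
      · have hco : IsCoprime P (sI σ P) := by
          rw [Ideal.isCoprime_iff_sup_eq]
          have hm2 : (sI σ P).IsMaximal := hσP.isMaximal (map_ne_bot _ hP0)
          exact Ideal.IsMaximal.coprime_of_ne hPm hm2 (fun hh => h.1 hh.symm)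
        exact hco.mul_dvd (Ideal.dvd_iff_le.2 hAP) (Ideal.dvd_iff_le.2 hσA)
      · have h1 : sI σ (P * sI σ P) = sI σ P * sI σ (sI σ P) := Ideal.map_mul _ _ _
        rw [h1, sI_sI hσ, mul_comm]
      · exact Subgroup.mem_sup_left (map_mem_JJ p hp0 _ _ h.2)
    · exact step P hP0 hP.ne_top (Ideal.dvd_iff_le.2 hAP) h.1
        (Subgroup.mem_sup_left (map_mem_JJ p hp0 _ _ h.2))
    · exact step P hP0 hP.ne_top (Ideal.dvd_iff_le.2 hAP) h.1
        (Subgroup.mem_sup_right (Subgroup.subset_closure ⟨P, hP0, h.2.1, rfl⟩))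

lemma IG_le {σ : M ≃ₐ[L] M} (hσ : σ ≠ 1) :
    (df (ta σ)).ker ≤ JJ L M ⊔ Subgroup.closure (ramS σ) := by
  intro a ha
  rw [MonoidHom.mem_ker, df_apply, div_eq_one] at ha
  obtain ⟨A, hA, x, h, y, hy⟩ := exists_mk_div a
  have hxA : a * pr M (x * su σ x) = mk (A * Ideal.span {sO σ y}) (mul_ne_zero hA (by
      intro h0
      have : sO σ y = 0 := by simpa using h0
      have hy0 : y = 0 := mapRingHom_inj _ (by rw [this, map_zero])
      rw [hy0] at hy
      exact x.ne_zero (by simpa using hy))) := by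
    apply Units.ext
    have h' := congrArg Units.val h
    rw [Units.val_mul, coe_toPrincipalIdeal, mk_val] at h'
    rw [Units.val_mul, mk_val, coe_toPrincipalIdeal, FractionalIdeal.coeIdeal_mul, ← h',
      FractionalIdeal.coeIdeal_span_singleton, mul_assoc, FractionalIdeal.spanSingleton_mul_spanSingleton]
    congr 2
    rw [Units.val_mul, su_val, hy]
    rfl
  have hJ := pr_norm_mem (L := L) hσ x
  have hJ' := JJ_le σ hJ
  rw [MonoidHom.mem_ker, df_apply, div_eq_one] at hJ'
  have hin : ta σ (a * pr M (x * su σ x)) = a * pr M (x * su σ x) := by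
    rw [map_mul, ← ha, ← hJ']
  rw [← Subgroup.mul_mem_cancel_right _ (Subgroup.mem_sup_left hJ), hxA]
  apply inv_ideal hσ _ _ _ le_rfl
  rw [hxA, ta_mk] at hin
  exact mk_inj hin

lemma ramS_sq {σ : M ≃ₐ[L] M} (hσ : σ ≠ 1) : ∀ a ∈ ramS σ, a ^ 2 ∈ JJ L M := by
  rintro _ ⟨P, hP0, ⟨hP, -, hR⟩, rfl⟩
  have h1 : sI σ P = P := by
    have hle : sI σ P ≤ P := by
      rw [Ideal.map_le_iff_le_comap]
      intro x hx
      rw [Ideal.mem_comap]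
      have := P.add_mem (hR x) hx
      simpa using this
    apply le_antisymm hle
    have := Ideal.map_mono (f := sO σ) hle
    rwa [show Ideal.map (sO σ) (sI σ P) = P from sI_sI hσ P] at this
  have := prime_norm_mem (L := L) hσ P hP0
  rw [ta_mk, mk_congr h1] at this
  rw [sq]; exact this

end

/-- index bound -/
lemma index_sq {G : Type*} [CommGroup G] (H K : Subgroup G) (S : Set G) (hS : S.Finite)
    (hsq : ∀ a ∈ S, a ^ 2 ∈ H) (hK : K ≤ H ⊔ Subgroup.closure S) :
    H.relIndex K ≤ 2 ^ S.ncard ∧ H.relIndex K ≠ 0 := by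
  have key : H.relIndex (H ⊔ Subgroup.closure S) ≤ 2 ^ S.ncard ∧
      H.relIndex (H ⊔ Subgroup.closure S) ≠ 0 := by
    clear hK
    induction S, hS using Set.Finite.induction_on with
    | empty => simp
    | @insert a s ha hs ih =>
      obtain ⟨ih1, ih2⟩ := ih (fun b hb => hsq b (Set.mem_insert_of_mem _ hb))
      have hcl : H ⊔ Subgroup.closure (insert a s) = (H ⊔ Subgroup.closure s) ⊔ Subgroup.zpowers a := by
        rw [Set.insert_eq, Subgroup.closure_union, Subgroup.zpowers_eq_closure, sup_assoc, sup_comm (Subgroup.closure {a})]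
      have hle : H ⊔ Subgroup.closure s ≤ H ⊔ Subgroup.closure (insert a s) := by
        rw [hcl]; exact le_sup_left
      rw [← Subgroup.relIndex_mul_relIndex _ _ _ le_sup_left hle, Set.ncard_insert_of_notMem ha hs, pow_succ]
      have h2 : (H ⊔ Subgroup.closure s).relIndex (H ⊔ Subgroup.closure (insert a s)) ∣ 2 := by
        rw [hcl, sup_comm _ (Subgroup.zpowers a), Subgroup.relIndex_sup_right, Subgroup.relIndex_dvd_two_iff]
        refine ⟨a, Subgroup.mem_zpowers a, ?_⟩
        rintro _ ⟨k, rfl⟩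
        have ha2 : a ^ 2 ∈ H ⊔ Subgroup.closure s := Subgroup.mem_sup_left (hsq a (Set.mem_insert _ _))
        rcases Int.even_or_odd' k with ⟨c, rfl | rfl⟩
        · right
          change a ^ (2 * c) ∈ _
          rw [zpow_mul]; exact zpow_mem (by exact_mod_cast ha2) _
        · left
          change a ^ (2 * c + 1) * a ∈ _
          have : a ^ (2 * c + 1) * a = (a ^ 2) ^ (c + 1) := by
            rw [← zpow_natCast a 2, ← zpow_mul, ← zpow_add_one]; congr 1; push_cast; ring
          rw [this]; exact zpow_mem ha2 _
      have h3 := Nat.le_of_dvd two_pos h2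
      refine ⟨Nat.mul_le_mul ih1 h3, mul_ne_zero ih2 ?_⟩
      intro h0; rw [h0] at h2; simp at h2
  exact ⟨(Subgroup.relIndex_le_of_le_right hK key.2).trans key.1,
    fun h0 => key.2 (Subgroup.relIndex_eq_zero_of_le_right hK h0)⟩

end CG

open NumberField nonZeroDivisors
set_option linter.all false
namespace CG

section
lemma idx_sq_equiv {G H : Type*} [CommGroup G] [CommGroup H] (e : G ≃* H) :
    (powMonoidHom 2 : G →* G).range.index = (powMonoidHom 2 : H →* H).range.index := by
  have : (powMonoidHom 2 : H →* H).range = (powMonoidHom 2 : G →* G).range.map e.toMonoidHom := by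
    ext x
    constructor
    · rintro ⟨y, rfl⟩
      exact ⟨(e.symm y)^2, ⟨e.symm y, rfl⟩, by simp⟩
    · rintro ⟨_, ⟨y, rfl⟩, rfl⟩
      exact ⟨e y, by simp⟩
  rw [this]
  exact (Subgroup.index_map_of_bijective e.bijective _).symm

lemma idx_sq_prod {G H : Type*} [CommGroup G] [CommGroup H] :
    (powMonoidHom 2 : G × H →* G × H).range.index =
      (powMonoidHom 2 : G →* G).range.index * (powMonoidHom 2 : H →* H).range.index := by
  rw [← Subgroup.index_prod]
  congr 1
  ext ⟨x, y⟩
  constructor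
  · rintro ⟨⟨a, b⟩, h⟩
    simp [Prod.ext_iff] at h
    exact ⟨⟨a, h.1⟩, ⟨b, h.2⟩⟩
  · rintro ⟨⟨a, h⟩, ⟨b, h'⟩⟩
    exact ⟨⟨a, b⟩, by simp_all⟩

lemma idx_sq_free (j : Type) [Fintype j] :
    (powMonoidHom 2 : (j → Multiplicative ℤ) →* (j → Multiplicative ℤ)).range.index
      = 2 ^ Fintype.card j := by
  let f : (j → Multiplicative ℤ) →* (j → Multiplicative (ZMod 2)) :=
    { toFun := fun v i => Multiplicative.ofAdd ((Multiplicative.toAdd (v i) : ℤ) : ZMod 2)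
      map_one' := by ext; simp
      map_mul' := by intro a b; ext; simp }
  have hr : f.range = ⊤ := by
    rw [MonoidHom.range_eq_top]
    intro w
    refine ⟨fun i => Multiplicative.ofAdd (((Multiplicative.toAdd (w i)).val : ℤ)), ?_⟩
    ext i
    simp [f]
  have hk : (powMonoidHom 2 : (j → Multiplicative ℤ) →* (j → Multiplicative ℤ)).range = f.ker := by
    ext v
    constructor
    · rintro ⟨w, rfl⟩
      rw [MonoidHom.mem_ker]
      ext i
      have : ((2:ℤ) : ZMod 2) = 0 := rfl
      simp [f]
      left; exact this
    · intro hv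
      rw [MonoidHom.mem_ker] at hv
      have h1 : ∀ i, ∃ k : ℤ, Multiplicative.toAdd (v i) = 2 * k := by
        intro i
        have := congrFun hv i
        simp only [f, MonoidHom.coe_mk, OneHom.coe_mk, Pi.one_apply, ofAdd_eq_one] at this
        exact (ZMod.intCast_zmod_eq_zero_iff_dvd _ 2).mp this
      choose k hk using h1
      refine ⟨fun i => Multiplicative.ofAdd (k i), ?_⟩
      ext i
      apply Multiplicative.toAdd.injective
      simp [hk]
  rw [hk, Subgroup.index_ker, hr]
  rw [Nat.card_congr (Subgroup.topEquiv (G := (j → Multiplicative (ZMod 2)))).toEquiv]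
  classical
  rw [Nat.card_eq_fintype_card, Fintype.card_pi]
  have : Fintype.card (Multiplicative (ZMod 2)) = 2 := by decide
  simp [this]

lemma idx_sq {G : Type*} [CommGroup G] [Module.Finite ℤ (Additive G)] :
    (powMonoidHom 2 : G →* G).range.index =
      2 ^ (Module.finrank ℤ (Additive G)) * Nat.card (powMonoidHom 2 : G →* G).ker := by
  have : Group.FG G := by
    rw [GroupFG.iff_add_fg]
    exact Module.Finite.iff_addGroup_fg.mp inferInstance
  obtain ⟨j, ι, fj, fι, p, hp, e, ⟨f⟩⟩ := CommGroup.equiv_free_prod_prod_multiplicative_zmod G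
  have : ∀ i, NeZero (p i ^ e i) := fun i => ⟨pow_ne_zero _ (hp i).ne_zero⟩
  rw [idx_sq_equiv f, idx_sq_prod, idx_sq_free, Subgroup.index_range]
  set T := ((i : j) → Multiplicative (ZMod (p i ^ e i))) with hT
  have hfin : Finite T := inferInstance
  congr 1
  · congr 1
    have e1 : Additive G ≃+ (ι → ℤ) × Additive T :=
      (MulEquiv.toAdditive f).trans ((AddEquiv.prodAdditive _ _).trans
        (((AddEquiv.piAdditive _).trans
          ((AddEquiv.additiveMultiplicative ℤ).arrowCongr (Equiv.refl _))).prodCongr (AddEquiv.refl _)))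
    rw [(e1.toIntLinearEquiv).finrank_eq]
    have hle := Submodule.finrank_quotient_add_finrank (LinearMap.ker (LinearMap.fst ℤ (ι → ℤ) (Additive T)))
    have h1 : Module.finrank ℤ (LinearMap.ker (LinearMap.fst ℤ (ι → ℤ) (Additive T))) = 0 := by
      rw [Module.finrank_eq_zero_iff]
      intro x
      refine ⟨Nat.card T, ?_, ?_⟩
      · exact_mod_cast Nat.card_pos.ne'
      · obtain ⟨⟨a, b⟩, hx⟩ := x
        have ha : a = 0 := by simpa using hx
        subst ha
        ext1
        ext1
        · simp
        · have : (Additive.toMul b) ^ Nat.card T = 1 := pow_card_eq_one'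
          simp only [Submodule.coe_smul, Prod.smul_mk]
          change ((Nat.card T : ℤ)) • b = 0
          rw [natCast_zsmul]
          exact this
    rw [← hle, h1, add_zero, (LinearMap.quotKerEquivOfSurjective (LinearMap.fst ℤ (ι → ℤ) (Additive T))
      LinearMap.fst_surjective).finrank_eq]
    simp
  · apply Nat.card_congr
    refine ⟨fun x => ⟨f.symm (1, x.1), ?_⟩, fun x => ⟨(f x.1).2, ?_⟩, ?_, ?_⟩
    · have := x.2
      rw [MonoidHom.mem_ker] at this ⊢
      simp only [powMonoidHom_apply] at this ⊢
      rw [← map_pow, Prod.pow_mk, this]; simp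
    · have := x.2
      rw [MonoidHom.mem_ker] at this ⊢
      simp only [powMonoidHom_apply] at this ⊢
      rw [← Prod.pow_snd, ← map_pow, this]; simp
    · intro x; simp
    · rintro ⟨x, hx⟩
      rw [MonoidHom.mem_ker, powMonoidHom_apply] at hx
      have h1 : (f x).1 = 1 := by
        have : (f x).1 ^ 2 = 1 := by rw [← Prod.pow_fst, ← map_pow, hx]; simp
        ext i
        have h2 := congrFun this i
        apply Multiplicative.toAdd.injective
        have h3 := congrArg Multiplicative.toAdd h2
        simp at h3
        simp [h3]
      ext1
      simp only
      apply f.injective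
      rw [MulEquiv.apply_symm_apply]
      exact Prod.ext h1.symm rfl
end
end CG

open NumberField nonZeroDivisors
set_option linter.all false
namespace CG

section
variable {X : Type*} [CommGroup X]

lemma relIndex_sq (H : Subgroup X) :
    (H.map (powMonoidHom 2)).relIndex H = (powMonoidHom 2 : H →* H).range.index := by
  rw [Subgroup.relIndex]
  congr 1
  ext ⟨x, hx⟩
  rw [Subgroup.mem_subgroupOf]
  constructor
  · rintro ⟨y, hy, h⟩
    exact ⟨⟨y, hy⟩, Subtype.ext h⟩
  · rintro ⟨⟨y, hy⟩, h⟩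
    exact ⟨y, hy, congrArg Subtype.val h⟩

lemma finite_of_le {H E : Subgroup X} (h : H ≤ E) [Module.Finite ℤ (Additive E)] :
    Module.Finite ℤ (Additive H) := by
  let f : Additive H →ₗ[ℤ] Additive E := (MonoidHom.toAdditive (Subgroup.inclusion h)).toIntLinearMap
  exact Module.Finite.of_injective f (fun a b hab => Subgroup.inclusion_injective h hab)

lemma rank_split (s : X →* X) (hs : ∀ x, s (s x) = x) (E : Subgroup X) (hE : ∀ x ∈ E, s x ∈ E)
    [Module.Finite ℤ (Additive E)] :
    Module.finrank ℤ (Additive ↥(E ⊓ (df s).ker)) + Module.finrank ℤ (Additive ↥(E ⊓ (nm s).ker))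
      = Module.finrank ℤ (Additive E) := by
  have m1 : ∀ x : E, nm s x ∈ E ⊓ (df s).ker := fun x => by
    refine Subgroup.mem_inf.2 ⟨E.mul_mem x.2 (hE _ x.2), ?_⟩
    rw [MonoidHom.mem_ker, df_apply, nm_apply, map_mul, hs, mul_comm, div_self']
  let g : E →* ↥(E ⊓ (df s).ker) := ((nm s).comp E.subtype).codRestrict _ m1
  let f : Additive E →ₗ[ℤ] Additive ↥(E ⊓ (df s).ker) := (MonoidHom.toAdditive g).toIntLinearMap
  have := finite_of_le (inf_le_left : E ⊓ (df s).ker ≤ E)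
  have := finite_of_le (inf_le_left : E ⊓ (nm s).ker ≤ E)
  have h1 := Submodule.finrank_quotient_add_finrank (LinearMap.ker f)
  have h2 := Submodule.finrank_quotient_add_finrank (LinearMap.range f)
  have h3 : Module.finrank ℤ (Additive ↥(E ⊓ (df s).ker) ⧸ LinearMap.range f) = 0 := by
    rw [Module.finrank_eq_zero_iff]
    intro x
    obtain ⟨y, rfl⟩ := Submodule.Quotient.mk_surjective _ x
    refine ⟨2, two_ne_zero, ?_⟩
    rw [← Submodule.Quotient.mk_smul, Submodule.Quotient.mk_eq_zero]
    have hy := Subgroup.mem_inf.1 (Additive.toMul y).2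
    refine ⟨Additive.ofMul ⟨(Additive.toMul y).1, hy.1⟩, ?_⟩
    apply Additive.toMul.injective
    apply Subtype.ext
    have := hy.2
    rw [MonoidHom.mem_ker, df_apply, div_eq_one] at this
    change (Additive.toMul y).1 * s (Additive.toMul y).1 = (((Additive.toMul y) ^ (2:ℤ) : ↥(E ⊓ (df s).ker)) : X)
    rw [← this]
    simp [zpow_ofNat, pow_two]
  have h4 : Module.finrank ℤ (LinearMap.ker f) = Module.finrank ℤ (Additive ↥(E ⊓ (nm s).ker)) := by
    have i1 : ∀ x : LinearMap.ker f, (nm s) (Additive.toMul x.1).1 = 1 := fun x =>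
      congrArg Subtype.val x.2
    let e : LinearMap.ker f ≃+ Additive ↥(E ⊓ (nm s).ker) :=
      { toFun := fun x => Additive.ofMul ⟨(Additive.toMul x.1).1, ⟨(Additive.toMul x.1).2, i1 x⟩⟩
        invFun := fun x => ⟨Additive.ofMul ⟨(Additive.toMul x).1, (Additive.toMul x).2.1⟩,
          Subtype.ext (Additive.toMul x).2.2⟩
        left_inv := fun x => rfl
        right_inv := fun x => rfl
        map_add' := fun x y => rfl }
    exact e.toIntLinearEquiv.finrank_eq
  rw [(LinearMap.quotKerEquivRange f).finrank_eq] at h1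
  omega

lemma herb (s : X →* X) (hs : ∀ x, s (s x) = x) (E : Subgroup X) (hE : ∀ x ∈ E, s x ∈ E)
    [Module.Finite ℤ (Additive E)] (h2 : ∀ x : X, x ^ 2 = 1 → s x = x)
    (m : X) (hm : m ∈ E) (hm1 : m ≠ 1) (hm2 : ∀ x, x ^ 2 = 1 ↔ x = 1 ∨ x = m) (r : ℕ)
    (h0 : Module.finrank ℤ (Additive ↥(E ⊓ (df s).ker)) = r)
    (h1 : Module.finrank ℤ (Additive E) = 2 * r + 1) :
    ((E ⊓ (df s).ker).map (powMonoidHom 2)).relIndex (E ⊓ (df s).ker) = 2 ^ (r + 1) ∧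
    ((E ⊓ (nm s).ker).map (powMonoidHom 2)).relIndex (E ⊓ (nm s).ker) = 2 * 2 ^ (r + 1) := by
  have := finite_of_le (inf_le_left : E ⊓ (df s).ker ≤ E)
  have := finite_of_le (inf_le_left : E ⊓ (nm s).ker ≤ E)
  have hm2' : m ^ 2 = 1 := (hm2 m).2 (Or.inr rfl)
  have hsm : s m = m := h2 m hm2'
  have key : ∀ H : Subgroup X, m ∈ H → Nat.card (powMonoidHom 2 : H →* H).ker = 2 := by
    intro H hH
    rw [Nat.card_eq_two_iff]
    refine ⟨1, ⟨⟨m, hH⟩, Subtype.ext hm2'⟩, ?_, ?_⟩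
    · intro h
      exact hm1 (congrArg (fun x => (x.1 : X)) h).symm
    · ext ⟨⟨x, hx⟩, hx2⟩
      have : x ^ 2 = 1 := congrArg Subtype.val hx2
      rcases (hm2 x).1 this with h | h
      · simp [h]
      · simp [h]
  have hs0 := rank_split s hs E hE
  have k1 : m ∈ E ⊓ (df s).ker := Subgroup.mem_inf.2 ⟨hm, by rw [MonoidHom.mem_ker, df_apply, hsm, div_self']⟩
  have k2 : m ∈ E ⊓ (nm s).ker := Subgroup.mem_inf.2 ⟨hm, by rw [MonoidHom.mem_ker, nm_apply, hsm, ← pow_two, hm2']⟩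
  rw [relIndex_sq, relIndex_sq, idx_sq, idx_sq, key _ k1, key _ k2, h0]
  have : Module.finrank ℤ (Additive ↥(E ⊓ (nm s).ker)) = r + 1 := by omega
  rw [this]
  constructor <;> ring
end
end CG

open NumberField nonZeroDivisors
set_option linter.all false
namespace CG

section
variable {L M : Type*} [Field L] [NumberField L] [Field M] [NumberField M] [Algebra L M]
  [Algebra.IsQuadraticExtension L M]

lemma hil90 {σ : M ≃ₐ[L] M} (hσ : σ ≠ 1) (x : Mˣ) (hx : x * su σ x = 1) : ∃ y, x = y / su σ y := by
  have hx' : (x : M) * σ x = 1 := congrArg Units.val hx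
  by_cases h : (x : M) = -1
  · obtain ⟨z, hz⟩ : ∃ z, σ z ≠ z := by
      by_contra! hh
      exact hσ (AlgEquiv.ext hh)
    have h0 : z - σ z ≠ 0 := sub_ne_zero.2 (Ne.symm hz)
    refine ⟨Units.mk0 _ h0, ?_⟩
    rw [eq_div_iff_mul_eq']
    ext
    simp [su_val, h, sig_sig hσ]
  · have h0 : 1 + (x : M) ≠ 0 := fun h' => h (by linear_combination h')
    refine ⟨Units.mk0 _ h0, ?_⟩
    rw [eq_div_iff_mul_eq']
    ext
    simp only [Units.val_mul, su_val, Units.val_mk0, map_add, map_one]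
    linear_combination hx'

lemma ker_df_su {σ : M ≃ₐ[L] M} (hσ : σ ≠ 1) :
    (df (su σ)).ker = (Units.map (algebraMap L M : L →* M)).range := by
  ext x
  rw [MonoidHom.mem_ker, df_apply, div_eq_one]
  constructor
  · intro h
    obtain ⟨y, hy⟩ := fixed_mem hσ (x : M) (congrArg Units.val h).symm
    have hy0 : y ≠ 0 := by
      rintro rfl
      exact x.ne_zero (by rw [← hy, map_zero])
    exact ⟨Units.mk0 y hy0, Units.ext hy⟩
  · rintro ⟨y, rfl⟩
    ext
    exact (σ.commutes _).symm

variable (L M) in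
lemma map_pr_range : ((Units.map (algebraMap L M : L →* M)).range).map (pr M) =
    (pr L).range.map (jm (algebraMap L M)) := by
  rw [MonoidHom.map_range, MonoidHom.map_range]
  congr 1
  ext1 x
  exact (jm_pr _ _).symm

lemma hh_bound {σ : M ≃ₐ[L] M} (hσ : σ ≠ 1) :
    ((df (su σ)).ker.map (pr M)) ≤ JJ L M ∧
    ((df (su σ)).ker.map (pr M)).relIndex (JJ L M) ∣ Nat.card (ClassGroup (𝓞 L)) ∧
    ((df (su σ)).ker.map (pr M)).relIndex (JJ L M) ≠ 0 := by
  rw [ker_df_su hσ, map_pr_range, card_cl]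
  have hJ : JJ L M = (⊤ : Subgroup (Fr L)).map (jm (algebraMap L M)) := (MonoidHom.range_eq_map _)
  have h0 : (pr L).range.index ≠ 0 := by rw [← card_cl]; exact Nat.card_pos.ne'
  have : ((pr L).range.map (jm (algebraMap L M))).relIndex (JJ L M) ∣ (pr L).range.index := by
    rw [hJ, Subgroup.relIndex_map_map, top_sup_eq, Subgroup.relIndex_top_right]
    exact Subgroup.index_dvd_of_le le_sup_left
  refine ⟨?_, this, ?_⟩
  · rw [hJ]; exact Subgroup.map_mono le_top
  · intro h; rw [h] at this; exact h0 (Nat.eq_zero_of_zero_dvd this)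

/-- units of `𝓞 K` as kernel of `pr`. -/
lemma unit_equiv {K F : Type*} [Field K] [NumberField K] [Field F] (i : K →+* F)  :
    Nonempty ((𝓞 K)ˣ ≃* ↥((pr K).ker.map (Units.map (i : K →* F)))) := by
  let f : (𝓞 K)ˣ →* Fˣ := (Units.map (i : K →* F)).comp (Units.map (algebraMap (𝓞 K) K : 𝓞 K →* K))
  have hf : Function.Injective f := by
    intro a b h
    have := congrArg Units.val h
    exact Units.ext (RingOfIntegers.coe_injective (i.injective this))
  have hr : f.range = (pr K).ker.map (Units.map (i : K →* F)) := by
    rw [← MonoidHom.map_range]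
    congr 1
    ext x
    rw [MonoidHom.mem_ker, pr_eq_one]
    constructor
    · rintro ⟨u, rfl⟩; exact ⟨u, rfl⟩
    · rintro ⟨u, h⟩; exact ⟨u, Units.ext h.symm⟩
  rw [← hr]
  exact ⟨MonoidHom.ofInjective hf⟩

lemma E0_eq {σ : M ≃ₐ[L] M} (hσ : σ ≠ 1) :
    (pr M).ker ⊓ (df (su σ)).ker = (pr L).ker.map (Units.map (algebraMap L M : L →* M)) := by
  rw [ker_df_su hσ]
  ext x
  rw [Subgroup.mem_inf]
  constructor
  · rintro ⟨h, y, rfl⟩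
    refine ⟨y, ?_, rfl⟩
    rw [MonoidHom.mem_ker, ← jm_pr] at h
    have : pr L y = 1 := by
      rw [pr_eq_one] 
      rw [jm_pr, pr_eq_one] at h
      obtain ⟨u, hu'⟩ := h
      have hu : algebraMap L M y = algebraMap (𝓞 M) M u := hu'
      have h1 : IsIntegral ℤ (y : L) := by
        have : IsIntegral ℤ (algebraMap L M y) := by
          have := RingOfIntegers.isIntegral_coe (u : 𝓞 M)
          rw [← hu] at this
          exact this
        exact (isIntegral_algebraMap_iff (algebraMap L M).injective).1 this
      have h2 : IsIntegral ℤ ((y⁻¹ : Lˣ) : L) := by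
        have : IsIntegral ℤ (algebraMap L M (y⁻¹ : Lˣ)) := by
          have h3 := RingOfIntegers.isIntegral_coe ((u⁻¹ : (𝓞 M)ˣ) : 𝓞 M)
          have h4 : (((u⁻¹ : (𝓞 M)ˣ) : 𝓞 M) : M) = algebraMap L M (y⁻¹ : Lˣ) := by
            have h5 : (((u : 𝓞 M)) : M) * (((u⁻¹ : (𝓞 M)ˣ) : 𝓞 M) : M) = 1 := by
              rw [← map_mul, Units.mul_inv, map_one]
            rw [← hu'] at h5
            have h6 : (algebraMap L M y) * algebraMap L M (y⁻¹ : Lˣ) = 1 := by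
              rw [← map_mul, Units.mul_inv, map_one]
            exact mul_left_cancel₀ (a := algebraMap L M y) (by simp) (h5.trans h6.symm)
          rw [← h4]; exact h3
        exact (isIntegral_algebraMap_iff (algebraMap L M).injective).1 this
      refine ⟨⟨⟨y, h1⟩, ⟨_, h2⟩, ?_, ?_⟩, rfl⟩
      · apply RingOfIntegers.ext; exact Units.mul_inv _
      · apply RingOfIntegers.ext; exact Units.inv_mul _
    exact this
  · rintro ⟨y, hy, rfl⟩
    refine ⟨?_, y, rfl⟩
    rw [MonoidHom.mem_ker, ← jm_pr, MonoidHom.mem_ker.1 hy, map_one]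

variable [hfin : Fact (Fintype.card (InfinitePlace M) = 2 * Fintype.card (InfinitePlace L))]

/-- Chevalley's inequality. -/
theorem chevalley {σ : M ≃ₐ[L] M} (hσ : σ ≠ 1) (t : ℕ) (T : Finset (Ideal (𝓞 M))) (hTt : T.card ≤ t)
    (hT : ∀ P, Ram σ P → P ∈ T) :
    (pr M).range.relIndex ((pr M).range.comap (df (ta σ))) * 2 *
      (nm (su σ)).range.relIndex ((pr M).ker ⊓ (df (su σ)).ker) ≤
      2 ^ t * ((df (su σ)).ker.map (pr M)).relIndex (JJ L M) ∧
    (nm (su σ)).range.relIndex ((pr M).ker ⊓ (df (su σ)).ker) ≠ 0 := by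
  classical
  obtain ⟨hb1, hb2, hb3⟩ := hh_bound (L := L) hσ
  have hsub : ramS σ ⊆ (T.image (fun P => if h : P ≠ ⊥ then mk P h else 1) : Finset (Fr M)) := by
    rintro _ ⟨P, hP, hR, rfl⟩
    rw [Finset.coe_image]
    exact ⟨P, hT P hR, by simp [hP]⟩
  have hSf : (ramS σ).Finite := (Finset.finite_toSet _).subset hsub
  have hSn : (ramS σ).ncard ≤ t := by
    refine (Set.ncard_le_ncard hsub (Finset.finite_toSet _)).trans ?_
    rw [Set.ncard_coe_finset]
    exact Finset.card_image_le.trans hTt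
  obtain ⟨i1, i2⟩ := index_sq (JJ L M) _ (ramS σ) hSf (ramS_sq hσ) (IG_le hσ)
  obtain ⟨eM⟩ := unit_equiv (RingHom.id M)
  have hMid : (pr M).ker.map (Units.map ((RingHom.id M : M →+* M) : M →* M)) = (pr M).ker := by
    have : (Units.map ((RingHom.id M : M →+* M) : M →* M)) = MonoidHom.id _ := by ext; rfl
    rw [this, Subgroup.map_id]
  rw [hMid] at eM
  obtain ⟨eL⟩ := unit_equiv (algebraMap L M)
  rw [← E0_eq hσ] at eL
  have : Module.Finite ℤ (Additive ↥(pr M).ker) :=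
    Module.Finite.equiv (MulEquiv.toAdditive eM).toIntLinearEquiv
  have hE : ∀ x ∈ (pr M).ker, su σ x ∈ (pr M).ker := by
    intro x hx
    rw [MonoidHom.mem_ker] at hx ⊢
    rw [ta_pr, hx, map_one]
  have hsq2 : ∀ x : Mˣ, x ^ 2 = 1 ↔ x = 1 ∨ x = -1 := fun x => by
    rw [← Units.val_inj, ← Units.val_inj, ← Units.val_inj]
    push_cast
    exact sq_eq_one_iff
  have cL : 0 < Fintype.card (InfinitePlace L) := Fintype.card_pos
  obtain ⟨k0, k1⟩ := herb (su σ) (su_su hσ) (pr M).ker hE (by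
      intro x hx
      rcases (hsq2 x).1 hx with rfl | rfl
      · simp
      · ext; simp [su_val]) (-1) (by
      rw [MonoidHom.mem_ker, pr_eq_one]; exact ⟨-1, by simp⟩) (by
      intro h
      have := congrArg Units.val h
      simp at this
      norm_num at this) hsq2 (Fintype.card (InfinitePlace L) - 1) (by
      rw [← (MulEquiv.toAdditive eL).toIntLinearEquiv.finrank_eq, NumberField.Units.finrank_eq]
      rfl) (by
      rw [← (MulEquiv.toAdditive eM).toIntLinearEquiv.finrank_eq, NumberField.Units.finrank_eq]
      rw [NumberField.Units.rank, hfin.out]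
      omega)
  obtain ⟨j0, j1⟩ := herbrand_abstract (su σ) (su_su hσ) (pr M).ker hE _ (by positivity) k0 k1
  refine ⟨?_, fun h => j1 (Nat.eq_zero_of_zero_dvd (h ▸ Subgroup.relIndex_dvd_of_le_left _
    (Subgroup.map_le_range _ _)))⟩
  exact chevalley_abstract (su σ) (ta σ) (pr M) (su_su hσ) (ta_pr σ) (hil90 hσ) (ta_ta hσ)
    (JJ L M) (JJ_le σ) hb1 _ _ le_rfl hb3 (i1.trans (Nat.pow_le_pow_right (by norm_num) hSn)) i2 j0 j1
end
end CG

open NumberField nonZeroDivisors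
set_option linter.all false
namespace CG

section Abs
variable {I : Type*} [CommGroup I]

lemma B_abs (τ : I →* I) (P J P0 : Subgroup I) (h1 : P0 ≤ J) (h2 : P0 ≤ P) (hP : ∀ a ∈ P, τ a ∈ P)
    (hJ : J ≤ (df τ).ker) (hn : ∀ a, a * τ a ∈ J) (hsq : ∀ a ∈ P, a ∈ J → a ^ 2 ∈ P0)
    (hodd : Odd (P0.relIndex J)) (hfin : P.index ≠ 0) :
    P.relIndex (P.comap (powMonoidHom 2)) * P0.relIndex J ≤ P.relIndex (P.comap (df τ)) := by
  set A := P.comap (powMonoidHom 2) with hA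
  set h := P0.relIndex J with hh
  have memA : ∀ a, a ∈ A ↔ a ^ 2 ∈ P := fun a => Iff.rfl
  have hpow : ∀ a ∈ J, a ^ h ∈ P0 := by
    intro a ha
    have := Subgroup.pow_index_mem (P0.subgroupOf J) ⟨a, ha⟩
    exact this
  have key : ∀ a ∈ J, a ^ 4 ∈ P0 → a ∈ P0 := by
    intro a ha h4
    have hc : Nat.Coprime 4 h := by
      have : Nat.Coprime (2 ^ 2) h := Nat.Coprime.pow_left 2 (Nat.coprime_two_left.2 hodd)
      exact this
    have h5 := Nat.gcd_eq_gcd_ab 4 h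
    rw [hc] at h5
    have : a = (a ^ 4) ^ (Nat.gcdA 4 h) * (a ^ h) ^ (Nat.gcdB 4 h) := by
      rw [← zpow_natCast a 4, ← zpow_natCast a h, ← zpow_mul, ← zpow_mul, ← zpow_add, ← h5]; simp
    rw [this]
    exact P0.mul_mem (P0.zpow_mem h4 _) (P0.zpow_mem (hpow a ha) _)
  have hinf : A ⊓ J = P0 := by
    ext a
    rw [Subgroup.mem_inf]
    constructor
    · rintro ⟨ha, hj⟩
      apply key a hj
      have := hsq (a ^ 2) ha (J.pow_mem hj 2)
      rwa [← pow_mul] at this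
    · intro ha
      exact ⟨P.pow_mem (h2 ha) 2, h1 ha⟩
  have hPA : P ≤ A := fun a ha => P.pow_mem ha 2
  have hAQ : A ⊔ J ≤ P.comap (df τ) := by
    rw [sup_le_iff]
    constructor
    · intro a ha
      have e1 : a * τ a ∈ P0 := by
        apply key _ (hn a)
        have : (a * τ a) ^ 2 ∈ P := by
          rw [mul_pow, ← map_pow]
          exact P.mul_mem ha (hP _ ha)
        have := hsq _ this (J.pow_mem (hn a) 2)
        rwa [← pow_mul] at this
      have e2 : a / τ a = a ^ 2 / (a * τ a) := by
        rw [pow_two, mul_div_mul_left_eq_div]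
      rw [Subgroup.mem_comap, df_apply, e2]
      exact P.div_mem ha (h2 e1)
    · intro a ha
      rw [Subgroup.mem_comap, MonoidHom.mem_ker.1 (hJ ha)]
      exact P.one_mem
  have e3 : A.relIndex (A ⊔ J) = h := by
    rw [Subgroup.relIndex_sup_left, ← Subgroup.inf_relIndex_right, hinf]
  have e4 := Subgroup.relIndex_mul_relIndex P A (A ⊔ J) hPA le_sup_left
  rw [e3] at e4
  rw [e4]
  have : P.relIndex (P.comap (df τ)) ≠ 0 := by
    exact fun h => hfin (Nat.eq_zero_of_zero_dvd (h ▸ Subgroup.relIndex_dvd_index_of_normal _ _))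
  exact Subgroup.relIndex_le_of_le_right hAQ this

lemma U_abs (τ : I →* I) (hττ : ∀ a, τ (τ a) = a) (P J P0 : Subgroup I) 
    (hP : ∀ a ∈ P, τ a ∈ P) (hn : ∀ a ∈ P, a * τ a ∈ P0)
    (hfin : P.index ≠ 0) (hq : P.relIndex (P.comap (df τ)) * 2 ≤ P0.relIndex J) :
    ¬ J ≤ (nm τ).range ⊔ P0 := by
  intro hJ
  have hQ0 : P.relIndex (P.comap (df τ)) ≠ 0 := by
    exact fun h => hfin (Nat.eq_zero_of_zero_dvd (h ▸ Subgroup.relIndex_dvd_index_of_normal _ _))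
  have e1 : (P0.comap (nm τ)).index = P0.relIndex ((nm τ).range ⊔ P0) := by
    rw [Subgroup.index_comap, Subgroup.relIndex_sup_right]
  have e2 : P ⊔ (df τ).range ≤ P0.comap (nm τ) := by
    rw [sup_le_iff]
    refine ⟨fun a ha => hn a ha, ?_⟩
    rintro _ ⟨a, rfl⟩
    rw [Subgroup.mem_comap, nm_apply, df_apply, map_div, hττ]
    simp
  have e3 : P.index = P.relIndex (P ⊔ (df τ).range) * (P ⊔ (df τ).range).index :=
    (Subgroup.relIndex_mul_index le_sup_left).symm
  have e4 : P.index = P.relIndex (P.comap (df τ)) * (P.comap (df τ)).index := by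
    refine (Subgroup.relIndex_mul_index ?_).symm
    intro a ha
    exact P.div_mem ha (hP a ha)
  rw [Subgroup.relIndex_sup_left, ← Subgroup.index_comap] at e3
  have hc0 : (P.comap (df τ)).index ≠ 0 := by
    intro h; rw [h, mul_zero] at e4; exact hfin e4
  have e5 : (P ⊔ (df τ).range).index = P.relIndex (P.comap (df τ)) := by
    apply Nat.eq_of_mul_eq_mul_left (Nat.pos_of_ne_zero hc0)
    rw [← e3, e4, mul_comm]
  have e6 : (P0.comap (nm τ)).index ∣ (P ⊔ (df τ).range).index := Subgroup.index_dvd_of_le e2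
  rw [e5, e1] at e6
  have e7 := Nat.le_of_dvd (Nat.pos_of_ne_zero hQ0) e6
  have e8 : P0.relIndex ((nm τ).range ⊔ P0) ≠ 0 := by
    intro h; rw [h] at e6; exact hQ0 (Nat.eq_zero_of_zero_dvd e6)
  have e9 := Subgroup.relIndex_le_of_le_right hJ e8
  omega
end Abs
end CG

open NumberField nonZeroDivisors
set_option linter.all false
namespace CG

lemma four_le {Q : Type*} [Group Q] [Finite Q] (x y : Q) (hx : x ≠ 1) (hy : y ≠ 1) (hxy : x * y ≠ 1)
    (h2 : x * x = 1) : 4 ≤ Nat.card Q := by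
  classical
  have : Fintype Q := Fintype.ofFinite _
  rw [Nat.card_eq_fintype_card]
  have a4 : x ≠ y := fun h => hxy (by rw [← h]; exact h2)
  have a5 : x ≠ x * y := fun h => hy (left_eq_mul.1 h)
  have a6 : y ≠ x * y := fun h => hx (right_eq_mul.1 h)
  calc 4 = ({1, x, y, x * y} : Finset Q).card := by
        rw [Finset.card_insert_of_notMem, Finset.card_insert_of_notMem, Finset.card_insert_of_notMem,
          Finset.card_singleton]
        · rw [Finset.mem_singleton]; exact a6
        · rw [Finset.mem_insert, Finset.mem_singleton]; tauto
        · rw [Finset.mem_insert, Finset.mem_insert, Finset.mem_singleton]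
          rintro (h | h | h)
          · exact hx h.symm
          · exact hy h.symm
          · exact hxy h.symm
    _ ≤ _ := Finset.card_le_univ _

section
variable (K : Type*) [Field K] [NumberField K]

/-- number of classes of order dividing two -/
noncomputable def N2 : ℕ := Nat.card (powMonoidHom 2 : ClassGroup (𝓞 K) →* ClassGroup (𝓞 K)).ker

/-- the class of a fractional ideal -/
noncomputable def cls : Fr K →* ClassGroup (𝓞 K) :=
  ((ClassGroup.equiv (R := 𝓞 K) K).symm : _ →* _).comp (QuotientGroup.mk' (pr K).range)

lemma cls_surj : Function.Surjective (cls K) :=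
  (ClassGroup.equiv (R := 𝓞 K) K).symm.surjective.comp (QuotientGroup.mk'_surjective _)

lemma cls_ker : (cls K).ker = (pr K).range := by
  ext x
  rw [MonoidHom.mem_ker, cls, MonoidHom.comp_apply, MonoidHom.coe_coe, MulEquiv.map_eq_one_iff]
  exact QuotientGroup.eq_one_iff x

lemma N2_eq : (pr K).range.relIndex ((pr K).range.comap (powMonoidHom 2)) = N2 K := by
  have h1 : (pr K).range.comap (powMonoidHom 2) =
      (powMonoidHom 2 : ClassGroup (𝓞 K) →* ClassGroup (𝓞 K)).ker.comap (cls K) := by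
    ext x
    rw [Subgroup.mem_comap, Subgroup.mem_comap, MonoidHom.mem_ker, ← cls_ker, MonoidHom.mem_ker]
    simp
  rw [h1]
  conv_lhs => rw [← cls_ker, ← MonoidHom.comap_bot]
  rw [Subgroup.relIndex_comap, Subgroup.map_comap_eq_self_of_surjective (cls_surj K),
    Subgroup.relIndex_bot_left, N2]

lemma odd_of_N2 (h : N2 K = 1) : Odd (Nat.card (ClassGroup (𝓞 K))) := by
  rw [← Nat.not_even_iff_odd]
  intro he
  obtain ⟨x, hx⟩ := exists_prime_orderOf_dvd_card' (G := ClassGroup (𝓞 K)) 2 he.two_dvd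
  rw [N2, Subgroup.card_eq_one] at h
  have : x ∈ (powMonoidHom 2 : ClassGroup (𝓞 K) →* ClassGroup (𝓞 K)).ker := by
    rw [MonoidHom.mem_ker, powMonoidHom_apply, ← hx, pow_orderOf_eq_one]
  rw [h, Subgroup.mem_bot] at this
  rw [this, orderOf_one] at hx
  omega

lemma N2_pos : 0 < N2 K := Nat.card_pos
end

section
variable {L M : Type*} [Field L] [NumberField L] [Field M] [NumberField M] [Algebra L M]
  [Algebra.IsQuadraticExtension L M]
  [hfin : Fact (Fintype.card (InfinitePlace M) = 2 * Fintype.card (InfinitePlace L))]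

lemma P0_le {σ : M ≃ₐ[L] M} (hσ : σ ≠ 1) (x : Mˣ) : pr M (x * su σ x) ∈ (df (su σ)).ker.map (pr M) := by
  refine ⟨x * su σ x, ?_, rfl⟩
  rw [SetLike.mem_coe, MonoidHom.mem_ker, df_apply, map_mul, su_su hσ, mul_comm, div_self']

theorem thmB {σ : M ≃ₐ[L] M} (hσ : σ ≠ 1) (t : ℕ) (T : Finset (Ideal (𝓞 M))) (hTt : T.card ≤ t)
    (hT : ∀ P, Ram σ P → P ∈ T) (hodd : Odd (Nat.card (ClassGroup (𝓞 L)))) :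
    N2 M * 2 * (nm (su σ)).range.relIndex ((pr M).ker ⊓ (df (su σ)).ker) ≤ 2 ^ t ∧
    (nm (su σ)).range.relIndex ((pr M).ker ⊓ (df (su σ)).ker) ≠ 0 := by
  obtain ⟨c1, c2⟩ := chevalley hσ t T hTt hT
  obtain ⟨b1, b2, b3⟩ := hh_bound (L := L) hσ
  refine ⟨?_, c2⟩
  have hP : ∀ a ∈ (pr M).range, ta σ a ∈ (pr M).range := by
    rintro _ ⟨x, rfl⟩
    exact ⟨su σ x, ta_pr σ x⟩
  have := B_abs (ta σ) (pr M).range (JJ L M) _ b1 (Subgroup.map_le_range _ _) hP (JJ_le σ) (norm_mem hσ)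
    (by
      rintro _ ⟨x, rfl⟩ hx
      have := MonoidHom.mem_ker.1 (JJ_le σ hx)
      rw [df_apply, div_eq_one] at this
      rw [pow_two]
      nth_rw 2 [this]
      rw [← ta_pr, ← map_mul]
      exact P0_le hσ x) (hodd.of_dvd_nat b2) (by rw [← card_cl]; exact Nat.card_pos.ne')
  rw [N2_eq] at this
  apply Nat.le_of_mul_le_mul_right _ (Nat.pos_of_ne_zero b3)
  calc _ = N2 M * ((df (su σ)).ker.map (pr M)).relIndex (JJ L M) * 2 *
        (nm (su σ)).range.relIndex ((pr M).ker ⊓ (df (su σ)).ker) := by ring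
    _ ≤ _ := by gcongr
    _ ≤ _ := c1

theorem thmU {σ : M ≃ₐ[L] M} (hσ : σ ≠ 1) (hT : ∀ P, ¬ Ram σ P) :
    ¬ JJ L M ≤ (nm (ta σ)).range ⊔ (df (su σ)).ker.map (pr M) := by
  obtain ⟨c1, c2⟩ := chevalley hσ 0 ∅ (by simp) (fun P hP => absurd hP (hT P))
  have hP : ∀ a ∈ (pr M).range, ta σ a ∈ (pr M).range := by
    rintro _ ⟨x, rfl⟩
    exact ⟨su σ x, ta_pr σ x⟩
  refine U_abs (ta σ) (ta_ta hσ) (pr M).range (JJ L M) _ hP ?_ 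
    (by rw [← card_cl]; exact Nat.card_pos.ne') ?_
  · rintro _ ⟨x, rfl⟩
    rw [← ta_pr, ← map_mul]
    exact P0_le hσ x
  · rw [pow_zero, one_mul] at c1
    exact (Nat.le_mul_of_pos_right _ (Nat.pos_of_ne_zero c2)).trans c1

/-- `u` is not a norm from `M`. -/
def NonNorm (σ : M ≃ₐ[L] M) (u : (𝓞 L)ˣ) : Prop := ∀ x : M, x * σ x ≠ algebraMap L M (u : 𝓞 L)

lemma index_of_nonnorm1 {σ : M ≃ₐ[L] M} (hσ : σ ≠ 1) (u : (𝓞 L)ˣ) (hu : NonNorm σ u)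
    (h0 : (nm (su σ)).range.relIndex ((pr M).ker ⊓ (df (su σ)).ker) ≠ 0) :
    2 ≤ (nm (su σ)).range.relIndex ((pr M).ker ⊓ (df (su σ)).ker) := by
  by_contra! hlt
  have h1 : (nm (su σ)).range.relIndex ((pr M).ker ⊓ (df (su σ)).ker) = 1 := by omega
  rw [Subgroup.relIndex_eq_one, E0_eq hσ] at h1
  obtain ⟨x, hx⟩ := h1 ⟨Units.map (algebraMap (𝓞 L) L : 𝓞 L →* L) u, by
    rw [SetLike.mem_coe, MonoidHom.mem_ker, pr_eq_one]; exact ⟨u, rfl⟩, rfl⟩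
  exact hu x (congrArg Units.val hx)

lemma index_of_nonnorm2 {σ : M ≃ₐ[L] M} (hσ : σ ≠ 1) (u v : (𝓞 L)ˣ) (hu : NonNorm σ u)
    (hv : NonNorm σ v) (huv : NonNorm σ (u * v))
    (h0 : (nm (su σ)).range.relIndex ((pr M).ker ⊓ (df (su σ)).ker) ≠ 0) :
    4 ≤ (nm (su σ)).range.relIndex ((pr M).ker ⊓ (df (su σ)).ker) := by
  have hmem : ∀ u : (𝓞 L)ˣ, (Units.map (algebraMap L M : L →* M) (Units.map (algebraMap (𝓞 L) L : 𝓞 L →* L) u))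
      ∈ (pr M).ker ⊓ (df (su σ)).ker := fun u => by
    rw [E0_eq hσ]
    exact ⟨_, by rw [SetLike.mem_coe, MonoidHom.mem_ker, pr_eq_one]; exact ⟨u, rfl⟩, rfl⟩
  set E0 := (pr M).ker ⊓ (df (su σ)).ker with hE0
  set N := (nm (su σ)).range.subgroupOf E0 with hN
  let w : (𝓞 L)ˣ → E0 := fun u => ⟨_, hmem u⟩
  have hw : ∀ u, NonNorm σ u → w u ∉ N := by
    intro u hu h
    obtain ⟨x, hx⟩ := (Subgroup.mem_subgroupOf.1 h)
    exact hu x (congrArg Units.val hx)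
  have hmul : ∀ a b, w (a * b) = w a * w b := fun a b => by
    apply Subtype.ext; simp [w]
  have hsq : ∀ a : E0, a * a ∈ N := by
    rintro ⟨a, ha⟩
    have h2 := (Subgroup.mem_inf.1 ha).2
    rw [MonoidHom.mem_ker, df_apply, div_eq_one] at h2
    rw [Subgroup.mem_subgroupOf]
    refine ⟨a, ?_⟩
    rw [nm_apply, ← h2]; rfl
  have hf : N.FiniteIndex := ⟨h0⟩
  have : Fintype (E0 ⧸ N) := Fintype.ofFinite _
  rw [Subgroup.relIndex, Subgroup.index, Nat.card_eq_fintype_card]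
  have hqsq : ∀ a : E0, (QuotientGroup.mk a * QuotientGroup.mk a : E0 ⧸ N) = 1 :=
    fun a => (QuotientGroup.eq_one_iff (a * a)).2 (hsq a)
  rw [← Nat.card_eq_fintype_card]
  refine four_le (Q := E0 ⧸ N) (QuotientGroup.mk (w u)) (QuotientGroup.mk (w v)) ?_ ?_ ?_ ?_
  · exact fun h => hw u hu ((QuotientGroup.eq_one_iff _).1 h)
  · exact fun h => hw v hv ((QuotientGroup.eq_one_iff _).1 h)
  · intro h
    apply hw _ huv
    rw [hmul]
    exact (QuotientGroup.eq_one_iff _).1 h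
  · exact hqsq _

end
end CG

open NumberField nonZeroDivisors
set_option linter.all false
namespace CG

lemma fact_tc (L M : Type*) [Field L] [NumberField L] [Field M] [NumberField M] [Algebra L M]
    [Algebra.IsQuadraticExtension L M] [IsTotallyComplex L] :
    Fact (Fintype.card (InfinitePlace M) = 2 * Fintype.card (InfinitePlace L)) := by
  have : IsTotallyComplex M := isTotallyComplex_of_algebra L M
  have h1 := IsTotallyComplex.finrank (K := L)
  have h2 := IsTotallyComplex.finrank (K := M)
  have h3 := Module.finrank_mul_finrank ℚ L M
  rw [Algebra.IsQuadraticExtension.finrank_eq_two L M] at h3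
  have h4 := InfinitePlace.card_eq_nrRealPlaces_add_nrComplexPlaces (K := L)
  have h5 := InfinitePlace.card_eq_nrRealPlaces_add_nrComplexPlaces (K := M)
  rw [IsTotallyComplex.nrRealPlaces_eq_zero] at h4 h5
  exact ⟨by omega⟩

universe u

lemma exists_quad {L : Type u} [Field L] [NumberField L] (γ : L) (h : ¬ IsSquare γ) :
    ∃ (M : Type u) (_ : Field M) (_ : NumberField M) (_ : Algebra L M)
      (_ : Algebra.IsQuadraticExtension L M) (r : M), r ^ 2 = algebraMap L M γ := by
  have hirr : Irreducible (Polynomial.X ^ 2 - Polynomial.C γ) := by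
    refine X_pow_sub_C_irreducible_of_prime Nat.prime_two ?_
    rintro b rfl
    exact h ⟨b, pow_two b⟩
  have : Fact (Irreducible (Polynomial.X ^ 2 - Polynomial.C γ)) := ⟨hirr⟩
  have hne : (Polynomial.X ^ 2 - Polynomial.C γ) ≠ 0 := hirr.ne_zero
  let M := AdjoinRoot (Polynomial.X ^ 2 - Polynomial.C γ)
  have hfd : Module.finrank L M = 2 := by
    rw [(AdjoinRoot.powerBasis hne).finrank, AdjoinRoot.powerBasis_dim]
    compute_degree!
  have hfin : FiniteDimensional L M := Module.finite_of_finrank_pos (by omega)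
  have hcz : CharZero M := charZero_of_injective_algebraMap (algebraMap L M).injective
  have hfd2 : FiniteDimensional ℚ M := Module.Finite.trans L M
  refine ⟨M, inferInstance, ⟨⟩, inferInstance, ⟨hfd⟩, AdjoinRoot.root _, ?_⟩
  have := AdjoinRoot.eval₂_root (Polynomial.X ^ 2 - Polynomial.C γ)
  simp [Polynomial.eval₂_sub] at this
  exact sub_eq_zero.1 this

section
variable {L M : Type*} [Field L] [NumberField L] [Field M] [NumberField M] [Algebra L M]
  [Algebra.IsQuadraticExtension L M]

variable (L M) in
lemma exists_sig : ∃ σ : M ≃ₐ[L] M, σ ≠ 1 := by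
  by_contra! h
  have h1 := card_gal (L := L) (M := M)
  have : Nat.card (M ≃ₐ[L] M) = 1 := Nat.card_eq_one_iff_unique.2 ⟨⟨fun a b => by rw [h a, h b]⟩, ⟨1⟩⟩
  omega

lemma sig_root {σ : M ≃ₐ[L] M} (hσ : σ ≠ 1) {γ : L} (h : ¬ IsSquare γ) {r : M}
    (hr : r ^ 2 = algebraMap L M γ) : σ r = - r := by
  have h1 : (σ r) ^ 2 = r ^ 2 := by rw [← map_pow, hr, σ.commutes]
  rcases sq_eq_sq_iff_eq_or_eq_neg.1 h1 with h2 | h2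
  · obtain ⟨y, hy⟩ := fixed_mem hσ r h2
    exfalso
    apply h
    refine ⟨y, ?_⟩
    apply (algebraMap L M).injective
    rw [← hr, ← hy, map_mul, pow_two]
  · exact h2
end

section
variable {L : Type*} [Field L] [NumberField L]

/-- A criterion for `L(√γ)/L` to be unramified. -/
def UnrSet (γ : L) : Set (𝓞 L) :=
  {g : 𝓞 L | (∃ c : L, c ≠ 0 ∧ algebraMap (𝓞 L) L g = c ^ 2 * γ) ∧ ∃ y z : 𝓞 L, g = y ^ 2 + 4 * z}

def Unr (γ : L) : Prop := Ideal.span (UnrSet γ) = ⊤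

lemma Unr.mul {γ δ : L} (h1 : Unr γ) (h2 : Unr δ) : Unr (γ * δ) := by
  unfold Unr at *
  have h := Ideal.span_mul_span' (UnrSet γ) (UnrSet δ)
  rw [h1, h2, Ideal.top_mul] at h
  rw [eq_top_iff, h]
  apply Ideal.span_mono
  rintro _ ⟨a, ⟨⟨c, hc, e1⟩, y, z, e2⟩, b, ⟨⟨c', hc', e1'⟩, y', z', e2'⟩, rfl⟩
  refine ⟨⟨c * c', mul_ne_zero hc hc', ?_⟩, y * y', y ^ 2 * z' + z * y' ^ 2 + 4 * z * z', ?_⟩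
  · simp only [map_mul, e1, e1']; ring
  · simp only [e2, e2']; ring

lemma Unr.exists_notMem {γ : L} (h : Unr γ) (P : Ideal (𝓞 L)) (hP : P ≠ ⊤) : ∃ g ∈ UnrSet γ, g ∉ P := by
  by_contra! hh
  apply hP
  rw [eq_top_iff, ← h, Ideal.span_le]
  exact hh

lemma ram_mem {M : Type*} [Field M] [NumberField M] [Algebra L M]
    [Algebra.IsQuadraticExtension L M] {γ : L} {g : 𝓞 L} (hg : g ∈ UnrSet γ) {r : M} (hr : r ^ 2 = algebraMap L M γ)
    {σ : M ≃ₐ[L] M} (hσ : σ r = - r) (P : Ideal (𝓞 M)) (hram : Ram σ P) :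
    algebraMap (𝓞 L) (𝓞 M) g ∈ P := by
  obtain ⟨hP, -, hR⟩ := hram
  obtain ⟨⟨c, hc, e1⟩, y, z, e2⟩ := hg
  have e3 : (algebraMap (𝓞 L) L g) = (algebraMap (𝓞 L) L y) ^ 2 + 4 * (algebraMap (𝓞 L) L z) := by
    rw [e2]; simp only [map_add, map_mul, map_pow, map_ofNat]
  set Y : M := algebraMap L M (algebraMap (𝓞 L) L y) with hY
  set Z : M := algebraMap L M (algebraMap (𝓞 L) L z) with hZ
  set C : M := algebraMap L M c with hC
  have e4 : C ^ 2 * r ^ 2 = Y ^ 2 + 4 * Z := by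
    rw [hr, ← map_pow, ← map_mul, ← e1, e3]; simp only [hY, hZ, map_add, map_mul, map_pow, map_ofNat]
  have hYi : IsIntegral ℤ Y := (RingOfIntegers.isIntegral_coe y).map (algebraMap L M).toIntAlgHom
  have hZi : IsIntegral ℤ Z := (RingOfIntegers.isIntegral_coe z).map (algebraMap L M).toIntAlgHom
  have hω : IsIntegral ℤ ((Y + C * r) / 2) := by
    have : ((Y + C * r) / 2) ^ 2 - Y * ((Y + C * r) / 2) - Z = 0 := by
      field_simp
      linear_combination e4
    have i2 : IsIntegral (integralClosure ℤ M) ((Y + C * r) / 2) := by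
      refine ⟨Polynomial.X ^ 2 - Polynomial.C (⟨Y, hYi⟩ : integralClosure ℤ M) * Polynomial.X
        - Polynomial.C (⟨Z, hZi⟩ : integralClosure ℤ M), ?_, ?_⟩
      · rw [sub_sub]
        apply Polynomial.monic_X_pow_sub
        compute_degree!
      · simp only [Polynomial.eval₂_sub, Polynomial.eval₂_mul, Polynomial.eval₂_pow, Polynomial.eval₂_X,
          Polynomial.eval₂_C]
        exact this
    exact isIntegral_trans _ i2
  let w : 𝓞 M := ⟨_, hω⟩
  have h1 := hR w
  have h2 := P.mul_mem_left (sO σ w - w) h1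
  have h3 : (sO σ w - w) * (sO σ w - w) = algebraMap (𝓞 L) (𝓞 M) g := by
    apply RingOfIntegers.ext
    have e5 : algebraMap (𝓞 M) M (sO σ w - w) = - (C * r) := by
      rw [map_sub]
      change σ ((Y + C * r) / 2) - ((Y + C * r) / 2) = _
      simp only [map_div₀, map_add, map_mul, hσ, hY, hC, σ.commutes, map_ofNat]
      ring
    change algebraMap (𝓞 M) M _ = algebraMap (𝓞 M) M _
    rw [map_mul, e5]
    change _ = algebraMap L M (algebraMap (𝓞 L) L g)
    rw [e1, map_mul, map_pow, ← hr]; ring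
  rwa [h3] at h2

lemma Unr.noRam {M : Type*} [Field M] [NumberField M] [Algebra L M]
    [Algebra.IsQuadraticExtension L M] {γ : L} (h : Unr γ) {r : M} (hr : r ^ 2 = algebraMap L M γ)
    {σ : M ≃ₐ[L] M} (hσ : σ r = - r) (P : Ideal (𝓞 M)) : ¬ Ram σ P := by
  intro hram
  have hP := hram.1
  obtain ⟨g, hg, hgP⟩ := h.exists_notMem (P.comap (algebraMap (𝓞 L) (𝓞 M)))
    (Ideal.comap_ne_top _ hP.ne_top)
  exact hgP (ram_mem hg hr hσ P hram)

lemma split_ring {A S : Type*} [CommRing A] [CommRing S] (f : A →+* S) (s : S →+* S)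
    (hsf : ∀ x, s (f x) = f x) (q : Ideal A) (hmax : q.IsMaximal) (h2 : (2 : A) ∉ q)
    (g : A) (hgq : g ∉ q) (a : A) (ha : g - a ^ 2 ∈ q) (R : S) (hR2 : R * R = f g) (hsR : s R = - R) :
    (q.map f ⊔ Ideal.span {R - f a}) * ((q.map f ⊔ Ideal.span {R - f a}).map s) = q.map f := by
  have hq := hmax.isPrime
  have hsB : (q.map f ⊔ Ideal.span {R - f a}).map s = q.map f ⊔ Ideal.span {R + f a} := by
    rw [Ideal.map_sup, Ideal.map_span, Set.image_singleton, Ideal.map_map]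
    have h1 : s.comp f = f := RingHom.ext hsf
    have h3 : s (R - f a) = - (R + f a) := by rw [map_sub, hsR, hsf]; ring
    rw [h1, h3, Ideal.span_singleton_neg]
  have hfg : ∀ x ∈ q, f x ∈ q.map f := fun x hx => Ideal.mem_map_of_mem f hx
  rw [hsB]
  apply le_antisymm
  · rw [Ideal.sup_mul, Ideal.mul_sup, Ideal.mul_sup]
    refine sup_le (sup_le Ideal.mul_le_left Ideal.mul_le_left) (sup_le Ideal.mul_le_right ?_)
    rw [Ideal.span_singleton_mul_span_singleton, Ideal.span_singleton_le_iff_mem]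
    have : (R - f a) * (R + f a) = f (g - a ^ 2) := by
      rw [map_sub, map_pow, ← hR2]; ring
    rw [this]
    exact hfg _ ha
  · have ha2 : 2 * a ∉ q := by
      intro h
      rcases hq.mem_or_mem h with h | h
      · exact h2 h
      · apply hgq
        have := q.add_mem ha (q.mul_mem_left a h)
        rwa [← pow_two, sub_add_cancel] at this
    obtain ⟨u, v, hv, huv⟩ := (Ideal.IsMaximal.exists_inv hmax ha2)
    rw [Ideal.map_le_iff_le_comap]
    intro x hx
    rw [Ideal.mem_comap]
    have m1 : f x * f v ∈ (q.map f ⊔ Ideal.span {R - f a}) * (q.map f ⊔ Ideal.span {R + f a}) :=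
      Ideal.mul_mem_mul (Ideal.mem_sup_left (hfg x hx)) (Ideal.mem_sup_left (hfg v hv))
    have m2 : f x * (R + f a) ∈ (q.map f ⊔ Ideal.span {R - f a}) * (q.map f ⊔ Ideal.span {R + f a}) :=
      Ideal.mul_mem_mul (Ideal.mem_sup_left (hfg x hx))
        (Ideal.mem_sup_right (Ideal.mem_span_singleton_self _))
    have m3 : (R - f a) * f x ∈ (q.map f ⊔ Ideal.span {R - f a}) * (q.map f ⊔ Ideal.span {R + f a}) :=
      Ideal.mul_mem_mul (Ideal.mem_sup_right (Ideal.mem_span_singleton_self _))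
        (Ideal.mem_sup_left (hfg x hx)) 
    have : f x = f u * (f x * (R + f a) - (R - f a) * f x) + f x * f v := by
      have h5 := congrArg f huv
      simp only [map_add, map_mul, map_one, map_ofNat] at h5
      linear_combination (-(f x)) * h5
    rw [this]
    exact Ideal.add_mem _ (Ideal.mul_mem_left _ _ (Ideal.sub_mem _ m2 m3)) m1

lemma split_aux {M : Type*} [Field M] [NumberField M] [Algebra L M]
    [Algebra.IsQuadraticExtension L M] {σ : M ≃ₐ[L] M} (q : Ideal (𝓞 L)) (hq0 : q ≠ ⊥)
    (B : Ideal (𝓞 M)) (h : B * sI σ B = q.map (algebraMap (𝓞 L) (𝓞 M))) :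
    jm (algebraMap L M) (mk q hq0) ∈ (nm (ta σ)).range := by
  have hqM : q.map (algebraMap (𝓞 L) (𝓞 M)) ≠ ⊥ := map_ne_bot (algebraMap L M) hq0
  have hB0 : B ≠ ⊥ := by
    rintro rfl
    apply hqM
    rw [← h]; exact Ideal.bot_mul _
  refine ⟨mk B hB0, ?_⟩
  have h1 : mk (B * sI σ B) (mul_ne_zero hB0 (map_ne_bot _ hB0)) = jm (algebraMap L M) (mk q hq0) := by
    rw [mk_congr h]
    exact (jm_mk _ _ _).symm
  rw [nm_apply, ta_mk, ← h1]
  exact (mk_mul _ _ _ _).symm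

lemma split_prime {M : Type*} [Field M] [NumberField M] [Algebra L M]
    [Algebra.IsQuadraticExtension L M] {γ : L} {r : M} (hr : r ^ 2 = algebraMap L M γ)
    {σ : M ≃ₐ[L] M} (hσ : σ r = - r) (q : Ideal (𝓞 L)) (hq : q.IsPrime) (hq0 : q ≠ ⊥)
    (h2 : (2 : 𝓞 L) ∉ q) (g : 𝓞 L) (c : L) (hg : algebraMap (𝓞 L) L g = c ^ 2 * γ) (hgq : g ∉ q)
    (a : 𝓞 L) (ha : g - a ^ 2 ∈ q) :
    jm (algebraMap L M) (mk q hq0) ∈ (nm (ta σ)).range := by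
  have hR : IsIntegral ℤ (algebraMap L M c * r) := by
    apply IsIntegral.of_pow (n := 2) (by norm_num)
    rw [mul_pow, hr, ← map_pow, ← map_mul, ← hg]
    exact (RingOfIntegers.isIntegral_coe g).map (algebraMap L M).toIntAlgHom
  let R : 𝓞 M := ⟨_, hR⟩
  have hR2 : R * R = algebraMap (𝓞 L) (𝓞 M) g := by
    apply RingOfIntegers.ext
    change (algebraMap L M c * r) * (algebraMap L M c * r) = algebraMap L M (algebraMap (𝓞 L) L g)
    rw [hg, map_mul, map_pow, ← hr]; ring
  have hsR : sO σ R = - R := by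
    apply RingOfIntegers.ext
    change σ (algebraMap L M c * r) = - (algebraMap L M c * r)
    rw [map_mul, σ.commutes, hσ]; ring
  have hsf : ∀ x, sO σ (algebraMap (𝓞 L) (𝓞 M) x) = algebraMap (𝓞 L) (𝓞 M) x := by
    intro x
    apply RingOfIntegers.ext
    change σ (algebraMap L M (algebraMap (𝓞 L) L x)) = algebraMap L M (algebraMap (𝓞 L) L x)
    exact σ.commutes _
  have hprod := split_ring (algebraMap (𝓞 L) (𝓞 M)) (sO σ) hsf q (hq.isMaximal hq0) h2 g hgq a ha R hR2 hsR
  exact split_aux q hq0 _ hprod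

set_option maxHeartbeats 400000 in
lemma unrH [IsTotallyComplex L] {γ : L} (hγ : ¬ IsSquare γ) (hu : Unr γ) :
    ∃ H : Subgroup (Fr L), H ≠ ⊤ ∧ (pr L).range ≤ H ∧ (∀ a, a ^ 2 ∈ H) ∧
      ∀ (q : Ideal (𝓞 L)) (hq0 : q ≠ ⊥), q.IsPrime → (2 : 𝓞 L) ∉ q → ∀ g ∈ UnrSet γ, g ∉ q →
        ∀ a : 𝓞 L, g - a ^ 2 ∈ q → mk q hq0 ∈ H := by
  obtain ⟨M, _, _, _, _, r, hr⟩ := exists_quad γ hγ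
  obtain ⟨σ, hσ⟩ := exists_sig L M
  have hσr := sig_root hσ hγ hr
  have := fact_tc L M
  have hU := thmU hσ (hu.noRam hr hσr)
  refine ⟨((nm (ta σ)).range ⊔ (df (su σ)).ker.map (pr M)).comap (jm (algebraMap L M)), ?_, ?_, ?_, ?_⟩
  · intro h
    apply hU
    rintro _ ⟨a, rfl⟩
    have : a ∈ (⊤ : Subgroup (Fr L)) := trivial
    rw [← h] at this
    exact this
  · rintro _ ⟨x, rfl⟩
    apply Subgroup.mem_sup_right
    rw [ker_df_su hσ, map_pr_range]
    exact ⟨_, ⟨x, rfl⟩, rfl⟩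
  · intro a
    apply Subgroup.mem_sup_left
    refine ⟨jm (algebraMap L M) a, ?_⟩
    rw [nm_apply, ta_j, map_pow, pow_two]
  · rintro q hq0 hq h2 g ⟨⟨c, hc, hg⟩, -⟩ hgq a ha
    exact Subgroup.mem_sup_left (split_prime hr hσr q hq hq0 h2 g c hg hgq a ha)
end
end CG

open NumberField nonZeroDivisors
set_option linter.all false
namespace CG

section
variable {G : Type*} [CommGroup G] [Finite G]

lemma ker_le_two (h : IsCyclic (CommGroup.primaryComponent G 2)) :
    Nat.card (powMonoidHom 2 : G →* G).ker ≤ 2 := by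
  classical
  have : Fintype (CommGroup.primaryComponent G 2) := Fintype.ofFinite _
  have h1 := IsCyclic.card_pow_eq_one_le (α := CommGroup.primaryComponent G 2) (n := 2) (by norm_num)
  refine le_trans ?_ h1
  rw [← Fintype.card_coe, ← Nat.card_eq_fintype_card]
  have hm : ∀ x : (powMonoidHom 2 : G →* G).ker, (x : G) ^ 2 = 1 := fun x => by
    have := x.2
    rwa [MonoidHom.mem_ker, powMonoidHom_apply] at this
  refine Nat.card_le_card_of_injective (fun x => ⟨⟨x.1, ?_⟩, ?_⟩) ?_
  · rw [CommGroup.mem_primaryComponent]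
    exact ⟨1, by simpa using hm x⟩
  · simp only [Finset.mem_filter, Finset.mem_univ, true_and]
    ext
    exact hm x
  · intro x y hxy
    simp only [Subtype.mk.injEq] at hxy
    exact Subtype.ext hxy

lemma cyclic_of_ker (h : Nat.card (powMonoidHom 2 : G →* G).ker ≤ 2) :
    IsCyclic (CommGroup.primaryComponent G 2) := by
  set A := CommGroup.primaryComponent G 2
  have hA : IsPGroup 2 A := CommGroup.primaryComponent.isPGroup
  have key : ∀ k : ℕ, Nat.card (powMonoidHom (2 ^ k) : G →* G).ker ≤ 2 ^ k := by
    intro k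
    induction k with
    | zero =>
      have : (powMonoidHom (2 ^ 0) : G →* G).ker = ⊥ := by
        ext x; simp [MonoidHom.mem_ker]
      rw [this]; simp
    | succ k ih =>
      let f : (powMonoidHom (2 ^ (k + 1)) : G →* G).ker →* (powMonoidHom (2 ^ k) : G →* G).ker :=
        ((powMonoidHom 2 : G →* G).comp (Subgroup.subtype _)).codRestrict _ (by
          rintro ⟨x, hx⟩
          rw [MonoidHom.mem_ker] at hx ⊢
          simp only [powMonoidHom_apply, MonoidHom.comp_apply, Subgroup.coe_subtype] at hx ⊢
          rw [← pow_mul, ← pow_succ', hx])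
      have h1 : Nat.card f.ker ≤ 2 := by
        refine le_trans (Nat.card_le_card_of_injective
          (fun x : f.ker => (⟨(x.1 : G), ?_⟩ : (powMonoidHom 2 : G →* G).ker)) ?_) h
        · have := congrArg Subtype.val ((MonoidHom.mem_ker).1 x.2)
          rw [MonoidHom.mem_ker]
          exact this
        · intro x y hxy
          simp only [Subtype.mk.injEq] at hxy
          exact Subtype.ext (Subtype.ext hxy)
      have h2 := Subgroup.card_mul_index f.ker
      rw [Subgroup.index_ker] at h2
      have h3 : Nat.card f.range ≤ 2 ^ k := (Subgroup.card_le_card_group _).trans ih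
      refine h2.symm.le.trans ((Nat.mul_le_mul h1 h3).trans (le_of_eq (pow_succ' 2 k).symm))
  classical
  have : Fintype A := Fintype.ofFinite _
  apply isCyclic_of_card_pow_eq_one_le
  intro n hn
  obtain ⟨k, m, hm, rfl⟩ := Nat.exists_eq_two_pow_mul_odd hn.ne'
  have h3 : (Finset.univ.filter fun a : A => a ^ (2 ^ k * m) = 1).card ≤ 2 ^ k := by
    refine le_trans ?_ (key k)
    rw [← Fintype.card_coe, ← Nat.card_eq_fintype_card]
    refine Nat.card_le_card_of_injective (fun x => ⟨(x.1 : G), ?_⟩) ?_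
    · have hx := (Finset.mem_filter.1 x.2).2
      rw [MonoidHom.mem_ker, powMonoidHom_apply]
      obtain ⟨j, hj⟩ := hA x.1
      have hd1 := orderOf_dvd_of_pow_eq_one hx
      have hd2 := orderOf_dvd_of_pow_eq_one hj
      have hc : Nat.Coprime (orderOf x.1) m := by
        apply Nat.Coprime.coprime_dvd_left hd2
        apply Nat.Coprime.pow_left
        rw [Nat.coprime_two_left]; exact hm
      have h5 := hc.dvd_of_dvd_mul_right hd1
      have h6 := orderOf_dvd_iff_pow_eq_one.1 h5
      exact congrArg Subtype.val h6
    · intro x y hxy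
      simp only [Subtype.mk.injEq] at hxy
      exact Subtype.ext (Subtype.ext hxy)
  refine h3.trans ?_
  exact Nat.le_mul_of_pos_right _ hm.pos

lemma nontrivial_iff_even : Nontrivial (CommGroup.primaryComponent G 2) ↔ Even (Nat.card G) := by
  constructor
  · intro h
    obtain ⟨x, hx⟩ := exists_ne (1 : CommGroup.primaryComponent G 2)
    obtain ⟨k, hk⟩ := CommGroup.mem_primaryComponent.1 x.2
    obtain ⟨j, hj, hj2⟩ := (Nat.dvd_prime_pow Nat.prime_two).1 (orderOf_dvd_of_pow_eq_one hk)
    have h1 : orderOf (x : G) ∣ Nat.card G := orderOf_dvd_natCard _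
    rw [hj2] at h1
    rcases Nat.eq_zero_or_pos j with rfl | hjp
    · exfalso
      rw [pow_zero, orderOf_eq_one_iff] at hj2
      exact hx (Subtype.ext hj2)
    · exact even_iff_two_dvd.2 ((dvd_pow_self 2 hjp.ne').trans h1)
  · intro h
    obtain ⟨x, hx⟩ := exists_prime_orderOf_dvd_card' (G := G) 2 h.two_dvd
    refine ⟨⟨⟨x, CommGroup.mem_primaryComponent.2 ⟨1, ?_⟩⟩, 1, ?_⟩⟩
    · rw [pow_one, ← hx, pow_orderOf_eq_one]
    · intro hh
      have : x = 1 := congrArg Subtype.val hh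
      rw [this] at hx
      simp at hx

lemma eq_sq_of_cyclic (h : Nat.card (powMonoidHom 2 : G →* G).ker ≤ 2) (H : Subgroup G) (hH : H ≠ ⊤)
    (h2 : ∀ x, x ^ 2 ∈ H) : H = (powMonoidHom 2 : G →* G).range := by
  have hle : (powMonoidHom 2 : G →* G).range ≤ H := by
    rintro _ ⟨x, rfl⟩; exact h2 x
  have h3 : (powMonoidHom 2 : G →* G).range.index ≤ 2 := by
    have h4 := Subgroup.card_mul_index (powMonoidHom 2 : G →* G).ker
    have h5 := Subgroup.card_mul_index (powMonoidHom 2 : G →* G).range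
    rw [Subgroup.index_ker, ← h5, mul_comm] at h4
    have := Nat.eq_of_mul_eq_mul_left Nat.card_pos h4
    omega
  have h6 := Subgroup.relIndex_mul_index hle
  have h7 : H.index ≠ 1 := fun h => hH (Subgroup.index_eq_one.1 h)
  have h8 : H.index ≠ 0 := Subgroup.index_ne_zero_of_finite
  have h9 : (powMonoidHom 2 : G →* G).range.relIndex H ≠ 0 := by
    intro h0
    rw [h0, zero_mul] at h6
    exact Subgroup.index_ne_zero_of_finite h6.symm
  have h10 : (powMonoidHom 2 : G →* G).range.relIndex H = 1 := by
    have : 2 ≤ H.index := by omega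
    nlinarith [Nat.pos_of_ne_zero h9]
  exact le_antisymm (Subgroup.relIndex_eq_one.1 h10) hle
end

section
variable {L : Type*} [Field L] [NumberField L]

lemma two_not_top : (Ideal.span {(2 : 𝓞 L)} : Ideal (𝓞 L)) ≠ ⊤ := by
  rw [Ne, Ideal.span_singleton_eq_top]
  intro h
  have h1 : IsUnit (Algebra.norm ℤ (2 : 𝓞 L)) := h.map (Algebra.norm ℤ)
  have h2 := Algebra.norm_algebraMap (R := ℤ) (S := 𝓞 L) 2
  rw [map_ofNat] at h2
  rw [h2] at h1
  have h3 : Module.finrank ℤ (𝓞 L) ≠ 0 := by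
    rw [RingOfIntegers.rank]; exact Module.finrank_pos.ne'
  rw [isUnit_pow_iff h3] at h1
  exact absurd h1 (by decide)

/-- a proper subgroup of ideals containing principal ideals misses a prime not above 2 -/
lemma exists_prime_notMem (S : Subgroup (Fr L)) (hS : S ≠ ⊤) (hp : (pr L).range ≤ S) :
    ∃ (q : Ideal (𝓞 L)) (hq0 : q ≠ ⊥), q.IsPrime ∧ (2 : 𝓞 L) ∉ q ∧ mk q hq0 ∉ S := by
  by_contra! hcon
  have h1 : ∀ (B : Ideal (𝓞 L)) (hB : B ≠ ⊥), Ideal.span {2} ⊔ B = ⊤ → mk B hB ∈ S := by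
    intro B hB
    induction B using UniqueFactorizationMonoid.induction_on_prime with
    | h₁ => exact absurd rfl hB
    | h₂ x hx =>
      intro _
      have : x = ⊤ := Ideal.isUnit_iff.1 hx
      subst this
      rw [mk_top]; exact one_mem _
    | h₃ a p ha hpp ih =>
      intro hh
      rw [mk_mul p a hpp.ne_zero ha]
      have hp1 : Ideal.span {2} ⊔ p = ⊤ := by
        rw [eq_top_iff, ← hh]; exact sup_le_sup_left Ideal.mul_le_left _
      have ha1 : Ideal.span {2} ⊔ a = ⊤ := by
        rw [eq_top_iff, ← hh]; exact sup_le_sup_left Ideal.mul_le_right _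
      have hpr := Ideal.isPrime_of_prime hpp
      refine mul_mem (hcon p hpp.ne_zero hpr ?_) (ih ha ha1)
      intro h2
      apply hpr.ne_top
      rw [← hp1]
      exact (sup_eq_right.2 ((Ideal.span_singleton_le_iff_mem _).2 h2)).symm
  apply hS
  rw [eq_top_iff]
  intro a _
  obtain ⟨A, hA, x, hx, -⟩ := exists_mk_div a
  have h2 : mk A hA ∈ S := by
    have h20 : (Ideal.span {(2 : 𝓞 L)} : Ideal (𝓞 L)) ≠ 0 := by
      rw [Ne, Ideal.zero_eq_bot, Ideal.span_singleton_eq_bot]; norm_num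
    obtain ⟨y, hy⟩ := IsDedekindDomain.exists_sup_span_eq (I := A * Ideal.span {2}) (J := A)
      Ideal.mul_le_left (mul_ne_zero hA h20)
    have hyA : Ideal.span {y} ≤ A := by
      rw [← hy]; exact le_sup_right
    obtain ⟨B, hB⟩ := Ideal.dvd_iff_le.2 hyA
    rw [hB, ← Ideal.mul_sup] at hy
    have hB2 : Ideal.span {2} ⊔ B = ⊤ := by
      have : A * (Ideal.span {2} ⊔ B) = A * ⊤ := by rw [hy, Ideal.mul_top]
      exact mul_left_cancel₀ hA this
    have hB0 : B ≠ ⊥ := by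
      rintro rfl
      rw [sup_bot_eq] at hB2
      exact two_not_top hB2
    have hy0 : y ≠ 0 := by
      rintro rfl
      rw [Ideal.span_singleton_zero] at hB
      exact mul_ne_zero hA hB0 hB.symm
    have hy0' : algebraMap (𝓞 L) L y ≠ 0 := by
      rw [Ne, FaithfulSMul.algebraMap_eq_zero_iff]; exact hy0
    have hm := mk_mul A B hA hB0
    have hpy : mk A hA * mk B hB0 = pr L (Units.mk0 _ hy0') := by
      rw [← hm]
      apply Units.ext
      rw [mk_val, coe_toPrincipalIdeal, ← hB]
      simp [FractionalIdeal.coeIdeal_span_singleton]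
    have : mk A hA = pr L (Units.mk0 _ hy0') * (mk B hB0)⁻¹ := by
      rw [← hpy, mul_inv_cancel_right]
    rw [this]
    exact mul_mem (hp ⟨_, rfl⟩) (inv_mem (h1 B hB0 hB2))
  rw [← hx] at h2
  exact (Subgroup.mul_mem_cancel_right S (hp ⟨x, rfl⟩)).1 h2

lemma one_square {F : Type*} [Field F] [Finite F] (a b : F) : IsSquare a ∨ IsSquare b ∨ IsSquare (a * b) := by
  classical
  have : Fintype F := Fintype.ofFinite _
  by_cases h2 : ringChar F = 2
  · exact Or.inl (FiniteField.isSquare_of_char_two h2 a)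
  by_cases ha : a = 0
  · left; rw [ha]; exact IsSquare.zero
  by_cases hb : b = 0
  · right; left; rw [hb]; exact IsSquare.zero
  by_cases h : IsSquare a
  · exact Or.inl h
  by_cases h' : IsSquare b
  · exact Or.inr (Or.inl h')
  right; right
  have e1 := quadraticChar_neg_one_iff_not_isSquare.2 h
  have e2 := quadraticChar_neg_one_iff_not_isSquare.2 h'
  rw [← quadraticChar_one_iff_isSquare (mul_ne_zero ha hb), map_mul, e1, e2]
  norm_num

lemma square_mod (q : Ideal (𝓞 L)) (hq : q.IsPrime) (hq0 : q ≠ ⊥) (g1 g2 : 𝓞 L) :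
    ∃ a : 𝓞 L, g1 - a ^ 2 ∈ q ∨ g2 - a ^ 2 ∈ q ∨ g1 * g2 - a ^ 2 ∈ q := by
  have hmax := hq.isMaximal hq0
  letI := Ideal.Quotient.field q
  have : Finite (𝓞 L ⧸ q) := Ideal.finiteQuotientOfFreeOfNeBot q hq0
  have key : ∀ g : 𝓞 L, IsSquare (Ideal.Quotient.mk q g) → ∃ a, g - a ^ 2 ∈ q := by
    rintro g ⟨r, hr⟩
    obtain ⟨a, rfl⟩ := Ideal.Quotient.mk_surjective r
    refine ⟨a, ?_⟩
    rw [← Ideal.Quotient.eq, hr, map_pow, pow_two]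
  rcases one_square (Ideal.Quotient.mk q g1) (Ideal.Quotient.mk q g2) with h | h | h
  · obtain ⟨a, ha⟩ := key _ h; exact ⟨a, Or.inl ha⟩
  · obtain ⟨a, ha⟩ := key _ h; exact ⟨a, Or.inr (Or.inl ha)⟩
  · rw [← map_mul] at h
    obtain ⟨a, ha⟩ := key _ h; exact ⟨a, Or.inr (Or.inr ha)⟩

lemma H_eq (h : N2 L ≤ 2) (H : Subgroup (Fr L)) (hH : H ≠ ⊤) (hp : (pr L).range ≤ H)
    (h2 : ∀ a, a ^ 2 ∈ H) : H = (powMonoidHom 2 : ClassGroup (𝓞 L) →* _).range.comap (cls L) := by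
  have h3 : (H.map (cls L)).comap (cls L) = H := by
    rw [Subgroup.comap_map_eq, cls_ker, sup_eq_left.2 hp]
  rw [← eq_sq_of_cyclic h (H.map (cls L)) ?_ ?_, h3]
  · intro ht
    rw [ht, Subgroup.comap_top] at h3
    exact hH h3.symm
  · intro x
    obtain ⟨a, rfl⟩ := cls_surj L x
    rw [← map_pow]
    exact ⟨_, h2 a, rfl⟩

lemma UnrSet_mul {γ δ : L} {g g' : 𝓞 L} (h : g ∈ UnrSet γ) (h' : g' ∈ UnrSet δ) : g * g' ∈ UnrSet (γ * δ) := by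
  obtain ⟨⟨c, hc, e1⟩, y, z, e2⟩ := h
  obtain ⟨⟨c', hc', e1'⟩, y', z', e2'⟩ := h'
  refine ⟨⟨c * c', mul_ne_zero hc hc', ?_⟩, y * y', y ^ 2 * z' + z * y' ^ 2 + 4 * z * z', ?_⟩
  · simp only [map_mul, e1, e1']; ring
  · simp only [e2, e2']; ring

theorem V4 [IsTotallyComplex L] {γ δ : L} (h1 : ¬ IsSquare γ) (h2 : ¬ IsSquare δ) (h3 : ¬ IsSquare (γ * δ))
    (hγ : Unr γ) (hδ : Unr δ) : ¬ IsCyclic (CommGroup.primaryComponent (ClassGroup (𝓞 L)) 2) := by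
  intro hc
  have hN : N2 L ≤ 2 := ker_le_two hc
  obtain ⟨H1, a1, b1, c1, d1⟩ := unrH h1 hγ
  obtain ⟨H2, a2, b2, c2, d2⟩ := unrH h2 hδ
  obtain ⟨H3, a3, b3, c3, d3⟩ := unrH h3 (hγ.mul hδ)
  have e1 := H_eq hN H1 a1 b1 c1
  have e2 := H_eq hN H2 a2 b2 c2
  have e3 := H_eq hN H3 a3 b3 c3
  rw [← e1] at e2 e3
  subst e2 e3
  obtain ⟨q, hq0, hq, hq2, hqS⟩ := exists_prime_notMem _ a1 b1
  obtain ⟨g1, m1, n1⟩ := hγ.exists_notMem q hq.ne_top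
  obtain ⟨g2, m2, n2⟩ := hδ.exists_notMem q hq.ne_top
  obtain ⟨a, h | h | h⟩ := square_mod q hq hq0 g1 g2
  · exact hqS (d1 q hq0 hq hq2 g1 m1 n1 a h)
  · exact hqS (d2 q hq0 hq hq2 g2 m2 n2 a h)
  · exact hqS (d3 q hq0 hq hq2 _ (UnrSet_mul m1 m2) (fun hh => (hq.mem_or_mem hh).elim n1 n2) a h)

theorem nontriv_of_unr [IsTotallyComplex L] {γ : L} (h1 : ¬ IsSquare γ) (hγ : Unr γ) :
    Nontrivial (CommGroup.primaryComponent (ClassGroup (𝓞 L)) 2) := by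
  rw [nontrivial_iff_even]
  by_contra hodd
  rw [Nat.not_even_iff_odd] at hodd
  obtain ⟨H1, a1, b1, c1, d1⟩ := unrH h1 hγ
  apply a1
  rw [eq_top_iff]
  intro a _
  have h2 : a ^ (Nat.card (ClassGroup (𝓞 L))) ∈ H1 := by
    apply b1
    rw [← cls_ker, MonoidHom.mem_ker, map_pow, pow_card_eq_one']
  obtain ⟨k, hk⟩ := hodd
  rw [hk, pow_succ, pow_mul'] at h2
  have h3 : (a ^ k) ^ 2 ∈ H1 := c1 _
  exact (Subgroup.mul_mem_cancel_left H1 h3).1 h2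

end
end CG

open NumberField nonZeroDivisors
set_option linter.all false
namespace CG
open IsDedekindDomain

section
variable {K : Type*} [Field K] [NumberField K]

/-- additive valuation -/
noncomputable def od (v : HeightOneSpectrum (𝓞 K)) (x : K) : ℤ := WithZero.log (v.valuation K x)

lemma od_mul (v : HeightOneSpectrum (𝓞 K)) {x y : K} (hx : x ≠ 0) (hy : y ≠ 0) :
    od v (x * y) = od v x + od v y := by
  rw [od, map_mul, WithZero.log_mul] <;> simp [od, hx, hy]

lemma od_pow (v : HeightOneSpectrum (𝓞 K)) (x : K) (n : ℕ) : od v (x ^ n) = n * od v x := by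
  rw [od, map_pow, WithZero.log_pow]; simp [od]

lemma od_notMem (v : HeightOneSpectrum (𝓞 K)) {x : 𝓞 K} (h : x ∉ v.asIdeal) : od v (x : K) = 0 := by
  have : v.valuation K (algebraMap (𝓞 K) K x) = 1 := by
    rw [HeightOneSpectrum.valuation_of_algebraMap]
    exact v.intValuation_eq_one_iff.2 h
  rw [od]
  change WithZero.log (v.valuation K (algebraMap (𝓞 K) K x)) = 0
  rw [this, WithZero.log_one]

lemma od_mem (v : HeightOneSpectrum (𝓞 K)) {x : 𝓞 K} (h : x ∈ v.asIdeal) (h2 : x ∉ v.asIdeal ^ 2) :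
    od v (x : K) = -1 := by
  have hx : x ≠ 0 := by rintro rfl; exact h2 (zero_mem _)
  have h3 := (v.intValuation_le_pow_iff_mem x 1).2 (by rwa [pow_one])
  have h4 := mt (v.intValuation_le_pow_iff_mem x 2).1 h2
  have hne : v.intValuation x ≠ 0 := v.intValuation_ne_zero x hx
  rw [od]
  change WithZero.log (v.valuation K (algebraMap (𝓞 K) K x)) = -1
  rw [HeightOneSpectrum.valuation_of_algebraMap]
  rw [← WithZero.log_le_iff_le_exp hne] at h3 h4
  push_cast at *
  omega

/-- `γ` has odd valuation at `v` if `γ ∈ v` -/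
def OddAt (v : HeightOneSpectrum (𝓞 K)) (g : 𝓞 K) : Prop := g ∈ v.asIdeal → Odd (od v (g : K))

lemma oddAt_of_dvd {v : HeightOneSpectrum (𝓞 K)} {g d : 𝓞 K} (h : g ∣ d) (hd : d ∉ v.asIdeal ^ 2) : OddAt v g := by
  intro hg
  rw [od_mem v hg (fun h2 => hd (Ideal.mem_of_dvd _ h h2))]
  decide

lemma od_parity {v : HeightOneSpectrum (𝓞 K)} {g : 𝓞 K} (h : OddAt v g) : Odd (od v (g : K)) ↔ g ∈ v.asIdeal := by
  constructor
  · intro h1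
    by_contra h2
    rw [od_notMem v h2] at h1
    exact absurd h1 (by decide)
  · exact h

variable {L : Type*} [Field L] [NumberField L] [Algebra K L] [Algebra.IsQuadraticExtension K L]

lemma rep {d : K} (hd : ¬ IsSquare d) {r : L} (hr : r ^ 2 = algebraMap K L d) (x : L) :
    ∃ a b : K, x = algebraMap K L a + algebraMap K L b * r := by
  obtain ⟨σ, hσ⟩ := exists_sig K L
  have hs := sig_root hσ hd hr
  have hr0 : r ≠ 0 := by
    rintro rfl
    apply hd
    have : algebraMap K L d = algebraMap K L 0 := by rw [← hr, map_zero]; norm_num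
    rw [(algebraMap K L).injective this]; exact IsSquare.zero
  obtain ⟨a, ha⟩ := fixed_mem hσ (x + σ x) (by rw [map_add, sig_sig hσ, add_comm])
  obtain ⟨b, hb⟩ := fixed_mem hσ ((x - σ x) / r) (by
    rw [map_div₀, map_sub, sig_sig hσ, hs, div_neg, ← neg_div, neg_sub])
  refine ⟨a / 2, b / 2, ?_⟩
  rw [map_div₀, map_div₀, ha, hb, map_ofNat]
  field_simp
  ring

lemma not_sq_quad {d : K} (hd : ¬ IsSquare d) {r : L} (hr : r ^ 2 = algebraMap K L d) {γ : K}
    (h1 : ¬ IsSquare γ) (h2 : ¬ IsSquare (γ * d)) : ¬ IsSquare (algebraMap K L γ) := by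
  rintro ⟨x, hx⟩
  obtain ⟨σ, hσ⟩ := exists_sig K L
  have hsq : (σ x) ^ 2 = x ^ 2 := by rw [← map_pow, pow_two, ← hx, σ.commutes]
  rcases sq_eq_sq_iff_eq_or_eq_neg.1 hsq with h | h
  · obtain ⟨a, rfl⟩ := fixed_mem hσ x h
    apply h1
    exact ⟨a, (algebraMap K L).injective (by rw [hx, map_mul])⟩
  · have hs := sig_root hσ hd hr
    obtain ⟨a, ha⟩ := fixed_mem hσ (x * r) (by rw [map_mul, h, hs]; ring)
    apply h2
    refine ⟨a, (algebraMap K L).injective ?_⟩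
    rw [map_mul, map_mul, hx, ← hr, ha]; ring

lemma not_sq_of_od {v : HeightOneSpectrum (𝓞 K)} {x : K} (h : Odd (od v x)) : ¬ IsSquare x := by
  rintro ⟨y, rfl⟩
  rw [← pow_two, od_pow] at h
  push_cast at h
  exact absurd h (by rw [Int.not_odd_iff_even]; exact even_two_mul _)

lemma not_sq_L {d : 𝓞 K} {r : L} (hr : r ^ 2 = algebraMap K L d) {γ : K} (hγ : γ ≠ 0)
    {v w : HeightOneSpectrum (𝓞 K)} (hv : Odd (od v (d : K))) (hw : Odd (od w (d : K)))
    (h1 : Odd (od v γ)) (h2 : ¬ Odd (od w γ)) : ¬ IsSquare (algebraMap K L γ) := by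
  have hd0 : (d : K) ≠ 0 := by
    intro h0; rw [h0, od, map_zero, WithZero.log_zero] at hv; exact absurd hv (by decide)
  refine not_sq_quad (not_sq_of_od hv) hr (not_sq_of_od h1) (not_sq_of_od (v := w) ?_)
  rw [od_mul w hγ hd0]
  rw [Int.not_odd_iff_even] at h2
  exact h2.add_odd hw

lemma isTC (K L : Type*) [Field K] [NumberField K] [Field L] [NumberField L] [Algebra K L] [IsTotallyComplex K] :
    IsTotallyComplex L := isTotallyComplex_of_algebra K L

/-- Unramifiedness criterion coming from the base field. -/
lemma unr_of_base {d : 𝓞 K} {r : L} (hr : r ^ 2 = algebraMap K L d) (g g' c : 𝓞 K) (hc : c ≠ 0) (hd : d ≠ 0)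
    (hgg : g * g' = c ^ 2 * d)
    (hcop : ∀ P : Ideal (𝓞 K), P.IsPrime → g ∈ P → g' ∉ P) (hg : ∃ y z, g = y ^ 2 + 4 * z)
    (hg' : ∃ y z, g' = y ^ 2 + 4 * z) : Unr (algebraMap K L g) := by
  have hg0 : (algebraMap (𝓞 K) K g) ≠ 0 := by
    rw [Ne, FaithfulSMul.algebraMap_eq_zero_iff]
    rintro rfl
    rw [zero_mul] at hgg
    exact mul_ne_zero (pow_ne_zero 2 hc) hd hgg.symm
  have hg0' : (algebraMap (𝓞 K) K g') ≠ 0 := by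
    rw [Ne, FaithfulSMul.algebraMap_eq_zero_iff]
    rintro rfl
    rw [mul_zero] at hgg
    exact mul_ne_zero (pow_ne_zero 2 hc) hd hgg.symm
  set j := algebraMap (𝓞 K) (𝓞 L) with hj
  have m1 : j g ∈ UnrSet (algebraMap K L g) := by
    obtain ⟨y, z, h⟩ := hg
    refine ⟨⟨1, one_ne_zero, ?_⟩, j y, j z, ?_⟩
    · rw [one_pow, one_mul]; rfl
    · rw [h, map_add, map_mul, map_pow, map_ofNat]
  have m2 : j g' ∈ UnrSet (algebraMap K L g) := by
    obtain ⟨y, z, h⟩ := hg'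
    have e1 := congrArg (fun x => algebraMap K L (algebraMap (𝓞 K) K x)) hgg
    simp only [map_mul, map_pow] at e1
    have a1 : algebraMap K L (algebraMap (𝓞 K) K g) ≠ 0 := by simpa using hg0
    have a2 : algebraMap K L (algebraMap (𝓞 K) K c) ≠ 0 := by simpa using hc
    have a3 : r ≠ 0 := by
      rintro rfl
      apply hd
      have : algebraMap K L (algebraMap (𝓞 K) K d) = 0 := by rw [← hr]; norm_num
      simpa using this
    refine ⟨⟨algebraMap K L (algebraMap (𝓞 K) K c) * r / algebraMap K L (algebraMap (𝓞 K) K g),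
      div_ne_zero (mul_ne_zero a2 a3) a1, ?_⟩, j y, j z, ?_⟩
    · have : algebraMap (𝓞 L) L (j g') = algebraMap K L (algebraMap (𝓞 K) K g') := rfl
      rw [this, div_pow, mul_pow, hr]
      field_simp
      linear_combination e1
    · rw [h, map_add, map_mul, map_pow, map_ofNat]
  rw [Unr]
  have htop : Ideal.span {g, g'} = (⊤ : Ideal (𝓞 K)) := by
    by_contra hne
    obtain ⟨P, hP, hle⟩ := Ideal.exists_le_maximal _ hne
    exact hcop P hP.isPrime (hle (Ideal.subset_span (by simp))) (hle (Ideal.subset_span (by simp)))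
  rw [eq_top_iff, ← Ideal.map_top j, ← htop, Ideal.map_span]
  apply Ideal.span_mono
  rintro _ ⟨x, hx, rfl⟩
  rcases hx with rfl | rfl
  · exact m1
  · exact m2

/-- inverse of a square mod 4 -/
lemma sq_mod_four_div {R : Type*} [CommRing R] (g g' e s y z y' z' w : R) (hgg : g * g' = e) (he : e = y' ^ 2 + 4 * z')
    (hg : g = y ^ 2 + 4 * z) (hw : w * g = 1 + 4 * s) : ∃ y z, g' = y ^ 2 + 4 * z := by
  refine ⟨w * y * y', w ^ 2 * y ^ 2 * z' + w ^ 2 * z * e - s * g' * 2 - 4 * s ^ 2 * g', ?_⟩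
  subst hg
  have h1 : e = y' ^ 2 + 4 * z' := he
  have h3 : (w * (y ^ 2 + 4 * z)) ^ 2 * g' = (1 + 4 * s) ^ 2 * g' := by rw [hw]
  have h4 : w ^ 2 * (y ^ 2 + 4 * z) * e = (1 + 4 * s) ^ 2 * g' := by rw [← h3, ← hgg]; ring
  linear_combination h4 * (-1) + w^2 * y^2 * h1

end
end CG

open NumberField nonZeroDivisors
set_option linter.all false
namespace CG
open IsDedekindDomain

section
variable {K L : Type*} [Field K] [NumberField K] [Field L] [NumberField L] [Algebra K L]
  [Algebra.IsQuadraticExtension K L]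

lemma sO_val (σ : L ≃ₐ[K] L) (x : 𝓞 L) : ((sO σ x : 𝓞 L) : L) = σ (x : L) := rfl

/-- integral element fixed by `σ` comes from below -/
lemma fixed_int {σ : L ≃ₐ[K] L} (hσ : σ ≠ 1) (x : 𝓞 L) (hx : sO σ x = x) :
    ∃ y : 𝓞 K, algebraMap (𝓞 K) (𝓞 L) y = x := by
  obtain ⟨y, hy⟩ := fixed_mem hσ (x : L) (by rw [← sO_val, hx])
  have hyi : IsIntegral ℤ y := by
    have : IsIntegral ℤ (algebraMap K L y) := by rw [hy]; exact RingOfIntegers.isIntegral_coe x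
    exact (isIntegral_algHom_iff ((algebraMap K L).toIntAlgHom) (algebraMap K L).injective).1 this
  refine ⟨⟨y, hyi⟩, ?_⟩
  apply RingOfIntegers.ext
  exact hy

lemma sO_sO {σ : L ≃ₐ[K] L} (hσ : σ ≠ 1) (x : 𝓞 L) : sO σ (sO σ x) = x :=
  RingOfIntegers.ext (sig_sig hσ _)

lemma ram_inj {σ : L ≃ₐ[K] L} (hσ : σ ≠ 1) {P Q : Ideal (𝓞 L)} (hP : Ram σ P) (hQ : Ram σ Q)
    (h : P.comap (algebraMap (𝓞 K) (𝓞 L)) ≤ Q.comap (algebraMap (𝓞 K) (𝓞 L))) : P ≤ Q := by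
  intro x hx
  obtain ⟨y, hy⟩ := fixed_int hσ (x * sO σ x) (by rw [map_mul, sO_sO hσ, mul_comm])
  have h1 : y ∈ P.comap (algebraMap (𝓞 K) (𝓞 L)) := by
    rw [Ideal.mem_comap, hy]; exact Ideal.mul_mem_right _ _ hx
  have h2 := h h1
  rw [Ideal.mem_comap, hy] at h2
  have h3 := hQ.2.2 x
  rcases hQ.1.mem_or_mem h2 with h4 | h4
  · exact h4
  · have := Q.sub_mem h4 h3
    rwa [sub_sub_cancel] at this

/-- bounding the set of ramified primes -/
lemma ram_finset {σ : L ≃ₐ[K] L} (hσ : σ ≠ 1) (S : Finset (Ideal (𝓞 K)))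
    (hS : ∀ P, Ram σ P → P.comap (algebraMap (𝓞 K) (𝓞 L)) ∈ S) :
    ∃ T : Finset (Ideal (𝓞 L)), T.card ≤ S.card ∧ ∀ P, Ram σ P → P ∈ T := by
  classical
  have hinj : Set.InjOn (fun P : Ideal (𝓞 L) => P.comap (algebraMap (𝓞 K) (𝓞 L))) {P | Ram σ P} := by
    intro P hP Q hQ h
    exact le_antisymm (ram_inj hσ hP hQ h.le) (ram_inj hσ hQ hP h.ge)
  have hfin : Set.Finite {P : Ideal (𝓞 L) | Ram σ P} := by
    apply Set.Finite.of_finite_image _ hinj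
    apply S.finite_toSet.subset
    rintro _ ⟨P, hP, rfl⟩
    exact hS P hP
  refine ⟨hfin.toFinset, ?_, fun P hP => hfin.mem_toFinset.2 hP⟩
  apply Finset.card_le_card_of_injOn (fun P : Ideal (𝓞 L) => P.comap (algebraMap (𝓞 K) (𝓞 L)))
  · intro P hP
    exact hS P (hfin.mem_toFinset.1 hP)
  · intro P hP Q hQ h
    exact hinj (hfin.mem_toFinset.1 hP) (hfin.mem_toFinset.1 hQ) h

lemma exists_ram {d : 𝓞 K} {r : L} (hr : r ^ 2 = algebraMap K L d) {σ : L ≃ₐ[K] L} (hσ : σ ≠ 1)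
    (v : HeightOneSpectrum (𝓞 K)) (hv : Odd (od v (d : K))) :
    ∃ P : Ideal (𝓞 L), Ram σ P ∧ P.comap (algebraMap (𝓞 K) (𝓞 L)) = v.asIdeal := by
  have hs := sig_root hσ (not_sq_of_od hv) hr
  have hd0 : (d : K) ≠ 0 := by
    intro h0; rw [h0, od, map_zero, WithZero.log_zero] at hv; exact absurd hv (by decide)
  have hr0 : r ≠ 0 := by
    rintro rfl
    apply hd0
    have : algebraMap K L d = 0 := by rw [← hr]; norm_num
    simpa using this
  obtain ⟨P, -, hP, hPv⟩ := Ideal.exists_ideal_over_prime_of_isIntegral (S := 𝓞 L) v.asIdeal ⊥ (by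
    intro x hx
    rw [Ideal.mem_comap, Ideal.mem_bot, FaithfulSMul.algebraMap_eq_zero_iff] at hx
    rw [hx]; exact zero_mem _)
  refine ⟨P, ⟨hP, ?_, ?_⟩, hPv⟩
  · rintro rfl
    apply v.ne_bot
    rw [← hPv, eq_bot_iff]
    intro x hx
    rw [Ideal.mem_comap, Ideal.mem_bot, FaithfulSMul.algebraMap_eq_zero_iff] at hx
    rw [hx]; exact zero_mem _
  · intro x
    set δ := sO σ x - x with hδ
    have hsδ : sO σ δ = - δ := by rw [hδ, map_sub, sO_sO hσ]; ring
    obtain ⟨s, hs2⟩ := fixed_int hσ (δ ^ 2) (by rw [map_pow, hsδ]; ring)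
    have hsδ' : σ (δ : L) = - (δ : L) := by
      rw [← sO_val, hsδ]; rfl
    obtain ⟨b, hb⟩ := fixed_mem hσ ((δ : L) / r) (by rw [map_div₀, hsδ', hs, neg_div_neg_eq])
    have h1 : (s : K) = b ^ 2 * (d : K) := by
      apply (algebraMap K L).injective
      have h2 : algebraMap K L (s : K) = (δ : L) ^ 2 := congrArg (fun z : 𝓞 L => (z : L)) hs2
      rw [h2, map_mul, map_pow, hb, ← hr]
      field_simp
    have hsv : s ∈ v.asIdeal := by
      by_contra hsv
      have h2 := od_notMem v hsv
      have hs0 : (s : K) ≠ 0 := by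
        intro h0
        apply hsv
        have : s = 0 := RingOfIntegers.ext h0
        rw [this]; exact zero_mem _
      have hb0 : b ≠ 0 := by
        rintro rfl
        apply hs0
        rw [h1]; ring
      rw [h1, od_mul v (pow_ne_zero 2 hb0) hd0, od_pow] at h2
      push_cast at h2
      obtain ⟨k, hk⟩ := hv
      omega
    rw [← hPv, Ideal.mem_comap, hs2] at hsv
    exact hP.mem_of_pow_mem 2 hsv

lemma nonnorm_of {d : 𝓞 K} {r : L} (hr : r ^ 2 = algebraMap K L d) {σ : L ≃ₐ[K] L} (hσ : σ ≠ 1)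
    (v : HeightOneSpectrum (𝓞 K)) (hv : Odd (od v (d : K))) (h2 : (2 : 𝓞 K) ∉ v.asIdeal) (u : (𝓞 K)ˣ)
    (hu : ∀ x : 𝓞 K, (u : 𝓞 K) - x ^ 2 ∉ v.asIdeal) : NonNorm σ u := by
  intro α hα
  obtain ⟨P, hram, hPv⟩ := exists_ram hr hσ v hv
  have hP := hram.1
  set j := algebraMap (𝓞 K) (𝓞 L) with hj
  let w : HeightOneSpectrum (𝓞 L) := ⟨P, hP, hram.2.1⟩
  have key : ∃ a n : 𝓞 L, n ∉ P ∧ j u * n ^ 2 - a ^ 2 ∈ P := by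
    obtain ⟨n, ⟨e, he⟩, h⟩ := HeightOneSpectrum.exists_primeCompl_mul_eq_or_mul_eq (K := L) w α
    have heP : e ∉ P := he
    have huL : algebraMap K L (u : 𝓞 K) = ((j u : 𝓞 L) : L) := rfl
    rw [huL] at hα
    rcases h with h | h
    · refine ⟨n, e, heP, ?_⟩
      have e1 : j u * (e * sO σ e) = n * sO σ n := by
        apply RingOfIntegers.ext
        change ((j u : 𝓞 L) : L) * ((e : L) * σ (e : L)) = (n : L) * σ (n : L)
        have h' : α * (e : L) = (n : L) := h
        rw [← h', ← hα, map_mul]; ring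
      have : j u * e ^ 2 - n ^ 2 = n * (sO σ n - n) - j u * e * (sO σ e - e) := by
        linear_combination e1
      rw [this]
      exact P.sub_mem (P.mul_mem_left _ (hram.2.2 n)) (P.mul_mem_left _ (hram.2.2 e))
    · have e1 : j u * (n * sO σ n) = e * sO σ e := by
        apply RingOfIntegers.ext
        change ((j u : 𝓞 L) : L) * ((n : L) * σ (n : L)) = (e : L) * σ (e : L)
        have h' : α * (n : L) = (e : L) := h
        rw [← h', ← hα, map_mul]; ring
      have h3 : j u * n ^ 2 - e ^ 2 ∈ P := by
        have : j u * n ^ 2 - e ^ 2 = e * (sO σ e - e) - j u * n * (sO σ n - n) := by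
          linear_combination e1
        rw [this]
        exact P.sub_mem (P.mul_mem_left _ (hram.2.2 e)) (P.mul_mem_left _ (hram.2.2 n))
      refine ⟨e, n, fun hn => heP ?_, h3⟩
      have h4 : e ^ 2 ∈ P := by
        have := P.sub_mem (P.mul_mem_left (j u * n) hn) h3
        have e2 : j u * n * n - (j u * n ^ 2 - e ^ 2) = e ^ 2 := by ring
        rwa [e2] at this
      exact hP.mem_of_pow_mem 2 h4
  obtain ⟨a, n, hn, han⟩ := key
  obtain ⟨A, hA⟩ := fixed_int hσ (a + sO σ a) (by rw [map_add, sO_sO hσ, add_comm])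
  obtain ⟨N, hN⟩ := fixed_int hσ (n + sO σ n) (by rw [map_add, sO_sO hσ, add_comm])
  have ha2 := hram.2.2 a
  have hn2 := hram.2.2 n
  have hmax : v.asIdeal.IsMaximal := v.isMaximal
  have hNv : N ∉ v.asIdeal := by
    intro hh
    rw [← hPv, Ideal.mem_comap, hN] at hh
    have h3 := P.sub_mem hh hn2
    have e3 : n + sO σ n - (sO σ n - n) = 2 * n := by ring
    rw [e3] at h3
    rcases hP.mem_or_mem h3 with h4 | h4
    · apply h2
      rw [← hPv, Ideal.mem_comap, map_ofNat]; exact h4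
    · exact hn h4
  have hmem : (u : 𝓞 K) * N ^ 2 - A ^ 2 ∈ v.asIdeal := by
    rw [← hPv, Ideal.mem_comap, map_sub, map_mul, map_pow, map_pow]
    change j u * (j N) ^ 2 - (j A) ^ 2 ∈ P
    have hN' : j N = n + sO σ n := hN
    have hA' : j A = a + sO σ a := hA
    rw [hN', hA']
    have : j u * (n + sO σ n) ^ 2 - (a + sO σ a) ^ 2 = 4 * (j u * n ^ 2 - a ^ 2)
      + j u * (4 * n + (sO σ n - n)) * (sO σ n - n) - (4 * a + (sO σ a - a)) * (sO σ a - a) := by ring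
    rw [this]
    exact P.sub_mem (P.add_mem (P.mul_mem_left _ han) (P.mul_mem_left _ hn2)) (P.mul_mem_left _ ha2)
  obtain ⟨M, y, hy, hM⟩ := hmax.exists_inv hNv
  apply hu (A * M)
  have e4 : (u : 𝓞 K) - (A * M) ^ 2 = M ^ 2 * ((u : 𝓞 K) * N ^ 2 - A ^ 2) + (u : 𝓞 K) * (1 + M * N) * y := by
    have : y = 1 - M * N := by rw [← hM]; ring
    rw [this]; ring
  rw [e4]
  exact Ideal.add_mem _ (Ideal.mul_mem_left _ _ hmem) (Ideal.mul_mem_left _ _ hy)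

end
end CG

open NumberField nonZeroDivisors
set_option linter.all false
namespace CG
open IsDedekindDomain

theorem four_pid (K : Type*) [Field K] [NumberField K] [IsCyclotomicExtension {2 ^ 2} ℚ K] :
    IsPrincipalIdealRing (𝓞 K) := by
  apply RingOfIntegers.isPrincipalIdealRing_of_abs_discr_lt
  have h2 : Fact (Nat.Prime 2) := ⟨Nat.prime_two⟩
  have e1 := IsCyclotomicExtension.Rat.discr_prime_pow 2 2 K
  have e2 : Module.finrank ℚ K = Nat.totient (2 ^ 2) := IsCyclotomicExtension.finrank K
    (Polynomial.cyclotomic.irreducible_rat (by simp))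
  have e3 : InfinitePlace.nrComplexPlaces K = Nat.totient (2 ^ 2) / 2 :=
    IsCyclotomicExtension.Rat.nrComplexPlaces_eq_totient_div_two (2 ^ 2) K
  have : Nat.totient (2 ^ 2) = 2 := by decide
  rw [this] at e2 e3
  rw [e1, e2, e3]
  norm_num
  have h3 := Real.pi_gt_three
  nlinarith [h3]

lemma quad_of_finrank {F L : Type*} [Field F] [Field L] [NumberField F] [NumberField L] [Algebra F L]
    (h : Module.finrank ℚ L = 2 * Module.finrank ℚ F) : Algebra.IsQuadraticExtension F L := by
  have h1 := Module.finrank_mul_finrank ℚ F L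
  have h0 : 0 < Module.finrank ℚ F := Module.finrank_pos
  refine { finrank_eq_two' := ?_ }
  have : Module.finrank ℚ F * Module.finrank F L = Module.finrank ℚ F * 2 := by rw [h1, h]; ring
  exact Nat.eq_of_mul_eq_mul_left h0 this

theorem odd_cyc (m : ℕ) : ∀ (K : Type*) [Field K] [NumberField K] [IsCyclotomicExtension {2 ^ (m + 2)} ℚ K],
    Odd (Nat.card (ClassGroup (𝓞 K))) := by
  induction m with
  | zero =>
    intro K _ _ _
    have := four_pid K
    have h1 := (classNumber_eq_one_iff (K := K)).2 this
    rw [classNumber, ← Nat.card_eq_fintype_card] at h1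
    rw [h1]; exact odd_one
  | succ m ih =>
    intro K _ _ _
    have h2 : Fact (Nat.Prime 2) := ⟨Nat.prime_two⟩
    obtain ⟨ζ, hζ⟩ := IsCyclotomicExtension.exists_isPrimitiveRoot (S := {2 ^ (m + 1 + 2)}) ℚ K (Set.mem_singleton _) (by positivity)
    have hζ2 : IsPrimitiveRoot (ζ ^ 2) (2 ^ (m + 2)) :=
      hζ.pow (by positivity) (by ring)
    let E := IntermediateField.adjoin ℚ {ζ ^ 2}
    have hE : IsCyclotomicExtension {2 ^ (m + 2)} ℚ E :=
      hζ2.intermediateField_adjoin_isCyclotomicExtension ℚ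
    have hEodd := ih E
    have hq : Algebra.IsQuadraticExtension E K := by
      apply quad_of_finrank
      rw [IsCyclotomicExtension.finrank (n := 2 ^ (m + 2)) E
        (Polynomial.cyclotomic.irreducible_rat (by simp)), IsCyclotomicExtension.finrank (n := 2 ^ (m + 1 + 2)) K
        (Polynomial.cyclotomic.irreducible_rat (by simp)), Nat.totient_prime_pow Nat.prime_two (by simp),
        Nat.totient_prime_pow Nat.prime_two (by simp)]
      simp
      ring
    have hTC : IsTotallyComplex E := IsCyclotomicExtension.Rat.isTotallyComplex E (n := 2 ^ (m + 2))
      (by have : 2 ^ 2 ≤ 2 ^ (m + 2) := Nat.pow_le_pow_right (by simp) (by simp)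
          omega)
    have := fact_tc E K
    obtain ⟨σ, hσ⟩ := exists_sig E K
    have hs2 : (σ ζ) ^ 2 = ζ ^ 2 := by
      rw [← map_pow]
      have : ζ ^ 2 = algebraMap E K ⟨ζ ^ 2, IntermediateField.mem_adjoin_simple_self ℚ _⟩ := rfl
      rw [this, AlgEquiv.commutes]
    have hs : σ ζ = - ζ := by
      rcases sq_eq_sq_iff_eq_or_eq_neg.1 hs2 with h | h
      · exfalso
        apply hσ
        ext x
        have : AlgHom.restrictScalars ℚ (σ : K →ₐ[E] K) = AlgHom.id ℚ K := by
          apply (hζ.powerBasis ℚ).algHom_ext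
          simpa using h
        exact DFunLike.congr_fun this x
      · exact h
    have key : ∀ P, Ram σ P → P ∈ ({Ideal.span {hζ.toInteger - 1}} : Finset (Ideal (𝓞 K))) := by
      intro P ⟨hP, hP0, h⟩
      rw [Finset.mem_singleton]
      have h1 := h hζ.toInteger
      have h3 : sO σ hζ.toInteger - hζ.toInteger = -2 * hζ.toInteger := by
        apply RingOfIntegers.ext
        have e1 : ((sO σ hζ.toInteger - hζ.toInteger : 𝓞 K) : K) = σ ζ - ζ := rfl
        have e2 : ((-2 * hζ.toInteger : 𝓞 K) : K) = -2 * ζ := by push_cast; rfl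
        rw [e1, e2, hs]
        ring
      rw [h3] at h1
      have hu : IsUnit hζ.toInteger := (hζ.toInteger_isPrimitiveRoot).isUnit (by positivity)
      have h4 : (2 : 𝓞 K) ∈ P := by
        rcases hP.mem_or_mem h1 with h | h
        · exact (Ideal.neg_mem_iff _).1 h
        · exact absurd (Ideal.eq_top_of_isUnit_mem _ h hu) hP.ne_top
      have hl : P.LiesOver (Ideal.span {((2 : ℕ) : ℤ)}) := by
        constructor
        have hm : (Ideal.span {((2 : ℕ) : ℤ)}).IsMaximal := by
          apply PrincipalIdealRing.isMaximal_of_irreducible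
          exact Nat.prime_iff_prime_int.1 Nat.prime_two |>.irreducible
        refine hm.eq_of_le (Ideal.IsPrime.ne_top (hP.under _)) ?_
        rw [Ideal.span_singleton_le_iff_mem, Ideal.under, Ideal.mem_comap]
        simpa using h4
      exact IsCyclotomicExtension.Rat.eq_span_zeta_sub_one_of_liesOver 2 (m + 2) K hζ P
    obtain ⟨h1, h3⟩ := thmB hσ 1 _ (by simp) key hEodd
    apply odd_of_N2
    have := N2_pos K
    generalize (nm (su σ)).range.relIndex ((pr K).ker ⊓ (df (su σ)).ker) = e at h1 h3
    nlinarith [Nat.pos_of_ne_zero h3]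

end CG

open NumberField nonZeroDivisors
set_option linter.all false
namespace CG
open IsDedekindDomain

/-! ### arithmetic of orders modulo powers of two -/

lemma lte_step (x a : ℕ) (ha : 2 ≤ a) (h : x % 2 ^ (a + 1) = 1 + 2 ^ a) :
    x ^ 2 % 2 ^ (a + 2) = 1 + 2 ^ (a + 1) := by
  obtain ⟨b, rfl⟩ := Nat.exists_eq_add_of_le ha
  have h1 := Nat.div_add_mod x (2 ^ (2 + b + 1))
  rw [h] at h1
  set q := x / 2 ^ (2 + b + 1)
  set A := 2 ^ b with hA
  have hA1 : 1 ≤ A := Nat.one_le_two_pow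
  have e1 : 2 ^ (2 + b + 1) = 8 * A := by rw [hA]; ring
  have e2 : 2 ^ (2 + b) = 4 * A := by rw [hA]; ring
  have e3 : 2 ^ (2 + b + 2) = 16 * A := by rw [hA]; ring
  rw [e1, e2] at h1
  rw [e3, e1, ← h1]
  have : (8 * A * q + (1 + 4 * A)) ^ 2 = (1 + 8 * A) + 16 * A * (4 * A * q ^ 2 + q + 4 * A * q + A) := by ring
  rw [this, Nat.add_mul_mod_self_left, Nat.mod_eq_of_lt]
  omega

lemma lte_pow (p c : ℕ) (hc : 2 ≤ c) (h : p ^ 2 % 2 ^ (c + 2) = 1 + 2 ^ (c + 1)) (j : ℕ) :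
    p ^ 2 ^ (j + 1) % 2 ^ (c + j + 2) = 1 + 2 ^ (c + j + 1) := by
  induction j with
  | zero => simpa using h
  | succ j ih =>
    have := lte_step _ (c + j + 1) (by omega) ih
    rw [← pow_mul, ← pow_succ] at this
    exact this

/-- `p` has 2-adic level `c`: level 2 is `p ≡ 3, 5 mod 8`, level 3 is `p ≡ 7, 9 mod 16` -/
def Lev (p c : ℕ) : Prop := 2 ≤ c ∧ p ^ 2 % 2 ^ (c + 2) = 1 + 2 ^ (c + 1)

lemma lev_two {p : ℕ} (h : p % 8 = 3 ∨ p % 8 = 5) : Lev p 2 := by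
  refine ⟨le_rfl, ?_⟩
  have : p % 16 = 3 ∨ p % 16 = 5 ∨ p % 16 = 11 ∨ p % 16 = 13 := by omega
  norm_num
  rcases this with h | h | h | h <;> simp [Nat.pow_mod, h]

lemma lev_three {p : ℕ} (h : p % 16 = 7) : Lev p 3 := by
  refine ⟨by simp, ?_⟩
  have : p % 32 = 7 ∨ p % 32 = 23 := by omega
  norm_num
  rcases this with h | h <;> simp [Nat.pow_mod, h]

/-- valuation of `p^f - 1` -/
lemma Lev.val {p c : ℕ} (h : Lev p c) (k : ℕ) (hk : c ≤ k + 3) :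
    ∃ s, p ^ 2 ^ (k + 4 - c) = 1 + 2 ^ (k + 4) * (2 * s + 1) := by
  obtain ⟨j, hj⟩ := Nat.exists_eq_add_of_le hk
  have h1 := lte_pow p c h.1 h.2 j
  have e1 : k + 4 - c = j + 1 := by omega
  have e2 : k + 4 = c + j + 1 := by omega
  rw [e1, e2]
  refine ⟨p ^ 2 ^ (j + 1) / 2 ^ (c + j + 2), ?_⟩
  have := Nat.div_add_mod (p ^ 2 ^ (j + 1)) (2 ^ (c + j + 2))
  rw [h1] at this
  rw [← this]
  have h2 : (1 + 2 ^ (c + j + 1)) < 2 ^ (c + j + 2) := by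
    have : 2 ^ (c + j + 2) = 2 * 2 ^ (c + j + 1) := by ring
    have h3 : 2 ^ 1 ≤ 2 ^ (c + j + 1) := Nat.pow_le_pow_right (by simp) (by omega)
    omega
  rw [Nat.mul_add_div (by positivity), Nat.div_eq_of_lt h2]
  ring

lemma Lev.order {p c : ℕ} (h : Lev p c) (k : ℕ) (hk : c ≤ k + 3) (hp16 : p % 16 ≠ 1) :
    orderOf (p : ZMod (2 ^ (k + 4))) = 2 ^ (k + 4 - c) := by
  obtain ⟨s, hs⟩ := h.val k hk
  obtain ⟨j, hj⟩ := Nat.exists_eq_add_of_le hk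
  have e1 : k + 4 - c = j + 1 := by omega
  have := Fact.mk Nat.prime_two
  rw [e1] at hs ⊢
  apply orderOf_eq_prime_pow
  · intro h1
    rw [← Nat.cast_pow, show (1 : ZMod (2 ^ (k + 4))) = ((1 : ℕ) : ZMod (2 ^ (k + 4))) by simp,
      ZMod.natCast_eq_natCast_iff] at h1
    cases j with
    | zero =>
      have : p ≡ 1 [MOD 16] := by
        have := h1.of_dvd (show 2 ^ 4 ∣ 2 ^ (k + 4) from pow_dvd_pow _ (by omega))
        simpa using this
      exact hp16 this
    | succ j =>
      have h2 := lte_pow p c h.1 h.2 j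
      have e2 : k + 4 = c + j + 2 := by omega
      rw [e2, Nat.ModEq, h2, Nat.mod_eq_of_lt (Nat.one_lt_two_pow (by omega))] at h1
      have : 0 < 2 ^ (c + j + 1) := by positivity
      omega
  · rw [← Nat.cast_pow, hs]
    push_cast
    rw [show ((2 : ZMod (2 ^ (k + 4))) ^ (k + 4)) = ((2 ^ (k + 4) : ℕ) : ZMod (2 ^ (k + 4))) by push_cast; rfl,
      ZMod.natCast_self]
    ring

section
variable {K : Type*} [Field K] [NumberField K]

lemma liesOver_of_mem (p : ℕ) [hp : Fact p.Prime] (P : Ideal (𝓞 K)) [hP : P.IsPrime]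
    (h : (p : 𝓞 K) ∈ P) : P.LiesOver (Ideal.span {(p : ℤ)}) := by
  constructor
  have hm : (Ideal.span {(p : ℤ)}).IsMaximal := by
    apply PrincipalIdealRing.isMaximal_of_irreducible
    exact (Nat.prime_iff_prime_int.1 hp.out).irreducible
  refine hm.eq_of_le (Ideal.IsPrime.ne_top (hP.under _)) ?_
  rw [Ideal.span_singleton_le_iff_mem, Ideal.under, Ideal.mem_comap]
  simpa using h

lemma mem_of_liesOver (p : ℕ) (P : Ideal (𝓞 K))
    (h : P.LiesOver (Ideal.span {(p : ℤ)})) : (p : 𝓞 K) ∈ P := by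
  have : (p : ℤ) ∈ P.under ℤ := by rw [← h.over]; exact Ideal.mem_span_singleton_self _
  rw [Ideal.under, Ideal.mem_comap] at this
  simpa using this

lemma ne_bot_of_mem {p : ℕ} (hp : p ≠ 0) {P : Ideal (𝓞 K)} (h : (p : 𝓞 K) ∈ P) : P ≠ ⊥ := by
  rintro rfl
  rw [Ideal.mem_bot] at h
  exact hp (by exact_mod_cast h)

lemma coprime_notMem {a b : ℕ} (hab : a.Coprime b) {P : Ideal (𝓞 K)} (hP : P.IsPrime)
    (h : (a : 𝓞 K) ∈ P) : (b : 𝓞 K) ∉ P := by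
  intro hb
  obtain ⟨x, y, hxy⟩ := Nat.isCoprime_iff_coprime.2 hab
  have : (x : 𝓞 K) * a + (y : 𝓞 K) * b = 1 := by exact_mod_cast congrArg (Int.cast : ℤ → 𝓞 K) hxy
  exact (Ideal.ne_top_iff_one P).1 hP.ne_top (this ▸ P.add_mem (P.mul_mem_left _ h) (P.mul_mem_left _ hb))

lemma euler_nonsq (P : Ideal (𝓞 K)) [hP : P.IsPrime] (hP0 : P ≠ ⊥) (h2 : (2 : 𝓞 K) ∉ P) (q : ℕ)
    (hq : Ideal.absNorm P = 2 * q + 1) (u : 𝓞 K) (hu : u ^ q + 1 ∈ P) (x : 𝓞 K) : u - x ^ 2 ∉ P := by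
  intro hx
  have hmax : P.IsMaximal := hP.isMaximal hP0
  letI := Ideal.Quotient.field P
  have hfin : Finite (𝓞 K ⧸ P) := Ideal.finiteQuotientOfFreeOfNeBot P hP0
  letI := Fintype.ofFinite (𝓞 K ⧸ P)
  have hcard : Fintype.card (𝓞 K ⧸ P) = 2 * q + 1 := by
    rw [← hq, ← Nat.card_eq_fintype_card]; rfl
  rw [← Ideal.Quotient.eq_zero_iff_mem] at hx hu h2
  simp only [map_sub, map_add, map_pow, map_one, map_ofNat] at hx hu h2
  have hx' := sub_eq_zero.1 hx
  set y := Ideal.Quotient.mk P x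
  rw [hx', ← pow_mul] at hu
  by_cases hy : y = 0
  · have hq0 : q ≠ 0 := by
      rintro rfl
      have := Fintype.one_lt_card (α := 𝓞 K ⧸ P)
      omega
    rw [hy, zero_pow (by omega)] at hu
    simp at hu
  · have := FiniteField.pow_card_sub_one_eq_one y hy
    rw [hcard, Nat.add_sub_cancel] at this
    rw [this] at hu
    apply h2
    rw [← hu]; norm_num

lemma not_dvd_two_pow {p : ℕ} (hp : p.Prime) (hp2 : Odd p) (k : ℕ) : ¬ p ∣ 2 ^ k := by
  intro h
  have := (Nat.prime_dvd_prime_iff_eq hp Nat.prime_two).1 (hp.dvd_of_dvd_pow h)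
  subst this
  exact absurd hp2 (by decide)

lemma p_notMem_sq (k : ℕ) [IsCyclotomicExtension {2 ^ (k + 4)} ℚ K] {p : ℕ} (hp : p.Prime) (hp2 : Odd p) (P : Ideal (𝓞 K)) [hP : P.IsPrime]
    (h : (p : 𝓞 K) ∈ P) : (p : 𝓞 K) ∉ P ^ 2 := by
  have := Fact.mk hp
  have hl := liesOver_of_mem p P h
  have h1 := IsCyclotomicExtension.Rat.ramificationIdx_eq_of_not_dvd (m := 2 ^ (k + 4)) p K P
    (not_dvd_two_pow hp hp2 _)
  have hle : Ideal.map (algebraMap ℤ (𝓞 K)) (Ideal.span {(p : ℤ)}) ≤ P := by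
    rw [Ideal.map_span, Set.image_singleton, Ideal.span_singleton_le_iff_mem]
    simpa using h
  have h2 : (Ideal.span {(p : ℤ)}).ramificationIdx' P = 1 := by
    rw [← h1]
    exact Ideal.ramificationIdx'_eq_ramificationIdx _ _ (by simpa using hp.ne_zero)
  intro h3
  refine (Ideal.ramificationIdx'_ne_one_iff hle).2 ?_ h2
  rw [Ideal.map_span, Set.image_singleton, Ideal.span_singleton_le_iff_mem]
  simpa using h3

lemma d_notMem_sq (k : ℕ) [IsCyclotomicExtension {2 ^ (k + 4)} ℚ K] {d : ℕ} (hd : Squarefree d) (hd2 : Odd d) (P : Ideal (𝓞 K)) [hP : P.IsPrime]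
    (h : (d : 𝓞 K) ∈ P) : (d : 𝓞 K) ∉ P ^ 2 ∧ ∃ p, p.Prime ∧ p ∣ d ∧ (p : 𝓞 K) ∈ P := by
  have hd0 : d ≠ 0 := hd.ne_zero
  have : ∃ p, p.Prime ∧ p ∣ d ∧ (p : 𝓞 K) ∈ P := by
    have h1 : ((∏ q ∈ d.primeFactors, q : ℕ) : 𝓞 K) ∈ P := by
      rwa [Nat.prod_primeFactors_of_squarefree hd]
    rw [Nat.cast_prod, Ideal.IsPrime.prod_mem_iff] at h1
    obtain ⟨p, hp, hpP⟩ := h1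
    exact ⟨p, Nat.prime_of_mem_primeFactors hp, Nat.dvd_of_mem_primeFactors hp, hpP⟩
  refine ⟨?_, this⟩
  obtain ⟨p, hp, ⟨m, rfl⟩, hpP⟩ := this
  have hcop : p.Coprime m := Nat.coprime_of_squarefree_mul hd
  have hm := coprime_notMem hcop hP hpP
  have hp2 := (Nat.odd_mul.1 hd2).1
  intro h3
  rw [Nat.cast_mul] at h3
  apply p_notMem_sq k hp hp2 P hpP
  obtain ⟨x, y, hxy⟩ := Nat.isCoprime_iff_coprime.2 hcop
  have hxy' : (x : 𝓞 K) * p + (y : 𝓞 K) * m = 1 := by exact_mod_cast congrArg (Int.cast : ℤ → 𝓞 K) hxy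
  have e : (p : 𝓞 K) = x * (p : 𝓞 K) ^ 2 + y * (p * m) := by
    linear_combination (-(p : 𝓞 K)) * hxy'
  rw [e]
  exact Ideal.add_mem _ (Ideal.mul_mem_left _ _ (Ideal.pow_mem_pow hpP 2)) (Ideal.mul_mem_left _ _ h3)

lemma norm_P (k : ℕ) [IsCyclotomicExtension {2 ^ (k + 4)} ℚ K] {p : ℕ} (hp : p.Prime) (hp2 : Odd p) (P : Ideal (𝓞 K)) [hP : P.IsPrime]
    (h : (p : 𝓞 K) ∈ P) : Ideal.absNorm P = p ^ orderOf (p : ZMod (2 ^ (k + 4))) := by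
  have := Fact.mk hp
  have hl := liesOver_of_mem p P h
  rw [← Ideal.pow_inertiaDeg p P, IsCyclotomicExtension.Rat.inertiaDeg_eq_of_not_dvd (m := 2 ^ (k + 4)) p K P
    (not_dvd_two_pow hp hp2 _)]

lemma primes_over (K : Type*) [Field K] [NumberField K] (k : ℕ) [IsCyclotomicExtension {2 ^ (k + 4)} ℚ K] {p : ℕ} (hp : p.Prime) (hp2 : Odd p) :
    ∃ S : Finset (Ideal (𝓞 K)), (∀ P, P ∈ S ↔ P.IsPrime ∧ (p : 𝓞 K) ∈ P) ∧
      S.card * orderOf (p : ZMod (2 ^ (k + 4))) = 2 ^ (k + 3) := by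
  have := Fact.mk hp
  have : IsGalois ℚ K := IsCyclotomicExtension.isGalois {2 ^ (k + 4)} ℚ K
  have hpr : (Ideal.span {(p : ℤ)}).IsPrime := by
    rw [Ideal.span_singleton_prime (by simpa using hp.ne_zero)]
    exact Nat.prime_iff_prime_int.1 hp
  have h1 := Ideal.ncard_primesOver_mul_ramificationIdxIn_mul_inertiaDegIn (Ideal.span {(p : ℤ)}) (𝓞 K) Gal(K/ℚ)
  rw [IsCyclotomicExtension.Rat.ramificationIdxIn_eq_of_not_dvd (m := 2 ^ (k + 4)) p K (not_dvd_two_pow hp hp2 _),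
    IsCyclotomicExtension.Rat.inertiaDegIn_eq_of_not_dvd (m := 2 ^ (k + 4)) p K (not_dvd_two_pow hp hp2 _),
    one_mul, IsGalois.card_aut_eq_finrank, IsCyclotomicExtension.finrank (n := 2 ^ (k + 4)) K
        (Polynomial.cyclotomic.irreducible_rat (by simp)), Nat.totient_prime_pow Nat.prime_two (by simp)] at h1
  have hfin : (Ideal.primesOver (Ideal.span {(p : ℤ)}) (𝓞 K)).Finite := by
    apply Set.finite_of_ncard_ne_zero
    intro h0
    rw [h0] at h1
    simp at h1
    exact absurd h1 (by positivity)
  refine ⟨hfin.toFinset, ?_, ?_⟩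
  · intro P
    rw [Set.Finite.mem_toFinset]
    constructor
    · rintro ⟨a, b⟩
      exact ⟨a, mem_of_liesOver p P b⟩
    · rintro ⟨a, b⟩
      exact ⟨a, liesOver_of_mem p P b⟩
  · rw [← Set.ncard_eq_toFinset_card _ hfin]
    simpa using h1

end
end CG

open NumberField nonZeroDivisors
set_option linter.all false
namespace CG
open IsDedekindDomain

/-! ### norm products -/

lemma halving {R : Type*} [CommRing R] {p c : ℕ} (h : Lev p c) (hp : Odd p) (j : ℕ) :
    ∀ x : R, x ^ 2 ^ (j + c) = -1 →
    ∏ i ∈ Finset.range (2 ^ (j + 1)), (1 - x ^ p ^ i) = (1 - x ^ 2 ^ j) * (1 - (x ^ 2 ^ j) ^ p) := by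
  induction j with
  | zero =>
    intro x hx
    simp [Finset.prod_range_succ]
  | succ j ih =>
    intro x hx
    have h1 : (x ^ 2) ^ 2 ^ (j + c) = -1 := by rw [← pow_mul, ← hx]; congr 1; ring
    have h2 := ih (x ^ 2) h1
    have h3 : x ^ p ^ 2 ^ (j + 1) = - x := by
      have h4 := lte_pow p c h.1 h.2 j
      have h5 := Nat.div_add_mod (p ^ 2 ^ (j + 1)) (2 ^ (c + j + 2))
      rw [h4] at h5
      rw [← h5, pow_add, pow_mul, show c + j + 2 = (j + 1 + c) + 1 by ring, pow_succ, pow_mul, hx,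
        show c + j + 1 = j + 1 + c by ring, pow_add x, hx]
      simp
    rw [show 2 ^ (j + 1 + 1) = 2 ^ (j + 1) + 2 ^ (j + 1) by ring, Finset.prod_range_add,
      ← Finset.prod_mul_distrib, show (x ^ 2 ^ (j + 1)) = (x ^ 2) ^ 2 ^ j by rw [← pow_mul]; congr 1; ring, ← h2]
    apply Finset.prod_congr rfl
    intro i _
    have h6 : x ^ p ^ (2 ^ (j + 1) + i) = - x ^ p ^ i := by
      rw [pow_add, pow_mul, h3, Odd.neg_pow (hp.pow)]
    rw [h6, ← pow_mul, mul_comm 2 (p ^ i), pow_mul]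
    ring

lemma geom_exp (p f : ℕ) (hp : Odd p) : ∃ G, (∑ i ∈ Finset.range f, p ^ i) = G ∧
    p ^ f = 2 * (G * ((p - 1) / 2)) + 1 := by
  refine ⟨_, rfl, ?_⟩
  obtain ⟨m, rfl⟩ := hp
  have h := geom_sum_mul_add (2 * m) f
  rw [← h]
  have : (2 * m + 1 - 1) / 2 = m := by omega
  rw [this]
  ring

section
variable {K : Type*} [Field K] [NumberField K]

/-- Frobenius for `1+x+x²` -/
lemma frob_V {p : ℕ} (hp : p.Prime) (P : Ideal (𝓞 K)) (h : (p : 𝓞 K) ∈ P) (x : 𝓞 K) (i : ℕ) :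
    Ideal.Quotient.mk P ((1 + x + x ^ 2) ^ p ^ i) =
      Ideal.Quotient.mk P (1 + x ^ p ^ i + (x ^ p ^ i) ^ 2) := by
  have := Fact.mk hp
  rcases eq_or_ne P ⊤ with rfl | hP
  · exact Subsingleton.elim (α := 𝓞 K ⧸ (⊤ : Ideal (𝓞 K))) _ _
  have : Nontrivial (𝓞 K ⧸ P) := Ideal.Quotient.nontrivial_iff.2 hP
  have : CharP (𝓞 K ⧸ P) p := by
    have h0 : ((p : ℕ) : 𝓞 K ⧸ P) = 0 := by
      rw [← map_natCast (Ideal.Quotient.mk P)]; exact Ideal.Quotient.eq_zero_iff_mem.2 h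
    exact (CharP.charP_iff_prime_eq_zero hp).2 h0
  simp only [map_pow, map_add, map_one]
  rw [add_pow_char_pow, add_pow_char_pow, one_pow, ← pow_mul, ← pow_mul, mul_comm]

/-- `V(x)^q ≡ (∏ V(x^{p^i}))^{(p-1)/2}` -/
lemma V_pow {p : ℕ} (hp : p.Prime) (hp2 : Odd p) (P : Ideal (𝓞 K)) (h : (p : 𝓞 K) ∈ P) (x : 𝓞 K) (f q : ℕ)
    (hq : p ^ f = 2 * q + 1) :
    (1 + x + x ^ 2) ^ q - (∏ i ∈ Finset.range f, (1 + x ^ p ^ i + (x ^ p ^ i) ^ 2)) ^ ((p - 1) / 2) ∈ P := by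
  obtain ⟨G, hG, hG2⟩ := geom_exp p f hp2
  have : q = G * ((p - 1) / 2) := by omega
  rw [← Ideal.Quotient.eq_zero_iff_mem, map_sub, sub_eq_zero, this, pow_mul, ← hG,
    ← Finset.prod_pow_eq_pow_sum, map_pow _ _ ((p - 1) / 2), map_pow _ _ ((p - 1) / 2), map_prod, map_prod]
  congr 1
  apply Finset.prod_congr rfl
  intro i _
  exact frob_V hp P h x i

variable {k : ℕ} {ζ : 𝓞 K}

lemma zeta_half (hζ : IsPrimitiveRoot ζ (2 ^ (k + 4))) : ζ ^ 2 ^ (k + 3) = -1 := by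
  have h1 : (ζ ^ 2 ^ (k + 3)) ^ 2 = 1 := by rw [← pow_mul, ← hζ.pow_eq_one]; congr 1
  rcases sq_eq_one_iff.1 h1 with h | h
  all_goals try exact h
  exfalso
  exact hζ.pow_ne_one_of_pos_of_lt (by positivity) (Nat.pow_lt_pow_right (by simp) (by omega)) h

lemma V_unit (hζ : IsPrimitiveRoot ζ (2 ^ (k + 4))) : IsUnit (1 + ζ + ζ ^ 2) := by
  obtain ⟨a, ha⟩ := Nat.exists_mul_mod_eq_one_of_coprime (n := 3) (k := 2 ^ (k + 4))
    (Nat.Coprime.pow_right _ (by decide)) (Nat.one_lt_two_pow (by omega))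
  have h1 : (1 - ζ) ≠ 0 := by
    intro h
    exact hζ.ne_one (Nat.one_lt_two_pow (by omega)) (sub_eq_zero.1 h).symm
  have h2 : (ζ ^ 3) ^ a = ζ := by
    rw [← pow_mul, ← Nat.div_add_mod (3 * a) (2 ^ (k + 4)), ha.2, pow_add, pow_mul, hζ.pow_eq_one]
    simp
  refine IsUnit.of_mul_eq_one (∑ i ∈ Finset.range a, (ζ ^ 3) ^ i) ?_
  apply mul_left_cancel₀ h1
  have h3 := mul_neg_geom_sum (ζ ^ 3) a
  rw [h2] at h3
  linear_combination h3

end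
end CG

open NumberField nonZeroDivisors
set_option linter.all false
namespace CG
open IsDedekindDomain

section
variable {K : Type*} [Field K] [NumberField K] {k : ℕ} {ζ : 𝓞 K}

lemma zeta_i (hζ : IsPrimitiveRoot ζ (2 ^ (k + 4))) : (ζ ^ 2 ^ (k + 2)) ^ 2 = -1 := by
  rw [← pow_mul, ← zeta_half hζ]; congr 1

lemma sq_mod4 (hζ : IsPrimitiveRoot ζ (2 ^ (k + 4))) (d : ℤ) (hd : Odd d) :
    ∃ y z : 𝓞 K, (d : 𝓞 K) = y ^ 2 + 4 * z := by
  have : d % 4 = 1 ∨ d % 4 = 3 := by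
    obtain ⟨m, rfl⟩ := hd
    omega
  have h1 := Int.mul_ediv_add_emod d 4
  rcases this with h | h
  · refine ⟨1, ((d / 4 : ℤ) : 𝓞 K), ?_⟩
    conv_lhs => rw [← h1, h]
    push_cast; ring
  · refine ⟨ζ ^ 2 ^ (k + 2), ((d / 4 : ℤ) : 𝓞 K) + 1, ?_⟩
    rw [zeta_i hζ]
    conv_lhs => rw [← h1, h]
    push_cast; ring

lemma two_notMem {d : ℕ} (hd : Odd d) {P : Ideal (𝓞 K)} (hP : P.IsPrime) (h : (d : 𝓞 K) ∈ P) :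
    (2 : 𝓞 K) ∉ P := by
  have := coprime_notMem (b := 2) (Nat.coprime_two_right.2 hd) hP h
  simpa using this

lemma exists_P (k : ℕ) [IsCyclotomicExtension {2 ^ (k + 4)} ℚ K] {p : ℕ} (hp : p.Prime) (hp2 : Odd p) :
    ∃ P : Ideal (𝓞 K), P.IsPrime ∧ (p : 𝓞 K) ∈ P := by
  obtain ⟨S, hS, hc⟩ := primes_over K k hp hp2
  have : S.Nonempty := by
    rw [Finset.nonempty_iff_ne_empty]
    rintro rfl
    simp at hc
    exact absurd hc (by positivity)
  obtain ⟨P, hP⟩ := this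
  exact ⟨P, (hS P).1 hP⟩

lemma od_d (k : ℕ) [IsCyclotomicExtension {2 ^ (k + 4)} ℚ K] {d : ℕ} (hd : Squarefree d) (hd2 : Odd d)
    (v : HeightOneSpectrum (𝓞 K)) (h : (d : 𝓞 K) ∈ v.asIdeal) : Odd (od v (((d : 𝓞 K)) : K)) := by
  have := v.isPrime
  rw [od_mem v h (d_notMem_sq k hd hd2 _ h).1]
  decide

lemma mem_of_dvd {p d : ℕ} (h : p ∣ d) {P : Ideal (𝓞 K)} (hP : (p : 𝓞 K) ∈ P) : (d : 𝓞 K) ∈ P := by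
  obtain ⟨m, rfl⟩ := h
  rw [Nat.cast_mul]
  exact P.mul_mem_right _ hP

lemma nonsq_d (k : ℕ) [IsCyclotomicExtension {2 ^ (k + 4)} ℚ K] {d : ℕ} (hd : Squarefree d) (hd2 : Odd d) (h1 : d ≠ 1) :
    ¬ IsSquare (((d : 𝓞 K)) : K) := by
  obtain ⟨p, hp, hpd⟩ := Nat.exists_prime_and_dvd h1
  obtain ⟨P, hP, hpP⟩ := exists_P (K := K) k hp (hd2.of_dvd_nat hpd)
  have hdP := mem_of_dvd hpd hpP
  exact not_sq_of_od (v := ⟨P, hP, ne_bot_of_mem hp.ne_zero hpP⟩) (od_d k hd hd2 _ hdP)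

section
variable {L : Type*} [Field L] [NumberField L] [Algebra K L] [Algebra.IsQuadraticExtension K L]
  [IsTotallyComplex K] [IsCyclotomicExtension {2 ^ (k + 4)} ℚ K]
  {d : ℕ} {r : L} {σ : L ≃ₐ[K] L}

lemma d_bound (hζ : IsPrimitiveRoot ζ (2 ^ (k + 4))) (hd : Squarefree d) (hd2 : Odd d) (h1 : d ≠ 1)
    (hr : r ^ 2 = algebraMap K L (((d : 𝓞 K)) : K)) (hσ : σ ≠ 1) (S : Finset (Ideal (𝓞 K)))
    (hS : ∀ P : Ideal (𝓞 K), P.IsPrime → (d : 𝓞 K) ∈ P → P ∈ S) :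
    N2 L * 2 * (nm (su σ)).range.relIndex ((pr L).ker ⊓ (df (su σ)).ker) ≤ 2 ^ S.card ∧
    (nm (su σ)).range.relIndex ((pr L).ker ⊓ (df (su σ)).ker) ≠ 0 := by
  have := fact_tc K L
  have hs := sig_root hσ (nonsq_d k hd hd2 h1) hr
  obtain ⟨y, z, hyz⟩ := sq_mod4 hζ (d : ℤ) (by exact_mod_cast hd2)
  rw [Int.cast_natCast] at hyz
  obtain ⟨T, hT, hT2⟩ := ram_finset hσ S (by
    intro P hP
    have := ram_mem (γ := (((d : 𝓞 K)) : K)) (g := (d : 𝓞 K)) ⟨⟨1, one_ne_zero, by rw [one_pow, one_mul]⟩, y, z, hyz⟩ hr hs P hP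
    have hPp := hP.1
    exact hS _ (hPp.comap _) this)
  exact thmB hσ _ T hT hT2 (odd_cyc (k + 2) K)

lemma nonnorm_at (hd : Squarefree d) (hd2 : Odd d)
    (hr : r ^ 2 = algebraMap K L (((d : 𝓞 K)) : K)) (hσ : σ ≠ 1) (k : ℕ) [IsCyclotomicExtension {2 ^ (k + 4)} ℚ K]
    (P : Ideal (𝓞 K)) (hP : P.IsPrime) (hdP : (d : 𝓞 K) ∈ P) (q : ℕ) (hq : Ideal.absNorm P = 2 * q + 1)
    (u : (𝓞 K)ˣ) (hu : (u : 𝓞 K) ^ q + 1 ∈ P) : NonNorm σ u := by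
  have h0 := ne_bot_of_mem hd.ne_zero hdP
  exact nonnorm_of hr hσ ⟨P, hP, h0⟩ (od_d k hd hd2 _ hdP) (two_notMem hd2 hP hdP) u
    (fun x => euler_nonsq P h0 (two_notMem hd2 hP hdP) q hq u hu x)

end

/-- data attached to a prime of level `c` -/
lemma lev_data [IsCyclotomicExtension {2 ^ (k + 4)} ℚ K] (hζ : IsPrimitiveRoot ζ (2 ^ (k + 4)))
    {p c : ℕ} (hp : p.Prime) (hp2 : Odd p) (h : Lev p c) (hk : c ≤ k + 3) (hp16 : p % 16 ≠ 1) :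
    ∃ q, p ^ 2 ^ (k + 4 - c) = 2 * q + 1 ∧ ζ ^ q = -1 ∧
      (∀ P : Ideal (𝓞 K), P.IsPrime → (p : 𝓞 K) ∈ P → Ideal.absNorm P = 2 * q + 1) ∧
      ∃ S : Finset (Ideal (𝓞 K)), (∀ P, P ∈ S ↔ P.IsPrime ∧ (p : 𝓞 K) ∈ P) ∧ S.card = 2 ^ (c - 1) := by
  obtain ⟨s, hs⟩ := h.val k hk
  have ho := h.order k hk hp16
  refine ⟨2 ^ (k + 3) * (2 * s + 1), ?_, ?_, ?_, ?_⟩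
  · rw [hs]; ring
  · rw [pow_mul, zeta_half hζ, Odd.neg_one_pow ⟨s, rfl⟩]
  · intro P hP hpP
    rw [norm_P k hp hp2 P hpP, ho, hs]; ring
  · obtain ⟨S, hS, hc⟩ := primes_over K k hp hp2
    refine ⟨S, hS, ?_⟩
    rw [ho] at hc
    have h2 := h.1
    have : 2 ^ (k + 3) = 2 ^ (c - 1) * 2 ^ (k + 4 - c) := by rw [← pow_add]; congr 1; omega
    rw [this] at hc
    exact Nat.eq_of_mul_eq_mul_right (by positivity) hc

/-- evaluation of the norm product of `V` -/
lemma V_prod (hζ : IsPrimitiveRoot ζ (2 ^ (k + 4)))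
    {p c : ℕ} (hp2 : Odd p) (h : Lev p c) (j : ℕ) (hj : j + c = k + 3) (a : ℕ) (ha : Odd a) :
    (∏ i ∈ Finset.range (2 ^ (j + 1)), (1 + (ζ ^ a) ^ p ^ i + ((ζ ^ a) ^ p ^ i) ^ 2)) *
      ((1 - (ζ ^ 2 ^ j) ^ a) * (1 - ((ζ ^ 2 ^ j) ^ a) ^ p)) =
      ((1 - (ζ ^ 2 ^ j) ^ (3 * a)) * (1 - ((ζ ^ 2 ^ j) ^ (3 * a)) ^ p)) := by
  have h1 : ∀ a, Odd a → (ζ ^ a) ^ 2 ^ (j + c) = -1 := by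
    intro a ha
    rw [← pow_mul, mul_comm, pow_mul, hj, zeta_half hζ, ha.neg_one_pow]
  have e1 := halving h hp2 j (ζ ^ a) (h1 a ha)
  have e2 := halving h hp2 j (ζ ^ (3 * a)) (h1 _ (Nat.odd_mul.2 ⟨by decide, ha⟩))
  have e3 : ∀ a, (ζ ^ a) ^ 2 ^ j = (ζ ^ 2 ^ j) ^ a := fun a => by rw [← pow_mul, ← pow_mul, mul_comm]
  rw [e3] at e1 e2
  rw [← e1, ← e2, ← Finset.prod_mul_distrib]
  apply Finset.prod_congr rfl
  intro i _
  have : (ζ ^ (3 * a)) ^ p ^ i = ((ζ ^ a) ^ p ^ i) ^ 3 := by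
    rw [← pow_mul, ← pow_mul, ← pow_mul]; congr 1; ring
  rw [this]
  ring

end
end CG

open NumberField nonZeroDivisors
set_option linter.all false
namespace CG
open IsDedekindDomain

section
variable {K : Type*} [Field K] [NumberField K] {k : ℕ} {ζ : 𝓞 K}

lemma exists_aut [IsCyclotomicExtension {2 ^ (k + 4)} ℚ K] (hζ : IsPrimitiveRoot ζ (2 ^ (k + 4)))
    (a : ℕ) (ha : Odd a) : ∃ τ : 𝓞 K →+* 𝓞 K, τ ζ = ζ ^ a := by
  have hζK : IsPrimitiveRoot (ζ : K) (2 ^ (k + 4)) := hζ.map_of_injective RingOfIntegers.coe_injective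
  have hcop : a.Coprime (2 ^ (k + 4)) := Nat.Coprime.pow_right _ (Nat.coprime_two_right.2 ha)
  have hirr : Irreducible (Polynomial.cyclotomic (2 ^ (k + 4)) ℚ) :=
    Polynomial.cyclotomic.irreducible_rat (by positivity)
  obtain ⟨τ, hτ⟩ : ∃ τ : K ≃ₐ[ℚ] K, τ (ζ : K) = (ζ : K) ^ a := by
    let f := (hζK.powerBasis ℚ).lift ((ζ : K) ^ a) (by
      rw [IsPrimitiveRoot.powerBasis_gen ℚ hζK, ← hζK.minpoly_eq_cyclotomic_of_irreducible hirr,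
        (hζK.pow_of_coprime a hcop).minpoly_eq_cyclotomic_of_irreducible hirr]
      exact minpoly.aeval _ _)
    have hf : f (ζ : K) = (ζ : K) ^ a := by
      have := (hζK.powerBasis ℚ).lift_gen ((ζ : K) ^ a) (by
        rw [IsPrimitiveRoot.powerBasis_gen ℚ hζK, ← hζK.minpoly_eq_cyclotomic_of_irreducible hirr,
        (hζK.pow_of_coprime a hcop).minpoly_eq_cyclotomic_of_irreducible hirr]
        exact minpoly.aeval _ _)
      exact (congrArg f (IsPrimitiveRoot.powerBasis_gen ℚ hζK)).symm.trans this
    exact ⟨AlgEquiv.ofBijective f (Algebra.IsAlgebraic.algHom_bijective f), hf⟩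
  refine ⟨RingOfIntegers.mapRingHom τ, ?_⟩
  apply RingOfIntegers.ext
  exact hτ

/-- powers of `w` with `w^n=-1` -/
lemma w_ne_one {w : 𝓞 K} {n m : ℕ} (hw : w ^ n = -1) (hm : Odd m) : w ^ m ≠ 1 := by
  intro h
  have h1 : (w ^ n) ^ m = 1 := by rw [← pow_mul, mul_comm, pow_mul, h, one_pow]
  rw [hw, hm.neg_one_pow] at h1
  have : (2 : 𝓞 K) = 0 := by linear_combination -h1
  exact two_ne_zero this

lemma w_mod {w : 𝓞 K} {n : ℕ} (hw : w ^ n = -1) (m : ℕ) : w ^ m = w ^ (m % (2 * n)) := by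
  conv_lhs => rw [← Nat.div_add_mod m (2 * n)]
  rw [pow_add, pow_mul, mul_comm 2 n, pow_mul, hw]
  simp

section
variable {L : Type*} [Field L] [NumberField L] [Algebra K L] [Algebra.IsQuadraticExtension K L]
  [IsTotallyComplex K] [IsCyclotomicExtension {2 ^ (k + 4)} ℚ K]
  {r : L}

theorem bound_prime (hζ : IsPrimitiveRoot ζ (2 ^ (k + 4))) {p : ℕ} (hp : p.Prime)
    (h : p % 8 = 3 ∨ p % 8 = 5) (hr : r ^ 2 = algebraMap K L (((p : 𝓞 K)) : K)) : N2 L = 1 := by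
  have := fact_tc K L
  obtain ⟨σ, hσ⟩ := exists_sig K L
  have hp2 : Odd p := by rw [Nat.odd_iff]; omega
  obtain ⟨q, h1, h2, h3, S, hS, hc⟩ := lev_data (K := K) hζ hp hp2 (lev_two h) (by omega) (by omega)
  obtain ⟨b1, b2⟩ := d_bound hζ hp.prime.squarefree hp2 hp.ne_one hr hσ S (fun P a b => (hS P).2 ⟨a, b⟩)
  obtain ⟨P, hP, hpP⟩ := exists_P (K := K) k hp hp2
  have hu : IsUnit ζ := hζ.isUnit (by positivity)
  have h4 := index_of_nonnorm1 hσ hu.unit (nonnorm_at hp.prime.squarefree hp2 hr hσ k P hP hpP q (h3 P hP hpP) _ (by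
    rw [IsUnit.unit_spec, h2]; simp)) b2
  rw [hc] at b1
  have := N2_pos L
  generalize (nm (su σ)).range.relIndex ((pr L).ker ⊓ (df (su σ)).ker) = e at *
  norm_num at b1
  nlinarith

theorem bound_two (hζ : IsPrimitiveRoot ζ (2 ^ (k + 4))) {p q : ℕ} (hp : p.Prime) (hq : q.Prime)
    (h : p % 8 = 5) (h' : q % 8 = 3) (hr : r ^ 2 = algebraMap K L ((((p * q : ℕ) : 𝓞 K)) : K)) : N2 L ≤ 2 := by
  classical
  have := fact_tc K L
  obtain ⟨σ, hσ⟩ := exists_sig K L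
  have hp2 : Odd p := by rw [Nat.odd_iff]; omega
  have hq2 : Odd q := by rw [Nat.odd_iff]; omega
  have hpq2 : Odd (p * q) := Nat.odd_mul.2 ⟨hp2, hq2⟩
  have hne : p ≠ q := by rintro rfl; omega
  have hsf : Squarefree (p * q) := by
    rw [Nat.squarefree_mul ((Nat.coprime_primes hp hq).2 hne)]
    exact ⟨hp.prime.squarefree, hq.prime.squarefree⟩
  obtain ⟨a, h1, h2, h3, S, hS, hc⟩ := lev_data (K := K) hζ hp hp2 (lev_two (Or.inr h)) (by omega) (by omega)
  obtain ⟨a', h1', h2', h3', S', hS', hc'⟩ := lev_data (K := K) hζ hq hq2 (lev_two (Or.inl h')) (by omega) (by omega)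
  obtain ⟨b1, b2⟩ := d_bound hζ hsf hpq2 (by have := hp.one_lt; have := hq.one_lt; intro h; nlinarith) hr hσ (S ∪ S') (fun P a b => by
    rw [Nat.cast_mul] at b
    rw [Finset.mem_union, hS, hS']
    rcases a.mem_or_mem b with h | h
    · exact Or.inl ⟨a, h⟩
    · exact Or.inr ⟨a, h⟩)
  obtain ⟨P, hP, hpP⟩ := exists_P (K := K) k hp hp2
  obtain ⟨Q, hQ, hqQ⟩ := exists_P (K := K) k hq hq2
  have hu : IsUnit ζ := hζ.isUnit (by positivity)
  have hv := V_unit hζ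
  have hdP := mem_of_dvd (Dvd.intro q rfl) hpP
  have hdQ := mem_of_dvd (Dvd.intro_left p rfl) hqQ
  have hw : (ζ ^ 2 ^ (k + 1)) ^ 4 = -1 := by rw [← zeta_half hζ, ← pow_mul]; congr 1; ring
  have e1 := V_prod hζ hp2 (lev_two (Or.inr h)) (k + 1) (by omega) 1 odd_one
  have e2 := V_prod hζ hq2 (lev_two (Or.inl h')) (k + 1) (by omega) 1 odd_one
  have f1 := V_pow hp hp2 P hpP ζ (2 ^ (k + 4 - 2)) a h1
  have f2 := V_pow hq hq2 Q hqQ ζ (2 ^ (k + 4 - 2)) a' h1'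
  rw [show k + 4 - 2 = k + 1 + 1 by omega] at f1 f2
  simp only [pow_one, mul_one] at e1 e2
  set w := ζ ^ 2 ^ (k + 1)
  clear_value w
  rw [w_mod hw p, show p % (2 * 4) = 5 from h, ← pow_mul w 3 p, w_mod hw (3 * p), show 3 * p % (2 * 4) = 7 by omega] at e1
  rw [w_mod hw q, show q % (2 * 4) = 3 from h', ← pow_mul w 3 q, w_mod hw (3 * q), show 3 * q % (2 * 4) = 1 by omega] at e2
  have n1 : w ^ 1 ≠ 1 := w_ne_one hw odd_one
  have n3 : w ^ 3 ≠ 1 := w_ne_one hw (by decide)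
  have n5 : w ^ 5 ≠ 1 := w_ne_one hw (by decide)
  rw [pow_one] at n1
  have e1' : ∏ i ∈ Finset.range (2 ^ (k + 1 + 1)), (1 + ζ ^ p ^ i + (ζ ^ p ^ i) ^ 2) = w ^ 2 := by
    apply mul_right_cancel₀ (mul_ne_zero (sub_ne_zero.2 n1.symm) (sub_ne_zero.2 n5.symm))
    rw [e1]
    linear_combination (1 - w ^ 2) * (1 - w ^ 4) * hw
  have e2' : ∏ i ∈ Finset.range (2 ^ (k + 1 + 1)), (1 + ζ ^ q ^ i + (ζ ^ q ^ i) ^ 2) = 1 := by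
    apply mul_right_cancel₀ (mul_ne_zero (sub_ne_zero.2 n1.symm) (sub_ne_zero.2 n3.symm))
    rw [e2]
    ring
  rw [e1'] at f1
  rw [e2', one_pow] at f2
  have g1 : (w ^ 2) ^ ((p - 1) / 2) = -1 := by
    rw [← pow_mul, w_mod hw, show 2 * ((p - 1) / 2) % (2 * 4) = 4 by omega, hw]
  rw [g1, sub_neg_eq_add] at f1
  have h4 := index_of_nonnorm2 hσ hu.unit hv.unit
    (nonnorm_at hsf hpq2 hr hσ k P hP hdP a (h3 P hP hpP) _ (by
      rw [IsUnit.unit_spec, h2]; simp))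
    (nonnorm_at hsf hpq2 hr hσ k P hP hdP a (h3 P hP hpP) _ (by
      rw [IsUnit.unit_spec]; exact f1))
    (nonnorm_at hsf hpq2 hr hσ k Q hQ hdQ a' (h3' Q hQ hqQ) _ (by
      rw [Units.val_mul, IsUnit.unit_spec, IsUnit.unit_spec, mul_pow, h2']
      have := Q.neg_mem f2
      convert this using 1; ring)) b2
  have hcard := Finset.card_union_le S S'
  rw [hc, hc'] at hcard
  have h5 : 2 ^ (S ∪ S').card ≤ 2 ^ 4 := Nat.pow_le_pow_right (by simp) (by simpa using hcard)
  generalize (nm (su σ)).range.relIndex ((pr L).ker ⊓ (df (su σ)).ker) = e at *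
  nlinarith

theorem bound_seven (hζ : IsPrimitiveRoot ζ (2 ^ (k + 4))) {p : ℕ} (hp : p.Prime)
    (h : p % 16 = 7) (hr : r ^ 2 = algebraMap K L (((p : 𝓞 K)) : K)) : N2 L ≤ 2 := by
  have := fact_tc K L
  obtain ⟨σ, hσ⟩ := exists_sig K L
  have hp2 : Odd p := by rw [Nat.odd_iff]; omega
  have hsf := hp.prime.squarefree
  obtain ⟨a, h1, h2, h3, S, hS, hc⟩ := lev_data (K := K) hζ hp hp2 (lev_three h) (by omega) (by omega)
  obtain ⟨b1, b2⟩ := d_bound hζ hsf hp2 hp.ne_one hr hσ S (fun P a b => (hS P).2 ⟨a, b⟩)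
  obtain ⟨P, hP, hpP⟩ := exists_P (K := K) k hp hp2
  obtain ⟨τ, hτ⟩ := exists_aut hζ 3 (by decide)
  have hP' : (P.comap τ).IsPrime := hP.comap τ
  have hpP' : (p : 𝓞 K) ∈ P.comap τ := by rw [Ideal.mem_comap, map_natCast]; exact hpP
  have hu : IsUnit ζ := hζ.isUnit (by positivity)
  have hv := V_unit hζ
  have hw : (ζ ^ 2 ^ k) ^ 8 = -1 := by rw [← zeta_half hζ, ← pow_mul]; congr 1; ring
  have e1 := V_prod hζ hp2 (lev_three h) k (by omega) 1 odd_one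
  have e2 := V_prod hζ hp2 (lev_three h) k (by omega) 3 (by decide)
  have f1 := V_pow hp hp2 P hpP ζ (2 ^ (k + 4 - 3)) a h1
  have f2 := V_pow hp hp2 P hpP (ζ ^ 3) (2 ^ (k + 4 - 3)) a h1
  rw [show k + 4 - 3 = k + 1 by omega] at f1 f2
  simp only [pow_one, mul_one] at e1
  set w := ζ ^ 2 ^ k
  clear_value w
  rw [w_mod hw p, show p % (2 * 8) = 7 from h, ← pow_mul w 3 p, w_mod hw (3 * p), show 3 * p % (2 * 8) = 5 by omega] at e1
  rw [← pow_mul w 3 p, w_mod hw (3 * p), show 3 * p % (2 * 8) = 5 by omega, ← pow_mul w (3 * 3) p, w_mod hw (3 * 3 * p),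
    show 3 * 3 * p % (2 * 8) = 15 by omega] at e2
  have n3 : w ^ 3 ≠ 1 := w_ne_one hw (by decide)
  have n5 : w ^ 5 ≠ 1 := w_ne_one hw (by decide)
  have n6 : w + w ^ 7 ≠ 0 := by
    intro h0
    have hw0 : w ≠ 0 := by rintro h; rw [h] at hw; simp at hw
    have : w ^ 6 = -1 := by
      apply mul_left_cancel₀ hw0
      linear_combination h0
    exact w_ne_one this (m := 3) (by decide) (by
      exfalso
      have h24 : w ^ 24 = -1 := by
        calc w ^ 24 = (w ^ 8) ^ 3 := by ring
          _ = -1 := by rw [hw]; ring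
      have h24' : w ^ 24 = 1 := by
        calc w ^ 24 = (w ^ 6) ^ 4 := by ring
          _ = 1 := by rw [this]; ring
      rw [h24] at h24'
      have : (2 : 𝓞 K) = 0 := by linear_combination -h24'
      exact two_ne_zero this)
  set A := ∏ i ∈ Finset.range (2 ^ (k + 1)), (1 + ζ ^ p ^ i + (ζ ^ p ^ i) ^ 2)
  set B := ∏ i ∈ Finset.range (2 ^ (k + 1)), (1 + (ζ ^ 3) ^ p ^ i + ((ζ ^ 3) ^ p ^ i) ^ 2)
  have hAB : A * B = -1 := by
    apply mul_right_cancel₀ n6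
    have e3 : (1 - w) * (1 - w ^ 7) = - (w + w ^ 7) := by linear_combination hw
    have e4 : (1 - w ^ (3 * 3)) * (1 - w ^ 15) = w + w ^ 7 := by
      linear_combination (-w - w ^ 7 + w ^ 16 - w ^ 8 + 1) * hw
    rw [e3] at e1
    rw [e4] at e2
    linear_combination (-B) * e1 - e2
  have hodd : Odd ((p - 1) / 2) := by rw [Nat.odd_iff]; omega
  -- product relation
  have hprod : (1 + ζ + ζ ^ 2) ^ a * (1 + ζ ^ 3 + (ζ ^ 3) ^ 2) ^ a + 1 ∈ P := by
    have h7 : A ^ ((p - 1) / 2) * B ^ ((p - 1) / 2) = -1 := by rw [← mul_pow, hAB, hodd.neg_one_pow]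
    have := P.add_mem (P.mul_mem_right ((1 + ζ ^ 3 + (ζ ^ 3) ^ 2) ^ a) f1) (P.mul_mem_left (A ^ ((p - 1) / 2)) f2)
    convert this using 1
    linear_combination h7
  have hsq : ((1 + ζ + ζ ^ 2) ^ a - 1) * ((1 + ζ + ζ ^ 2) ^ a + 1) ∈ P := by
    by_contra hcon
    have hP0 := ne_bot_of_mem hp.ne_zero hpP
    have hmax : P.IsMaximal := hP.isMaximal hP0
    letI := Ideal.Quotient.field P
    have hfin : Finite (𝓞 K ⧸ P) := Ideal.finiteQuotientOfFreeOfNeBot P hP0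
    letI := Fintype.ofFinite (𝓞 K ⧸ P)
    have hcard : Fintype.card (𝓞 K ⧸ P) = 2 * a + 1 := by
      rw [← h3 P hP hpP, ← Nat.card_eq_fintype_card]; rfl
    have hne : Ideal.Quotient.mk P (1 + ζ + ζ ^ 2) ≠ 0 := (hv.map (Ideal.Quotient.mk P)).ne_zero
    have := FiniteField.pow_card_sub_one_eq_one _ hne
    rw [hcard, Nat.add_sub_cancel] at this
    apply hcon
    rw [← Ideal.Quotient.eq_zero_iff_mem, show ((1 + ζ + ζ ^ 2) ^ a - 1) * ((1 + ζ + ζ ^ 2) ^ a + 1) =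
      (1 + ζ + ζ ^ 2) ^ (2 * a) - 1 by ring, map_sub, map_pow, this, map_one, sub_self]
  have hτV : τ (1 + ζ + ζ ^ 2) = 1 + ζ ^ 3 + (ζ ^ 3) ^ 2 := by simp [hτ]
  have hζn : NonNorm σ hu.unit := nonnorm_at hsf hp2 hr hσ k P hP hpP a (h3 P hP hpP) _ (by
      rw [IsUnit.unit_spec, h2]; simp)
  have h4 : 4 ≤ (nm (su σ)).range.relIndex ((pr L).ker ⊓ (df (su σ)).ker) := by
    rcases hP.mem_or_mem hsq with hc1 | hc1
    · refine index_of_nonnorm2 hσ hu.unit hv.unit hζn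
        (nonnorm_at hsf hp2 hr hσ k _ hP' hpP' a (h3 _ hP' hpP') _ ?_)
        (nonnorm_at hsf hp2 hr hσ k P hP hpP a (h3 P hP hpP) _ ?_) b2
      · rw [IsUnit.unit_spec, Ideal.mem_comap, map_add, map_pow, hτV, map_one]
        have := P.sub_mem hprod (P.mul_mem_right ((1 + ζ ^ 3 + (ζ ^ 3) ^ 2) ^ a) hc1)
        convert this using 1; ring
      · rw [Units.val_mul, IsUnit.unit_spec, IsUnit.unit_spec, mul_pow, h2]
        have := P.neg_mem hc1
        convert this using 1; ring
    · refine index_of_nonnorm2 hσ hu.unit hv.unit hζn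
        (nonnorm_at hsf hp2 hr hσ k P hP hpP a (h3 P hP hpP) _ ?_)
        (nonnorm_at hsf hp2 hr hσ k _ hP' hpP' a (h3 _ hP' hpP') _ ?_) b2
      · rw [IsUnit.unit_spec]; exact hc1
      · rw [Units.val_mul, IsUnit.unit_spec, IsUnit.unit_spec, mul_pow, h2, Ideal.mem_comap, map_add, map_mul,
          map_neg, map_one, map_pow, hτV]
        have := P.sub_mem hprod (P.mul_mem_right ((1 + ζ ^ 3 + (ζ ^ 3) ^ 2) ^ a) hc1)
        convert this using 1; ring
  rw [hc] at b1
  generalize (nm (su σ)).range.relIndex ((pr L).ker ⊓ (df (su σ)).ker) = e at *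
  norm_num at b1
  nlinarith

end
end
end CG

open NumberField nonZeroDivisors
set_option linter.all false
namespace CG
open IsDedekindDomain

section
variable {K : Type*} [Field K] [NumberField K] {k : ℕ} {ζ : 𝓞 K}

/-- data making `K(√d)(√γ)` unramified with controlled parity -/
def Good (L : Type*) [Field L] [NumberField L] [Algebra K L] (d : ℕ) (γ : 𝓞 K) : Prop :=
  Unr (algebraMap K L (γ : K)) ∧ γ ≠ 0 ∧ ∀ v : HeightOneSpectrum (𝓞 K), (d : 𝓞 K) ∈ v.asIdeal → OddAt v γ

section
variable {L : Type*} [Field L] [NumberField L] [Algebra K L] [Algebra.IsQuadraticExtension K L]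
  [IsCyclotomicExtension {2 ^ (k + 4)} ℚ K]
  {r : L}

lemma good_of_dvd (hζ : IsPrimitiveRoot ζ (2 ^ (k + 4))) {d : ℕ} (hd : Squarefree d) (hd2 : Odd d)
    (hr : r ^ 2 = algebraMap K L (((d : 𝓞 K)) : K)) (γ γ' : 𝓞 K)
    (h : γ * γ' = d ∨ γ * γ' = -d) (hγ : ∃ y z, γ = y ^ 2 + 4 * z) : Good L d γ := by
  have hd0 : (d : 𝓞 K) ≠ 0 := Nat.cast_ne_zero.2 hd.ne_zero
  have hdvd : γ ∣ (d : 𝓞 K) := by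
    rcases h with h | h
    · exact Dvd.intro _ h
    · exact ⟨-γ', by linear_combination h⟩
  obtain ⟨c, hc, hcc, e, he, heo⟩ : ∃ c : 𝓞 K, c ≠ 0 ∧ γ * γ' = c ^ 2 * d ∧ ∃ e : ℤ, γ * γ' = (e : 𝓞 K) ∧ Odd e := by
    rcases h with h | h
    · exact ⟨1, one_ne_zero, by rw [h]; ring, d, by rw [h]; simp, by exact_mod_cast hd2⟩
    · refine ⟨ζ ^ 2 ^ (k + 2), pow_ne_zero _ (hζ.ne_zero (by positivity)), by rw [zeta_i hζ, h]; ring, -d, by rw [h]; simp, ?_⟩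
      exact (show Odd (d : ℤ) by exact_mod_cast hd2).neg
  refine ⟨?_, ?_, ?_⟩
  · refine unr_of_base hr γ γ' c hc hd0 hcc ?_ hγ ?_
    · intro P hP h1 h2
      have h3 : (d : 𝓞 K) ∈ P ^ 2 := by
        have h4 := Ideal.mul_mem_mul h1 h2
        rw [← pow_two] at h4
        rcases h with h | h
        · rwa [h] at h4
        · rw [h] at h4; simpa using h4
      exact (d_notMem_sq k hd hd2 P (Ideal.pow_le_self two_ne_zero h3)).1 h3
    · obtain ⟨y, z, hyz⟩ := hγ
      obtain ⟨y', z', hyz'⟩ := sq_mod4 hζ e heo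
      obtain ⟨w, s, hw⟩ : ∃ w s : 𝓞 K, w * γ = 1 + 4 * s := by
        have h1 := Int.mul_ediv_add_emod e 4
        have : e % 4 = 1 ∨ e % 4 = 3 := by
          obtain ⟨m, rfl⟩ := heo
          omega
        rcases this with h5 | h5
        · refine ⟨γ', ((e / 4 : ℤ) : 𝓞 K), ?_⟩
          rw [mul_comm, he]
          conv_lhs => rw [← h1, h5]
          push_cast; ring
        · refine ⟨-γ', -((e / 4 : ℤ) : 𝓞 K) - 1, ?_⟩
          rw [mul_comm, mul_neg, he]
          conv_lhs => rw [← h1, h5]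
          push_cast; ring
      exact sq_mod_four_div γ γ' e s y z y' z' w he hyz' hyz hw
  · rintro rfl
    exact hd0 (zero_dvd_iff.1 hdvd)
  · intro v hv
    have := v.isPrime
    exact oddAt_of_dvd hdvd (d_notMem_sq k hd hd2 _ hv).1

lemma v_of (P : Ideal (𝓞 K)) (hP : P.IsPrime) {d : ℕ} (hd : d ≠ 0) (h : (d : 𝓞 K) ∈ P) :
    ∃ v : HeightOneSpectrum (𝓞 K), v.asIdeal = P := ⟨⟨P, hP, ne_bot_of_mem hd h⟩, rfl⟩

lemma nsq_good (hζ : IsPrimitiveRoot ζ (2 ^ (k + 4))) {d : ℕ} (hd : Squarefree d) (hd2 : Odd d)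
    (hr : r ^ 2 = algebraMap K L (((d : 𝓞 K)) : K)) {γ : 𝓞 K} (h : Good L d γ)
    (P Q : Ideal (𝓞 K)) (hP : P.IsPrime) (hQ : Q.IsPrime) (hdP : (d : 𝓞 K) ∈ P) (hdQ : (d : 𝓞 K) ∈ Q)
    (h1 : γ ∈ P) (h2 : γ ∉ Q) : ¬ IsSquare (algebraMap K L (γ : K)) := by
  obtain ⟨v, rfl⟩ := v_of P hP hd.ne_zero hdP
  obtain ⟨w, rfl⟩ := v_of Q hQ hd.ne_zero hdQ
  refine not_sq_L hr (by simpa using h.2.1) (od_d k hd hd2 v hdP) (od_d k hd hd2 w hdQ) ?_ ?_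
  · exact (od_parity (h.2.2 v hdP)).2 h1
  · rw [od_parity (h.2.2 w hdQ)]; exact h2

lemma nsq_good2 (hζ : IsPrimitiveRoot ζ (2 ^ (k + 4))) {d : ℕ} (hd : Squarefree d) (hd2 : Odd d)
    (hr : r ^ 2 = algebraMap K L (((d : 𝓞 K)) : K)) {γ δ : 𝓞 K} (h : Good L d γ) (h' : Good L d δ)
    (P Q : Ideal (𝓞 K)) (hP : P.IsPrime) (hQ : Q.IsPrime) (hdP : (d : 𝓞 K) ∈ P) (hdQ : (d : 𝓞 K) ∈ Q)
    (h1 : γ ∈ P ∧ δ ∉ P) (h2 : γ ∈ Q ↔ δ ∈ Q) : ¬ IsSquare (algebraMap K L (γ : K) * algebraMap K L (δ : K)) := by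
  obtain ⟨v, rfl⟩ := v_of P hP hd.ne_zero hdP
  obtain ⟨w, rfl⟩ := v_of Q hQ hd.ne_zero hdQ
  have g0 : (γ : K) ≠ 0 := by simpa using h.2.1
  have d0 : (δ : K) ≠ 0 := by simpa using h'.2.1
  rw [← map_mul]
  refine not_sq_L hr (mul_ne_zero g0 d0) (od_d k hd hd2 v hdP) (od_d k hd hd2 w hdQ) ?_ ?_
  · rw [od_mul v g0 d0, Int.odd_add, od_parity (h.2.2 v hdP), ← Int.not_odd_iff_even, od_parity (h'.2.2 v hdP)]
    tauto
  · rw [od_mul w g0 d0, Int.odd_add, od_parity (h.2.2 w hdQ), ← Int.not_odd_iff_even, od_parity (h'.2.2 w hdQ)]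
    tauto

/-- pattern 11, 10, 00 -/
theorem V4a [IsTotallyComplex L] (hζ : IsPrimitiveRoot ζ (2 ^ (k + 4))) {d : ℕ} (hd : Squarefree d) (hd2 : Odd d)
    (hr : r ^ 2 = algebraMap K L (((d : 𝓞 K)) : K)) {γ δ : 𝓞 K} (h : Good L d γ) (h' : Good L d δ)
    (P Q R : Ideal (𝓞 K)) (hP : P.IsPrime) (hQ : Q.IsPrime) (hR : R.IsPrime) (hdP : (d : 𝓞 K) ∈ P) (hdQ : (d : 𝓞 K) ∈ Q)
    (hdR : (d : 𝓞 K) ∈ R) (hp : γ ∈ P ∧ δ ∈ P) (hq : γ ∈ Q ∧ δ ∉ Q) (hr' : γ ∉ R ∧ δ ∉ R) :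
    ¬ IsCyclic (CommGroup.primaryComponent (ClassGroup (𝓞 L)) 2) :=
  V4 (nsq_good hζ hd hd2 hr h P R hP hR hdP hdR hp.1 hr'.1)
    (nsq_good hζ hd hd2 hr h' P R hP hR hdP hdR hp.2 hr'.2)
    (nsq_good2 hζ hd hd2 hr h h' Q R hQ hR hdQ hdR hq (by tauto)) h.1 h'.1

/-- pattern 10, 01, 00 -/
theorem V4b [IsTotallyComplex L] (hζ : IsPrimitiveRoot ζ (2 ^ (k + 4))) {d : ℕ} (hd : Squarefree d) (hd2 : Odd d)
    (hr : r ^ 2 = algebraMap K L (((d : 𝓞 K)) : K)) {γ δ : 𝓞 K} (h : Good L d γ) (h' : Good L d δ)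
    (P Q R : Ideal (𝓞 K)) (hP : P.IsPrime) (hQ : Q.IsPrime) (hR : R.IsPrime) (hdP : (d : 𝓞 K) ∈ P) (hdQ : (d : 𝓞 K) ∈ Q)
    (hdR : (d : 𝓞 K) ∈ R) (hp : γ ∈ P ∧ δ ∉ P) (hq : δ ∈ Q) (hr' : γ ∉ R ∧ δ ∉ R) :
    ¬ IsCyclic (CommGroup.primaryComponent (ClassGroup (𝓞 L)) 2) :=
  V4 (nsq_good hζ hd hd2 hr h P R hP hR hdP hdR hp.1 hr'.1)
    (nsq_good hζ hd hd2 hr h' Q R hQ hR hdQ hdR hq hr'.2)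
    (nsq_good2 hζ hd hd2 hr h h' P R hP hR hdP hdR hp (by tauto)) h.1 h'.1

theorem nontriv_good [IsTotallyComplex L] (hζ : IsPrimitiveRoot ζ (2 ^ (k + 4))) {d : ℕ} (hd : Squarefree d) (hd2 : Odd d)
    (hr : r ^ 2 = algebraMap K L (((d : 𝓞 K)) : K)) {γ : 𝓞 K} (h : Good L d γ)
    (P Q : Ideal (𝓞 K)) (hP : P.IsPrime) (hQ : Q.IsPrime) (hdP : (d : 𝓞 K) ∈ P) (hdQ : (d : 𝓞 K) ∈ Q)
    (h1 : γ ∈ P) (h2 : γ ∉ Q) : Nontrivial (CommGroup.primaryComponent (ClassGroup (𝓞 L)) 2) :=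
  nontriv_of_unr (nsq_good hζ hd hd2 hr h P Q hP hQ hdP hdQ h1 h2) h.1

end

/-- special elements -/
lemma special (hζ : IsPrimitiveRoot ζ (2 ^ (k + 4))) :
    ∃ i s t : 𝓞 K, i ^ 2 = -1 ∧ s ^ 2 = 2 ∧ t ^ 2 = -2 ∧
      (∀ τ : 𝓞 K →+* 𝓞 K, τ ζ = ζ ^ 3 → τ i = -i ∧ τ s = -s ∧ τ t = t) ∧
      (∀ τ : 𝓞 K →+* 𝓞 K, τ ζ = ζ ^ 5 → τ i = i ∧ τ s = -s ∧ τ t = -t) ∧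
      (∀ τ : 𝓞 K →+* 𝓞 K, τ ζ = ζ ^ 7 → τ i = -i ∧ τ s = s ∧ τ t = -t) := by
  have hw : (ζ ^ 2 ^ (k + 1)) ^ 4 = -1 := by rw [← zeta_half hζ, ← pow_mul]; congr 1; ring
  have key : ∀ (a : ℕ) (τ : 𝓞 K →+* 𝓞 K), τ ζ = ζ ^ a → τ (ζ ^ 2 ^ (k + 1)) = (ζ ^ 2 ^ (k + 1)) ^ a := by
    intro a τ h
    rw [map_pow, h, ← pow_mul, ← pow_mul, mul_comm]
  set w := ζ ^ 2 ^ (k + 1)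
  clear_value w
  refine ⟨w ^ 2, w - w ^ 3, w + w ^ 3, by linear_combination hw, by linear_combination (w ^ 2 - 2) * hw,
    by linear_combination (w ^ 2 + 2) * hw, ?_, ?_, ?_⟩ <;> intro τ hτ <;> have := key _ τ hτ <;>
    simp only [map_add, map_sub, map_pow, this] <;> refine ⟨?_, ?_, ?_⟩
  · linear_combination w ^ 2 * hw
  · linear_combination (-w ^ 5 + w) * hw
  · linear_combination (w ^ 5 - w) * hw
  · linear_combination (w ^ 6 - w ^ 2) * hw
  · linear_combination (w - w ^ 11 + w ^ 7 - w ^ 3) * hw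
  · linear_combination (w + w ^ 11 - w ^ 7 + w ^ 3) * hw
  · linear_combination (w ^ 10 - w ^ 6 + w ^ 2) * hw
  · linear_combination (w ^ 3 - w ^ 17 + w ^ 13 - w ^ 9 + w ^ 5 - w) * hw
  · linear_combination (w ^ 3 + w ^ 17 - w ^ 13 + w ^ 9 - w ^ 5 + w) * hw

lemma sqm_a (hζ : IsPrimitiveRoot ζ (2 ^ (k + 4))) (X Y : ℤ) (hX : Odd X) (hY : Y % 4 = 0) (θ : 𝓞 K) :
    ∃ y z : 𝓞 K, (X : 𝓞 K) + Y * θ = y ^ 2 + 4 * z := by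
  obtain ⟨y, z, h⟩ := sq_mod4 hζ X hX
  obtain ⟨m, rfl⟩ := Int.dvd_of_emod_eq_zero hY
  exact ⟨y, z + m * θ, by rw [h]; push_cast; ring⟩

lemma sqm_b (hζ : IsPrimitiveRoot ζ (2 ^ (k + 4))) (X Y : ℤ) (hX : Odd X) (hY : Y % 2 = 0) (θ : 𝓞 K)
    (hθ : θ ^ 2 = 2 ∨ θ ^ 2 = -2) :
    ∃ y z : 𝓞 K, (X : 𝓞 K) + Y * θ = y ^ 2 + 4 * z := by
  have hθ' : ∃ u : 𝓞 K, θ ^ 2 = 2 + 4 * u := by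
    rcases hθ with h | h
    · exact ⟨0, by rw [h]; ring⟩
    · exact ⟨-1, by rw [h]; ring⟩
  obtain ⟨u, hu⟩ := hθ'
  by_cases h4 : Y % 4 = 0
  · exact sqm_a hζ X Y hX h4 θ
  have hY' : Y = 4 * (Y / 4) + 2 := by omega
  have hX' : X = 4 * (X / 4) + 1 ∨ X = 4 * (X / 4) + 3 := by rcases hX with ⟨m, rfl⟩; omega
  have hi := zeta_i hζ
  generalize X / 4 = a at *
  generalize Y / 4 = b at *
  subst hY'
  rcases hX' with rfl | rfl
  · refine ⟨ζ ^ 2 ^ (k + 2) * (1 + θ), a + b * θ + θ + 1 + u, ?_⟩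
    rw [mul_pow, hi]
    push_cast
    linear_combination hu
  · refine ⟨1 + θ, a + b * θ - u, ?_⟩
    push_cast
    linear_combination -hu
end
end CG

open NumberField nonZeroDivisors
set_option linter.all false
namespace CG
open IsDedekindDomain

lemma thue {p : ℕ} (hp : p.Prime) (c : ℤ) (hc : IsSquare (c : ZMod p)) :
    ∃ x y : ℤ, (x ≠ 0 ∨ y ≠ 0) ∧ x ^ 2 < p ∧ y ^ 2 < p ∧ (p : ℤ) ∣ x ^ 2 - c * y ^ 2 := by
  have : Fact p.Prime := ⟨hp⟩
  obtain ⟨a, ha⟩ := hc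
  set m := Nat.sqrt p
  have hm1 : p < (m + 1) * (m + 1) := Nat.lt_succ_sqrt p
  have hm2 : m * m ≤ p := Nat.sqrt_le p
  have hm3 : m * m ≠ p := by
    intro h
    have : IsSquare p := ⟨m, h.symm⟩
    exact hp.prime.not_isSquare this
  let f : Fin (m + 1) × Fin (m + 1) → ZMod p := fun u => (u.1 : ℕ) - a * (u.2 : ℕ)
  have hf : ¬ Function.Injective f := by
    intro hinj
    have := Fintype.card_le_of_injective f hinj
    simp [ZMod.card] at this
    omega
  rw [Function.Injective] at hf
  push Not at hf
  obtain ⟨⟨x1, y1⟩, ⟨x2, y2⟩, h1, h2⟩ := hf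
  simp only [f] at h1
  have b1 := x1.2
  have b2 := x2.2
  have b3 := y1.2
  have b4 := y2.2
  have bd : ∀ x : ℤ, -m ≤ x → x ≤ m → x ^ 2 < p := by
    intro x h3 h4
    have : x ^ 2 ≤ (m : ℤ) * m := by nlinarith
    have h5 : (m : ℤ) * m < p := by exact_mod_cast lt_of_le_of_ne hm2 hm3
    omega
  refine ⟨(x1 : ℕ) - (x2 : ℕ), (y1 : ℕ) - (y2 : ℕ), ?_, bd _ (by omega) (by omega), bd _ (by omega) (by omega), ?_⟩
  · by_contra hcon
    push Not at hcon
    apply h2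
    have e1 : x1 = x2 := by ext; omega
    have e2 : y1 = y2 := by ext; omega
    rw [e1, e2]
  · rw [← ZMod.intCast_zmod_eq_zero_iff_dvd]
    push_cast
    rw [ha]
    linear_combination ((x1 : ℕ) - (x2 : ℕ) + a * ((y1 : ℕ) - (y2 : ℕ)) : ZMod p) * h1

lemma no_sqrt2 {x y : ℤ} (h : x ^ 2 = 2 * y ^ 2) : x = 0 ∧ y = 0 := by
  have : Zsqrtd.Nonsquare 2 := ⟨by
    intro n h
    have : n < 2 := by nlinarith
    interval_cases n <;> omega⟩
  exact Zsqrtd.divides_sq_eq_zero_z (d := 2) (by push_cast; linear_combination h)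

lemma rep_neg {p : ℕ} (hp : p.Prime) (h : p % 8 = 1 ∨ p % 8 = 7) : ∃ x y : ℤ, x ^ 2 - 2 * y ^ 2 = -p := by
  have : Fact p.Prime := ⟨hp⟩
  obtain ⟨x, y, h0, hx, hy, hd⟩ := thue hp 2 (by
    have := (ZMod.exists_sq_eq_two_iff (p := p) (by rintro rfl; omega)).2 h
    simpa using this)
  obtain ⟨m, hm⟩ := hd
  have hp0 : (0 : ℤ) < p := by exact_mod_cast hp.pos
  have h1 : m < 1 := by nlinarith [sq_nonneg y]
  have h2 : -2 < m := by nlinarith [sq_nonneg x]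
  have h3 : m ≠ 0 := by
    rintro rfl
    obtain ⟨h4, h5⟩ := no_sqrt2 (x := x) (y := y) (by linear_combination hm)
    rcases h0 with h0 | h0 <;> contradiction
  have : m = -1 := by omega
  subst this
  exact ⟨x, y, by rw [hm]; ring⟩

/-- representation with even `y`, `x` odd -/
lemma rep_two {p : ℕ} (hp : p.Prime) (h : p % 8 = 1 ∨ p % 8 = 7) :
    ∃ x y : ℤ, (x ^ 2 - 2 * y ^ 2 = p ∨ x ^ 2 - 2 * y ^ 2 = -p) ∧ Odd x ∧ y % 2 = 0 := by
  obtain ⟨x, y, hxy⟩ := rep_neg hp h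
  have fin : ∀ x y : ℤ, (x ^ 2 - 2 * y ^ 2) % 8 = 1 → Odd x ∧ y % 2 = 0 := by
    intro x y h
    have hx : Odd x := by
      rw [← Int.not_even_iff_odd]
      rintro ⟨m, rfl⟩
      have : ((m + m) ^ 2 - 2 * y ^ 2) = 2 * (2 * m ^ 2 - y ^ 2) := by ring
      omega
    refine ⟨hx, ?_⟩
    by_contra hy
    have hy' : y % 2 = 1 := by omega
    have e1 := Int.sq_mod_four_eq_one_of_odd hx
    have e2 : y ^ 2 % 4 = 1 := Int.sq_mod_four_eq_one_of_odd (Int.odd_iff.2 hy')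
    omega
  rcases h with h | h
  · have h2 : (x + 2 * y) ^ 2 - 2 * (x + y) ^ 2 = p := by linear_combination -hxy
    exact ⟨x + 2 * y, x + y, Or.inl h2, fin _ _ (by rw [h2]; omega)⟩
  · exact ⟨x, y, Or.inr hxy, fin _ _ (by rw [hxy]; omega)⟩

lemma rep_neg_two {p : ℕ} (hp : p.Prime) (h : p % 8 = 3) :
    ∃ x y : ℤ, x ^ 2 + 2 * y ^ 2 = p ∧ Odd x ∧ Odd y := by
  have : Fact p.Prime := ⟨hp⟩
  obtain ⟨x, y, h0, hx, hy, hd⟩ := thue hp (-2) (by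
    have := (ZMod.exists_sq_eq_neg_two_iff (p := p) (by rintro rfl; omega)).2 (Or.inr h)
    simpa using this)
  obtain ⟨m, hm⟩ := hd
  have hp0 : (0 : ℤ) < p := by exact_mod_cast hp.pos
  have h1 : m < 3 := by nlinarith [sq_nonneg y]
  have h2 : 0 < m := by
    have : 0 < x ^ 2 - -2 * y ^ 2 := by
      rcases h0 with h0 | h0
      · have := sq_nonneg y; have := pow_pos (abs_pos.2 h0) 2; rw [sq_abs] at this; omega
      · have := sq_nonneg x; have := pow_pos (abs_pos.2 h0) 2; rw [sq_abs] at this; omega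
    rw [hm] at this
    exact pos_of_mul_pos_right this hp0.le
  have key : ∃ x y : ℤ, x ^ 2 + 2 * y ^ 2 = p := by
    have : m = 1 ∨ m = 2 := by omega
    rcases this with rfl | rfl
    · exact ⟨x, y, by linear_combination hm⟩
    · have hx : Even x := by
        rw [← Int.not_odd_iff_even]
        intro ho
        have e1 := Int.sq_mod_four_eq_one_of_odd ho
        omega
      obtain ⟨x', rfl⟩ := hx
      refine ⟨y, x', ?_⟩
      have : 2 * (y ^ 2 + 2 * x' ^ 2) = 2 * (p : ℤ) := by linear_combination hm
      omega
  obtain ⟨x, y, hxy⟩ := key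
  have hx : Odd x := by
    rw [← Int.not_even_iff_odd]
    rintro ⟨n, rfl⟩
    have : (n + n) ^ 2 + 2 * y ^ 2 = 2 * (2 * n ^ 2 + y ^ 2) := by ring
    omega
  refine ⟨x, y, hxy, hx, ?_⟩
  rw [← Int.not_even_iff_odd]
  rintro ⟨n, rfl⟩
  have e1 := Int.sq_mod_four_eq_one_of_odd hx
  have : (n + n) ^ 2 = 4 * n ^ 2 := by ring
  omega

/-- Gaussian -/
lemma rep_one {p : ℕ} (hp : p.Prime) (h : p % 4 = 1) :
    ∃ x y : ℤ, x ^ 2 + y ^ 2 = p ∧ Odd x ∧ (p % 8 = 1 → y % 4 = 0) ∧ (p % 8 = 5 → y % 4 = 2) := by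
  have : Fact p.Prime := ⟨hp⟩
  obtain ⟨a, b, hab⟩ := Nat.Prime.sq_add_sq (p := p) (by omega)
  have key : ∃ x y : ℤ, x ^ 2 + y ^ 2 = p ∧ Odd x := by
    rcases Nat.even_or_odd a with ha | ha
    · refine ⟨b, a, by rw [← hab]; push_cast; ring, ?_⟩
      have hb : Odd b := by
        rw [← Nat.not_even_iff_odd]
        rintro ⟨n, rfl⟩
        obtain ⟨m, rfl⟩ := ha
        have : (m + m) ^ 2 + (n + n) ^ 2 = 2 * (2 * m ^ 2 + 2 * n ^ 2) := by ring
        omega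
      exact_mod_cast hb
    · exact ⟨a, b, by rw [← hab]; push_cast; ring, by exact_mod_cast ha⟩
  obtain ⟨x, y, hxy, hx⟩ := key
  obtain ⟨m, rfl⟩ := hx
  have hmm : (m * (m + 1)) % 2 = 0 := Int.even_iff.1 (Int.even_mul_succ_self m)
  have ex : (2 * m + 1) ^ 2 = 4 * (m * (m + 1)) + 1 := by ring
  have hy : y % 2 = 0 := by
    by_contra hy
    have e2 : y ^ 2 % 4 = 1 := Int.sq_mod_four_eq_one_of_odd (Int.odd_iff.2 (by omega))
    omega
  obtain ⟨l, rfl⟩ := Int.dvd_of_emod_eq_zero hy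
  have ey : (2 * l) ^ 2 = 4 * l ^ 2 := by ring
  refine ⟨_, _, hxy, ⟨m, rfl⟩, ?_, ?_⟩
  · intro h8
    have : Even (l ^ 2) := Int.even_iff.2 (by omega)
    rw [Int.even_pow' two_ne_zero, Int.even_iff] at this
    omega
  · intro h8
    have : Odd (l ^ 2) := Int.odd_iff.2 (by omega)
    rw [Int.odd_pow' two_ne_zero, Int.odd_iff] at this
    omega

end CG

open NumberField nonZeroDivisors
set_option linter.all false
namespace CG
open IsDedekindDomain

section
variable {K : Type*} [Field K] [NumberField K] {k : ℕ} {ζ : 𝓞 K} [IsCyclotomicExtension {2 ^ (k + 4)} ℚ K]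

lemma conj_mem (k : ℕ) [IsCyclotomicExtension {2 ^ (k + 4)} ℚ K] {p : ℕ} (hp : p.Prime) (hp2 : Odd p) (P : Ideal (𝓞 K)) (hP : P.IsPrime) (hpP : (p : 𝓞 K) ∈ P)
    (π π' : 𝓞 K) (h : π * π' = p ∨ π * π' = -p) : π ∉ P ↔ π' ∈ P := by
  have h0 : π * π' ∈ P := by
    rcases h with h | h <;> rw [h]
    · exact hpP
    · exact P.neg_mem hpP
  constructor
  · intro h1
    exact (hP.mem_or_mem h0).resolve_left h1
  · intro h2 h1
    have h4 := Ideal.mul_mem_mul h1 h2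
    rw [← pow_two] at h4
    have h3 : (p : 𝓞 K) ∈ P ^ 2 := by
      rcases h with h | h
      · rwa [h] at h4
      · rw [h] at h4; simpa using h4
    exact (d_notMem_sq k hp.prime.squarefree hp2 P hpP).1 h3

section
variable {L : Type*} [Field L] [NumberField L] [Algebra K L] [Algebra.IsQuadraticExtension K L] [IsTotallyComplex L]
  {r : L}

lemma good_nat (hζ : IsPrimitiveRoot ζ (2 ^ (k + 4))) {d : ℕ} (hd : Squarefree d) (hd2 : Odd d)
    (hr : r ^ 2 = algebraMap K L (((d : 𝓞 K)) : K)) {p : ℕ} (hp : p ∣ d) : Good L d (p : 𝓞 K) := by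
  obtain ⟨m, rfl⟩ := hp
  refine good_of_dvd hζ hd hd2 hr _ (m : 𝓞 K) (Or.inl (by push_cast; ring)) ?_
  have := sq_mod4 hζ (p : ℤ) (by exact_mod_cast (Nat.odd_mul.1 hd2).1)
  simpa using this

theorem nc_three (hζ : IsPrimitiveRoot ζ (2 ^ (k + 4))) {d : ℕ} (hd : Squarefree d) (hd2 : Odd d)
    (hr : r ^ 2 = algebraMap K L (((d : 𝓞 K)) : K)) {p q l : ℕ} (hp : p.Prime) (hq : q.Prime) (hl : l.Prime)
    (hpd : p ∣ d) (hqd : q ∣ d) (hld : l ∣ d) (h1 : p ≠ q) (h2 : p ≠ l) (h3 : q ≠ l) :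
    ¬ IsCyclic (CommGroup.primaryComponent (ClassGroup (𝓞 L)) 2) := by
  obtain ⟨P, hP, hpP⟩ := exists_P (K := K) k hp (hd2.of_dvd_nat hpd)
  obtain ⟨Q, hQ, hqQ⟩ := exists_P (K := K) k hq (hd2.of_dvd_nat hqd)
  obtain ⟨R, hR, hlR⟩ := exists_P (K := K) k hl (hd2.of_dvd_nat hld)
  exact V4b hζ hd hd2 hr (good_nat hζ hd hd2 hr hpd) (good_nat hζ hd hd2 hr hqd) P Q R hP hQ hR
    (mem_of_dvd hpd hpP) (mem_of_dvd hqd hqQ) (mem_of_dvd hld hlR)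
    ⟨hpP, coprime_notMem ((Nat.coprime_primes hp hq).2 h1) hP hpP⟩ hqQ
    ⟨coprime_notMem ((Nat.coprime_primes hl hp).2 h2.symm) hR hlR, coprime_notMem ((Nat.coprime_primes hl hq).2 h3.symm) hR hlR⟩

theorem nontriv_two (hζ : IsPrimitiveRoot ζ (2 ^ (k + 4))) {d : ℕ} (hd : Squarefree d) (hd2 : Odd d)
    (hr : r ^ 2 = algebraMap K L (((d : 𝓞 K)) : K)) {p q : ℕ} (hp : p.Prime) (hq : q.Prime)
    (hpd : p ∣ d) (hqd : q ∣ d) (h1 : p ≠ q) :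
    Nontrivial (CommGroup.primaryComponent (ClassGroup (𝓞 L)) 2) := by
  obtain ⟨P, hP, hpP⟩ := exists_P (K := K) k hp (hd2.of_dvd_nat hpd)
  obtain ⟨Q, hQ, hqQ⟩ := exists_P (K := K) k hq (hd2.of_dvd_nat hqd)
  exact nontriv_good hζ hd hd2 hr (good_nat hζ hd hd2 hr hpd) P Q hP hQ
    (mem_of_dvd hpd hpP) (mem_of_dvd hqd hqQ) hpP (coprime_notMem ((Nat.coprime_primes hq hp).2 h1.symm) hQ hqQ)

/-- generic data for the element `π ∈ ℤ[√2]` -/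
lemma pi_two (hζ : IsPrimitiveRoot ζ (2 ^ (k + 4))) {p : ℕ} (hp : p.Prime) (h : p % 8 = 1 ∨ p % 8 = 7)
    {s : 𝓞 K} (hs : s ^ 2 = 2) :
    ∃ a b : ℤ, (((a : 𝓞 K) + b * s) * (a + b * (-s)) = p ∨ ((a : 𝓞 K) + b * s) * (a + b * (-s)) = -p) ∧
      ∃ y z, ((a : 𝓞 K) + b * s) = y ^ 2 + 4 * z := by
  obtain ⟨a, b, hab, ha, hb⟩ := rep_two hp h
  refine ⟨a, b, ?_, sqm_b hζ a b ha hb s (Or.inl hs)⟩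
  have e : ((a : 𝓞 K) + b * s) * (a + b * (-s)) = ((a ^ 2 - 2 * b ^ 2 : ℤ) : 𝓞 K) := by
    push_cast; linear_combination -(b : 𝓞 K) ^ 2 * hs
  rw [e]
  rcases hab with h | h <;> rw [h] <;> simp

theorem nontriv_seven (hζ : IsPrimitiveRoot ζ (2 ^ (k + 4))) {p : ℕ} (hp : p.Prime) (h : p % 8 = 1 ∨ p % 8 = 7)
    (hr : r ^ 2 = algebraMap K L (((p : 𝓞 K)) : K)) :
    Nontrivial (CommGroup.primaryComponent (ClassGroup (𝓞 L)) 2) := by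
  obtain ⟨i, s, t, hi, hs, ht, h3, h5, h7⟩ := special hζ
  obtain ⟨τ, hτ⟩ := exists_aut hζ 3 (by decide)
  obtain ⟨τi, τs, τt⟩ := h3 τ hτ
  have hp2 : Odd p := by rw [Nat.odd_iff]; omega
  obtain ⟨a, b, hab, hsq⟩ := pi_two hζ hp h hs
  obtain ⟨P, hP, hpP⟩ := exists_P (K := K) k hp hp2
  have eτ : τ ((a : 𝓞 K) + b * s) = a + b * (-s) := by simp [τs]
  have good := good_of_dvd hζ hp.prime.squarefree hp2 hr _ _ hab hsq
  have hP' : (P.comap τ).IsPrime := hP.comap τ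
  have hpP' : (p : 𝓞 K) ∈ P.comap τ := by rw [Ideal.mem_comap, map_natCast]; exact hpP
  have := conj_mem k hp hp2 P hP hpP _ _ hab
  by_cases hm : ((a : 𝓞 K) + b * s) ∈ P
  · exact nontriv_good hζ hp.prime.squarefree hp2 hr good P _ hP hP' hpP hpP' hm (by rw [Ideal.mem_comap, eτ]; tauto)
  · exact nontriv_good hζ hp.prime.squarefree hp2 hr good _ P hP' hP hpP' hpP (by rw [Ideal.mem_comap, eτ]; tauto) hm

/-- `d = pq`, `γ = p`, `δ` a divisor of `d` with conjugate -/
theorem nc_pq_gen (hζ : IsPrimitiveRoot ζ (2 ^ (k + 4))) {p q : ℕ} (hp : p.Prime) (hq : q.Prime) (hne : p ≠ q)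
    (hp2 : Odd p) (hq2 : Odd q)
    (hr : r ^ 2 = algebraMap K L ((((p * q : ℕ) : 𝓞 K)) : K)) (τ : 𝓞 K →+* 𝓞 K) (π ρ ρ' : 𝓞 K)
    (h1 : π * τ π = p ∨ π * τ π = -p) (h2 : ρ * ρ' = q ∨ ρ * ρ' = -q ∨ ρ * ρ' = 1)
    (h3 : ∃ Q : Ideal (𝓞 K), Q.IsPrime ∧ (q : 𝓞 K) ∈ Q ∧ ρ ∉ Q)
    (hsq : ∃ y z, π * ρ = y ^ 2 + 4 * z) :
    ¬ IsCyclic (CommGroup.primaryComponent (ClassGroup (𝓞 L)) 2) := by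
  have hd2 : Odd (p * q) := Nat.odd_mul.2 ⟨hp2, hq2⟩
  have hd : Squarefree (p * q) := by
    rw [Nat.squarefree_mul ((Nat.coprime_primes hp hq).2 hne)]
    exact ⟨hp.prime.squarefree, hq.prime.squarefree⟩
  obtain ⟨Q, hQ, hqQ, hρQ⟩ := h3
  obtain ⟨P0, hP0, hpP0⟩ := exists_P (K := K) k hp hp2
  have good : Good L (p * q) (π * ρ) := by
    have h2' : ∃ ρ'', ρ * ρ'' = q ∨ ρ * ρ'' = -q := by
      rcases h2 with h | h | h
      · exact ⟨_, Or.inl h⟩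
      · exact ⟨_, Or.inr h⟩
      · exact ⟨ρ' * q, Or.inl (by rw [← mul_assoc, h, one_mul])⟩
    obtain ⟨ρ'', h2'⟩ := h2'
    have e : π * ρ * (τ π * ρ'') = (π * τ π) * (ρ * ρ'') := by ring
    refine good_of_dvd hζ hd hd2 hr _ (τ π * ρ'') ?_ hsq
    rw [e]
    push_cast
    rcases h1 with h1 | h1 <;> rcases h2' with h2' | h2' <;> rw [h1, h2']
    · left; ring
    · right; ring
    · right; ring
    · left; ring
  have hρ : ∀ P : Ideal (𝓞 K), P.IsPrime → (p : 𝓞 K) ∈ P → ρ ∉ P := by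
    intro P hP hpP hρP
    have hqP : (q : 𝓞 K) ∈ P := by
      have := P.mul_mem_right ρ' hρP
      rcases h2 with h | h | h <;> rw [h] at this
      · exact this
      · simpa using this
      · exact absurd ((Ideal.eq_top_iff_one P).2 this) hP.ne_top
    exact coprime_notMem ((Nat.coprime_primes hp hq).2 hne) hP hpP hqP
  have hcm : ∀ P : Ideal (𝓞 K), P.IsPrime → (p : 𝓞 K) ∈ P → (P.comap τ).IsPrime ∧ (p : 𝓞 K) ∈ P.comap τ := by
    intro P hP hpP
    exact ⟨hP.comap τ, by rw [Ideal.mem_comap, map_natCast]; exact hpP⟩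
  obtain ⟨P, R, hP, hR, hpP, hpR, hπP, hπR⟩ : ∃ P R : Ideal (𝓞 K), P.IsPrime ∧ R.IsPrime ∧ (p : 𝓞 K) ∈ P ∧ (p : 𝓞 K) ∈ R ∧
      π ∈ P ∧ π ∉ R := by
    have := conj_mem k hp hp2 P0 hP0 hpP0 _ _ h1
    by_cases hm : π ∈ P0
    · exact ⟨P0, P0.comap τ, hP0, (hcm _ hP0 hpP0).1, hpP0, (hcm _ hP0 hpP0).2, hm, by rw [Ideal.mem_comap]; tauto⟩
    · exact ⟨P0.comap τ, P0, (hcm _ hP0 hpP0).1, hP0, (hcm _ hP0 hpP0).2, hpP0, by rw [Ideal.mem_comap]; tauto, hm⟩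
  have hpQ : (p : 𝓞 K) ∉ Q := coprime_notMem ((Nat.coprime_primes hq hp).2 hne.symm) hQ hqQ
  refine V4a hζ hd hd2 hr (good_nat hζ hd hd2 hr (Dvd.intro _ rfl)) good P R Q hP hR hQ
    (mem_of_dvd (Dvd.intro _ rfl) hpP) (mem_of_dvd (Dvd.intro _ rfl) hpR) (mem_of_dvd (Dvd.intro_left _ rfl) hqQ)
    ⟨hpP, P.mul_mem_right _ hπP⟩ ⟨hpR, fun h => ?_⟩ ⟨hpQ, fun h => ?_⟩
  · rcases hR.mem_or_mem h with h | h
    · exact hπR h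
    · exact hρ R hR hpR h
  · rcases hQ.mem_or_mem h with h | h
    · apply hpQ
      have := Q.mul_mem_right (τ π) h
      rcases h1 with h1 | h1 <;> rw [h1] at this
      · exact this
      · simpa using this
    · exact hρQ h

theorem nc_pq_one (hζ : IsPrimitiveRoot ζ (2 ^ (k + 4))) {p q : ℕ} (hp : p.Prime) (hq : q.Prime) (hne : p ≠ q)
    (hq2 : Odd q) (h : p % 8 = 1 ∨ p % 8 = 7)
    (hr : r ^ 2 = algebraMap K L ((((p * q : ℕ) : 𝓞 K)) : K)) :
    ¬ IsCyclic (CommGroup.primaryComponent (ClassGroup (𝓞 L)) 2) := by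
  obtain ⟨i, s, t, hi, hs, ht, h3, h5, h7⟩ := special hζ
  obtain ⟨τ, hτ⟩ := exists_aut hζ 3 (by decide)
  obtain ⟨τi, τs, τt⟩ := h3 τ hτ
  have hp2 : Odd p := by rw [Nat.odd_iff]; omega
  obtain ⟨a, b, hab, hsq⟩ := pi_two hζ hp h hs
  have eτ : τ ((a : 𝓞 K) + b * s) = a + b * (-s) := by simp [τs]
  obtain ⟨Q, hQ, hqQ⟩ := exists_P (K := K) k hq hq2
  exact nc_pq_gen hζ hp hq hne hp2 hq2 hr τ _ 1 1 (by rw [eτ]; exact hab) (by simp)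
    ⟨Q, hQ, hqQ, fun h => hQ.ne_top ((Ideal.eq_top_iff_one Q).2 h)⟩ (by simpa using hsq)

lemma exists_conj_notMem {q : ℕ} (hζ : IsPrimitiveRoot ζ (2 ^ (k + 4))) (hq : q.Prime) (hq2 : Odd q) (τ : 𝓞 K →+* 𝓞 K) (ρ : 𝓞 K)
    (h : ρ * τ ρ = q ∨ ρ * τ ρ = -q) : ∃ Q : Ideal (𝓞 K), Q.IsPrime ∧ (q : 𝓞 K) ∈ Q ∧ ρ ∉ Q := by
  obtain ⟨Q, hQ, hqQ⟩ := exists_P (K := K) k hq hq2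
  by_cases hm : ρ ∈ Q
  · refine ⟨Q.comap τ, hQ.comap τ, by rw [Ideal.mem_comap, map_natCast]; exact hqQ, ?_⟩
    have := conj_mem k hq hq2 Q hQ hqQ _ _ h
    rw [Ideal.mem_comap]; tauto
  · exact ⟨Q, hQ, hqQ, hm⟩

theorem nc_pq_three (hζ : IsPrimitiveRoot ζ (2 ^ (k + 4))) {p q : ℕ} (hp : p.Prime) (hq : q.Prime) (hne : p ≠ q)
    (h : p % 8 = 3) (h' : q % 8 = 3)
    (hr : r ^ 2 = algebraMap K L ((((p * q : ℕ) : 𝓞 K)) : K)) :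
    ¬ IsCyclic (CommGroup.primaryComponent (ClassGroup (𝓞 L)) 2) := by
  obtain ⟨i, s, t, hi, hs, ht, h3, h5, h7⟩ := special hζ
  obtain ⟨τ, hτ⟩ := exists_aut hζ 5 (by decide)
  obtain ⟨τi, τs, τt⟩ := h5 τ hτ
  have hp2 : Odd p := by rw [Nat.odd_iff]; omega
  have hq2 : Odd q := by rw [Nat.odd_iff]; omega
  obtain ⟨a, b, hab, ha, hb⟩ := rep_neg_two hp h
  obtain ⟨c, e, hce, hc, he⟩ := rep_neg_two hq h'
  have e1 : ((a : 𝓞 K) + b * t) * τ ((a : 𝓞 K) + b * t) = p := by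
    have : ((a ^ 2 + 2 * b ^ 2 : ℤ) : 𝓞 K) = p := by rw [hab]; simp
    rw [← this]; simp [τt]; linear_combination -(b : 𝓞 K) ^ 2 * ht
  have e2 : ((c : 𝓞 K) + e * t) * τ ((c : 𝓞 K) + e * t) = q := by
    have : ((c ^ 2 + 2 * e ^ 2 : ℤ) : 𝓞 K) = q := by rw [hce]; simp
    rw [← this]; simp [τt]; linear_combination -(e : 𝓞 K) ^ 2 * ht
  refine nc_pq_gen hζ hp hq hne hp2 hq2 hr τ _ ((c : 𝓞 K) + e * t) _ (Or.inl e1) (Or.inl e2)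
    (exists_conj_notMem hζ hq hq2 τ _ (Or.inl e2)) ?_
  obtain ⟨y, z, hyz⟩ := sqm_b hζ (a * c - 2 * (b * e)) (a * e + b * c)
    ((ha.mul hc).sub_even (by simp)) (by
      have := (ha.mul he).add_odd (hb.mul hc); exact Int.even_iff.1 this) t (Or.inr ht)
  refine ⟨y, z, ?_⟩
  rw [← hyz]; push_cast
  linear_combination (b : 𝓞 K) * e * ht

theorem nc_pq_five (hζ : IsPrimitiveRoot ζ (2 ^ (k + 4))) {p q : ℕ} (hp : p.Prime) (hq : q.Prime) (hne : p ≠ q)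
    (h : p % 8 = 5) (h' : q % 8 = 5)
    (hr : r ^ 2 = algebraMap K L ((((p * q : ℕ) : 𝓞 K)) : K)) :
    ¬ IsCyclic (CommGroup.primaryComponent (ClassGroup (𝓞 L)) 2) := by
  obtain ⟨i, s, t, hi, hs, ht, h3, h5, h7⟩ := special hζ
  obtain ⟨τ, hτ⟩ := exists_aut hζ 3 (by decide)
  obtain ⟨τi, τs, τt⟩ := h3 τ hτ
  have hp2 : Odd p := by rw [Nat.odd_iff]; omega
  have hq2 : Odd q := by rw [Nat.odd_iff]; omega
  obtain ⟨a, b, hab, ha, -, hb⟩ := rep_one hp (by omega)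
  obtain ⟨c, e, hce, hc, -, he⟩ := rep_one hq (by omega)
  specialize hb h
  specialize he h'
  have e1 : ((a : 𝓞 K) + b * i) * τ ((a : 𝓞 K) + b * i) = p := by
    have : ((a ^ 2 + b ^ 2 : ℤ) : 𝓞 K) = p := by rw [hab]; simp
    rw [← this]; simp [τi]; linear_combination -(b : 𝓞 K) ^ 2 * hi
  have e2 : ((c : 𝓞 K) + e * i) * τ ((c : 𝓞 K) + e * i) = q := by
    have : ((c ^ 2 + e ^ 2 : ℤ) : 𝓞 K) = q := by rw [hce]; simp
    rw [← this]; simp [τi]; linear_combination -(e : 𝓞 K) ^ 2 * hi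
  refine nc_pq_gen hζ hp hq hne hp2 hq2 hr τ _ ((c : 𝓞 K) + e * i) _ (Or.inl e1) (Or.inl e2)
    (exists_conj_notMem hζ hq hq2 τ _ (Or.inl e2)) ?_
  have hb' : b = 2 * (2 * (b / 4) + 1) := by omega
  have he' : e = 2 * (2 * (e / 4) + 1) := by omega
  generalize b / 4 = b1 at *
  generalize e / 4 = e1 at *
  obtain ⟨y, z, hyz⟩ := sqm_a hζ (a * c - b * e) (a * e + b * c)
    ((ha.mul hc).sub_even (by rw [hb', mul_assoc]; simp)) (by
      obtain ⟨a1, rfl⟩ := ha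
      obtain ⟨c1, rfl⟩ := hc
      rw [hb', he']
      ring_nf
      omega) i
  refine ⟨y, z, ?_⟩
  rw [← hyz]; push_cast
  linear_combination (b : 𝓞 K) * e * hi

theorem nc_one (hζ : IsPrimitiveRoot ζ (2 ^ (k + 4))) {p : ℕ} (hp : p.Prime) (h : p % 8 = 1)
    (hr : r ^ 2 = algebraMap K L (((p : 𝓞 K)) : K)) :
    ¬ IsCyclic (CommGroup.primaryComponent (ClassGroup (𝓞 L)) 2) := by
  obtain ⟨i, s, t, hi, hs, ht, h3, h5, h7⟩ := special hζ
  obtain ⟨τ, hτ⟩ := exists_aut hζ 3 (by decide)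
  obtain ⟨τi, τs, τt⟩ := h3 τ hτ
  obtain ⟨α, hα⟩ := exists_aut hζ 5 (by decide)
  obtain ⟨αi, αs, αt⟩ := h5 α hα
  obtain ⟨β, hβ⟩ := exists_aut hζ 7 (by decide)
  obtain ⟨βi, βs, βt⟩ := h7 β hβ
  have hp2 : Odd p := by rw [Nat.odd_iff]; omega
  obtain ⟨a, b, hab, ha, hb, -⟩ := rep_one hp (by omega)
  specialize hb h
  obtain ⟨c, e, hce, hsq⟩ := pi_two hζ hp (Or.inl h) hs
  have e1 : ((a : 𝓞 K) + b * i) * ((a : 𝓞 K) + b * (-i)) = p := by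
    have : ((a ^ 2 + b ^ 2 : ℤ) : 𝓞 K) = p := by rw [hab]; simp
    rw [← this]; push_cast; linear_combination -(b : 𝓞 K) ^ 2 * hi
  have g1 := good_of_dvd hζ hp.prime.squarefree hp2 hr _ _ (Or.inl e1) (sqm_a hζ a b ha hb i)
  have g2 := good_of_dvd hζ hp.prime.squarefree hp2 hr _ _ hce hsq
  have α1 : α ((a : 𝓞 K) + b * i) = a + b * i := by simp [αi]
  have α2 : α ((c : 𝓞 K) + e * s) = c + e * (-s) := by simp [αs]
  have β1 : β ((a : 𝓞 K) + b * i) = a + b * (-i) := by simp [βi]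
  have β2 : β ((c : 𝓞 K) + e * s) = c + e * s := by simp [βs]
  have τ1 : τ ((a : 𝓞 K) + b * i) = a + b * (-i) := by simp [τi]
  have τ2 : τ ((c : 𝓞 K) + e * s) = c + e * (-s) := by simp [τs]
  set γ := (a : 𝓞 K) + b * i
  set γ' := (a : 𝓞 K) + b * (-i)
  set δ := (c : 𝓞 K) + e * s
  set δ' := (c : 𝓞 K) + e * (-s)
  have hcm : ∀ (τ : 𝓞 K →+* 𝓞 K) (P : Ideal (𝓞 K)), P.IsPrime → (p : 𝓞 K) ∈ P → (P.comap τ).IsPrime ∧ (p : 𝓞 K) ∈ P.comap τ := by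
    intro τ P hP hpP
    exact ⟨hP.comap τ, by rw [Ideal.mem_comap, map_natCast]; exact hpP⟩
  have c1 := fun P hP hpP => conj_mem k hp hp2 P hP hpP γ γ' (Or.inl e1)
  have c2 := fun P hP hpP => conj_mem k hp hp2 P hP hpP δ δ' hce
  obtain ⟨P, hP, hpP, hPγ⟩ : ∃ P : Ideal (𝓞 K), P.IsPrime ∧ (p : 𝓞 K) ∈ P ∧ γ ∈ P := by
    obtain ⟨P, hP, hpP⟩ := exists_P (K := K) k hp hp2
    by_cases hm : γ ∈ P
    · exact ⟨P, hP, hpP, hm⟩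
    · exact ⟨_, (hcm β P hP hpP).1, (hcm β P hP hpP).2, by rw [Ideal.mem_comap, β1]; exact (c1 P hP hpP).1 hm⟩
  obtain ⟨Q, hQ, hpQ, hQγ, hQδ⟩ : ∃ P : Ideal (𝓞 K), P.IsPrime ∧ (p : 𝓞 K) ∈ P ∧ γ ∈ P ∧ δ ∈ P := by
    by_cases hm : δ ∈ P
    · exact ⟨P, hP, hpP, hPγ, hm⟩
    · refine ⟨_, (hcm α P hP hpP).1, (hcm α P hP hpP).2, ?_, ?_⟩
      · rw [Ideal.mem_comap, α1]; exact hPγ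
      · rw [Ideal.mem_comap, α2]; exact (c2 P hP hpP).1 hm
  refine V4a hζ hp.prime.squarefree hp2 hr g1 g2 Q (Q.comap α) (Q.comap τ) hQ (hcm _ _ hQ hpQ).1 (hcm _ _ hQ hpQ).1
    hpQ (hcm _ _ hQ hpQ).2 (hcm _ _ hQ hpQ).2 ⟨hQγ, hQδ⟩ ?_ ?_
  · rw [Ideal.mem_comap, Ideal.mem_comap, α1, α2]
    have := c2 Q hQ hpQ
    tauto
  · rw [Ideal.mem_comap, Ideal.mem_comap, τ1, τ2]
    have := c2 Q hQ hpQ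
    have := c1 Q hQ hpQ
    tauto

end
end
end CG

open NumberField nonZeroDivisors
set_option linter.all false
namespace CG
open IsDedekindDomain

section
variable {M : Type*} [Field M] [NumberField M] {η : 𝓞 M}

/-- integral power basis generated by an integer root of unity -/
lemma exists_pb {n : ℕ} [NeZero n] [IsCyclotomicExtension {n} ℚ M] (hη : IsPrimitiveRoot η n) :
    ∃ pb : PowerBasis ℤ (𝓞 M), pb.gen = η ∧ pb.dim = n.totient := by
  have hK : IsPrimitiveRoot (η : M) n := hη.map_of_injective RingOfIntegers.coe_injective
  refine ⟨hK.integralPowerBasis, ?_, hK.integralPowerBasis_dim⟩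
  rw [hK.integralPowerBasis_gen]
  rfl

lemma hom_ext {n : ℕ} [NeZero n] [IsCyclotomicExtension {n} ℚ M] (hη : IsPrimitiveRoot η n) {R : Type*} [CommRing R]
    (f g : 𝓞 M →+* R) (h : f η = g η) : ∀ x, f x = g x := by
  obtain ⟨pb, hg, -⟩ := exists_pb hη
  intro x
  obtain ⟨q, rfl⟩ := pb.exists_eq_aeval' x
  rw [hg, Polynomial.aeval_def, Polynomial.hom_eval₂, Polynomial.hom_eval₂, h]
  congr 1
  exact RingHom.ext_int _ _

variable [IsCyclotomicExtension {2 ^ (0 + 4)} ℚ M]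

lemma rep8 (hη : IsPrimitiveRoot η (2 ^ (0 + 4))) (x : 𝓞 M) : ∃ f : ℕ → ℤ, x = ∑ i ∈ Finset.range 8, (f i : 𝓞 M) * η ^ i := by
  obtain ⟨pb, hg, hd⟩ := exists_pb hη
  obtain ⟨q, hq, rfl⟩ := pb.exists_eq_aeval x
  refine ⟨q.coeff, ?_⟩
  rw [hg, Polynomial.aeval_eq_sum_range' (n := 8)]
  · apply Finset.sum_congr rfl
    intro i _
    rw [zsmul_eq_mul]
  · rw [hd] at hq
    exact lt_of_lt_of_eq hq (by decide)

lemma indep8 (hη : IsPrimitiveRoot η (2 ^ (0 + 4))) (g : ℕ → ℤ) (h : ∑ i ∈ Finset.range 8, (g i : 𝓞 M) * η ^ i = 0) :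
    ∀ i < 8, g i = 0 := by
  obtain ⟨pb, hg, hd⟩ := exists_pb hη
  have hd8 : pb.dim = 8 := by rw [hd]; decide
  set p : Polynomial ℤ := ∑ i ∈ Finset.range 8, Polynomial.C (g i) * Polynomial.X ^ i with hp
  have hc : ∀ i < 8, p.coeff i = g i := by
    intro i hi
    rw [hp, Polynomial.finsetSum_coeff]
    simp only [Polynomial.coeff_C_mul_X_pow]
    rw [Finset.sum_ite_eq]
    simp [hi]
  have hp0 : p = 0 := by
    by_contra h0
    have h1 := pb.dim_le_natDegree_of_root h0 (by
      rw [hg, hp, map_sum, ← h]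
      apply Finset.sum_congr rfl
      intro i _
      simp)
    rw [hd8] at h1
    have h2 : p.natDegree ≤ 7 := by
      apply Polynomial.natDegree_sum_le_of_forall_le
      intro i hi
      refine (Polynomial.natDegree_C_mul_X_pow_le _ _).trans ?_
      have := Finset.mem_range.1 hi
      omega
    omega
  intro i hi
  rw [← hc i hi, hp0, Polynomial.coeff_zero]

/-- complex conjugation -/
lemma exists_conj (hη : IsPrimitiveRoot η (2 ^ (0 + 4))) : ∃ τ : 𝓞 M →+* 𝓞 M, τ η = η ^ 15 ∧ ∀ x, τ (τ x) = x := by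
  obtain ⟨τ, hτ⟩ := exists_aut hη 15 (by decide)
  refine ⟨τ, hτ, ?_⟩
  apply hom_ext hη (τ.comp τ) (RingHom.id _)
  rw [RingHom.comp_apply, hτ, map_pow, hτ, ← pow_mul, RingHom.id_apply]
  have h16 : η ^ 16 = 1 := hη.pow_eq_one
  calc η ^ (15 * 15) = (η ^ 16) ^ 14 * η := by ring
    _ = η := by rw [h16]; ring

lemma frob_conj (hη : IsPrimitiveRoot η (2 ^ (0 + 4))) {τ : 𝓞 M →+* 𝓞 M} (hτ : τ η = η ^ 15) {p : ℕ} (hp : p.Prime)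
    (h : p % 16 = 15) (P : Ideal (𝓞 M)) (hP : P.IsPrime) (hpP : (p : 𝓞 M) ∈ P) (x : 𝓞 M) : τ x - x ^ p ∈ P := by
  have := Fact.mk hp
  have : CharP (𝓞 M ⧸ P) p := by
    have h0 : ((p : ℕ) : 𝓞 M ⧸ P) = 0 := by
      rw [← map_natCast (Ideal.Quotient.mk P)]; exact Ideal.Quotient.eq_zero_iff_mem.2 hpP
    exact (CharP.charP_iff_prime_eq_zero hp).2 h0
  have key := hom_ext hη ((Ideal.Quotient.mk P).comp τ) ((frobenius (𝓞 M ⧸ P) p).comp (Ideal.Quotient.mk P)) (by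
    rw [RingHom.comp_apply, RingHom.comp_apply, hτ, frobenius_def, ← map_pow]
    congr 1
    have h16 : η ^ 16 = 1 := hη.pow_eq_one
    conv_rhs => rw [← Nat.div_add_mod p 16, h, pow_add, pow_mul, h16, one_pow, one_mul]) x
  rw [← Ideal.Quotient.eq_zero_iff_mem, map_sub, sub_eq_zero, map_pow]
  exact key

lemma conj_stable (hη : IsPrimitiveRoot η (2 ^ (0 + 4))) {τ : 𝓞 M →+* 𝓞 M} (hτ : τ η = η ^ 15) {p : ℕ} (hp : p.Prime)
    (h : p % 16 = 15) (P : Ideal (𝓞 M)) (hP : P.IsPrime) (hpP : (p : 𝓞 M) ∈ P) (x : 𝓞 M) (hx : x ∈ P) : τ x ∈ P := by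
  have := P.add_mem (frob_conj hη hτ hp h P hP hpP x) (P.pow_mem_of_mem hx p hp.pos)
  simpa using this

lemma unit_norm_one (hη : IsPrimitiveRoot η (2 ^ (0 + 4))) {τ : 𝓞 M →+* 𝓞 M} (hτ : τ η = η ^ 15) (u : 𝓞 M) (hu : u * τ u = 1) :
    ∃ j : ℕ, u = η ^ j := by
  have h16 : η ^ 16 = 1 := hη.pow_eq_one
  have h1 : ∃ (n : ℕ) (_ : 0 < n), (u : M) ^ n = 1 := by
    apply NumberField.Embeddings.pow_eq_one_of_norm_eq_one M ℂ u.2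
    intro φ
    have hext := hom_ext hη ((φ.comp (algebraMap (𝓞 M) M)).comp τ) ((starRingEnd ℂ).comp (φ.comp (algebraMap (𝓞 M) M))) (by
      simp only [RingHom.comp_apply]
      rw [hτ]
      set z := φ (algebraMap (𝓞 M) M η) with hz
      have hz16 : z ^ 16 = 1 := by rw [hz, ← map_pow, ← map_pow, h16]; simp
      rw [map_pow, map_pow, ← hz]
      have hn : ‖z‖ = 1 := by
        have : ‖z‖ ^ 16 = 1 := by rw [← norm_pow, hz16, norm_one]
        exact (pow_eq_one_iff_of_nonneg (norm_nonneg _) (by norm_num)).1 this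
      have hz0 : z ≠ 0 := by rintro h; rw [h] at hn; simp at hn
      apply mul_left_cancel₀ hz0
      rw [Complex.mul_conj, Complex.normSq_eq_norm_sq, hn, ← pow_succ', hz16]
      simp) u
    simp only [RingHom.comp_apply] at hext
    have h2 : φ (algebraMap (𝓞 M) M u) * φ (algebraMap (𝓞 M) M (τ u)) = 1 := by
      rw [← map_mul, ← map_mul, hu]; simp
    rw [hext, Complex.mul_conj, Complex.normSq_eq_norm_sq] at h2
    have h3 : ‖φ (algebraMap (𝓞 M) M u)‖ ^ 2 = 1 := by exact_mod_cast h2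
    exact (pow_eq_one_iff_of_nonneg (norm_nonneg _) (by norm_num)).1 h3
  obtain ⟨n, hn, hun⟩ := h1
  have hun' : u ^ n = 1 := RingOfIntegers.coe_injective (by simpa using hun)
  let U : (𝓞 M)ˣ := ⟨u, τ u, hu, by rw [mul_comm, hu]⟩
  have hU : U ∈ NumberField.Units.torsion M := by
    rw [NumberField.Units.torsion, CommGroup.mem_torsion, isOfFinOrder_iff_pow_eq_one]
    exact ⟨n, hn, Units.ext hun'⟩
  have hto := IsCyclotomicExtension.Rat.torsionOrder_eq (n := 2 ^ (0 + 4)) (K := M)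
  have hU16 : U ^ 16 = 1 := by
    have h4 : (⟨U, hU⟩ : NumberField.Units.torsion M) ^ (NumberField.Units.torsionOrder M) = 1 := by
      rw [NumberField.Units.torsionOrder]
      first | exact pow_card_eq_one' | exact pow_card_eq_one
    rw [hto, if_pos (by decide)] at h4
    simpa using congrArg Subtype.val h4
  have hu16 : u ^ 16 = 1 := by simpa using congrArg Units.val hU16
  obtain ⟨j, -, hj⟩ := hη.eq_pow_of_pow_eq_one hu16
  exact ⟨j, hj.symm⟩

/-- the ideal above 2 -/
lemma lam_prime (hη : IsPrimitiveRoot η (2 ^ (0 + 4))) : Prime (1 - η) := by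
  have hK : IsPrimitiveRoot (η : M) (2 ^ (3 + 1)) := hη.map_of_injective RingOfIntegers.coe_injective
  have : Fact (Nat.Prime 2) := ⟨Nat.prime_two⟩
  have : IsCyclotomicExtension {2 ^ (3 + 1)} ℚ M := inferInstanceAs (IsCyclotomicExtension {2 ^ (0 + 4)} ℚ M)
  have h := hK.zeta_sub_one_prime
  have e : hK.toInteger = η := rfl
  rw [e] at h
  have := h.neg
  rwa [neg_sub] at this

lemma lam_two (hη : IsPrimitiveRoot η (2 ^ (0 + 4))) : (1 - η) ∣ 2 := by
  have h8 : η ^ 8 = -1 := zeta_half hη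
  have := sub_dvd_pow_sub_pow 1 η 8
  rw [h8] at this
  norm_num at this
  exact this

lemma lam_odd (hη : IsPrimitiveRoot η (2 ^ (0 + 4))) (c : ℤ) (hc : Odd c) : ¬ (1 - η) ∣ (c : 𝓞 M) := by
  intro h
  obtain ⟨m, rfl⟩ := hc
  have h2 : (1 - η) ∣ ((2 * m : ℤ) : 𝓞 M) := by push_cast; exact (lam_two hη).mul_right _
  have := dvd_sub h h2
  push_cast at this
  rw [add_sub_cancel_left] at this
  exact (lam_prime hη).not_unit (isUnit_of_dvd_one this)

lemma conj_lam (hη : IsPrimitiveRoot η (2 ^ (0 + 4))) {τ : 𝓞 M →+* 𝓞 M} (hτ : τ η = η ^ 15) (x : 𝓞 M) :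
    (1 - η) ^ 2 ∣ x - τ x := by
  have h16 : η ^ 16 = 1 := hη.pow_eq_one
  have key := hom_ext hη (Ideal.Quotient.mk (Ideal.span {(1 - η) ^ 2})) ((Ideal.Quotient.mk (Ideal.span {(1 - η) ^ 2})).comp τ) (by
    rw [RingHom.comp_apply, hτ, Ideal.Quotient.eq, Ideal.mem_span_singleton]
    obtain ⟨m, hm⟩ := lam_two hη
    have h1 : (1 - η) ^ 2 ∣ 1 - η ^ 2 := ⟨1 + m * η, by linear_combination (1 - η) * η * hm⟩
    have h2 : (1 - η ^ 2) ∣ 1 - (η ^ 2) ^ 7 := by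
      have := sub_dvd_pow_sub_pow 1 (η ^ 2) 7
      rwa [one_pow] at this
    have h3 : η - η ^ 15 = (1 - (η ^ 2) ^ 7) * η := by ring
    rw [h3]
    exact (h1.trans h2).mul_right _) x
  rwa [RingHom.comp_apply, Ideal.Quotient.eq, Ideal.mem_span_singleton] at key

lemma j_even (hη : IsPrimitiveRoot η (2 ^ (0 + 4))) {τ : 𝓞 M →+* 𝓞 M} (hτ : τ η = η ^ 15) (x : 𝓞 M)
    (hx : ¬ (1 - η) ∣ x) (j : ℕ) (h : τ x = η ^ j * x) : Even j := by
  rw [← Nat.not_odd_iff_even]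
  intro ho
  have h1 := conj_lam hη hτ x
  have hp := lam_prime hη
  rw [h, show x - η ^ j * x = (1 - η ^ j) * x by ring, ← mul_neg_geom_sum η j, pow_two, mul_assoc] at h1
  have h2 := (mul_dvd_mul_iff_left hp.ne_zero).1 h1
  rcases hp.dvd_or_dvd h2 with h3 | h3
  · have h4 : (1 - η) ∣ ((j : ℤ) : 𝓞 M) := by
      have h5 : (1 - η) ∣ ∑ i ∈ Finset.range j, (1 - η ^ i) := by
        apply Finset.dvd_sum
        intro i _
        have := sub_dvd_pow_sub_pow 1 η i
        rwa [one_pow] at this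
      have h6 := dvd_add h5 h3
      rw [← Finset.sum_add_distrib] at h6
      simpa using h6
    exact lam_odd hη j (by exact_mod_cast ho) h4
  · exact hx h3
end
end CG

open NumberField nonZeroDivisors
set_option linter.all false
namespace CG
open IsDedekindDomain

/-- multiplication in `ℕ[θ]`, `θ ^ 4 = 2`, on coefficient vectors -/
def mulq (a b : ℕ × ℕ × ℕ × ℕ) : ℕ × ℕ × ℕ × ℕ :=
  (a.1 * b.1 + 2 * (a.2.1 * b.2.2.2 + a.2.2.1 * b.2.2.1 + a.2.2.2 * b.2.1),
   a.1 * b.2.1 + a.2.1 * b.1 + 2 * (a.2.2.1 * b.2.2.2 + a.2.2.2 * b.2.2.1),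
   a.1 * b.2.2.1 + a.2.1 * b.2.1 + a.2.2.1 * b.1 + 2 * (a.2.2.2 * b.2.2.2),
   a.1 * b.2.2.2 + a.2.1 * b.2.2.1 + a.2.2.1 * b.2.1 + a.2.2.2 * b.1)

def redq (a : ℕ × ℕ × ℕ × ℕ) : ℕ × ℕ × ℕ × ℕ := (a.1 % 4, a.2.1 % 4, a.2.2.1 % 4, a.2.2.2 % 4)

lemma tabq : ∀ b0 b1 b2 b3 : Fin 4, b0.val % 2 = 1 →
    ∃ e1 e2 e3 e4 y1 y2 y3 : Fin 2,
    redq (mulq (1, e1.val, 0, 0) (mulq (1 + 2 * e2.val, e2.val, e2.val, 0) (mulq (1 + 2 * e3.val, 0, e3.val, 0)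
      (mulq (1 + 2 * e4.val, 0, 0, 0) (b0.val, b1.val, b2.val, b3.val))))) =
      redq (mulq (1, y1.val, y2.val, y3.val) (1, y1.val, y2.val, y3.val)) := by
  decide +kernel

section
variable {R : Type*} [CommRing R]
def evq (θ : R) (a : ℕ × ℕ × ℕ × ℕ) : R := a.1 + a.2.1 * θ + a.2.2.1 * θ ^ 2 + a.2.2.2 * θ ^ 3

lemma evq_mul (θ : R) (h : θ ^ 4 = 2) (a b) : evq θ (mulq a b) = evq θ a * evq θ b := by
  simp only [evq, mulq]
  push_cast
  linear_combination (-(a.2.1 * b.2.2.2 + a.2.2.1 * b.2.2.1 + a.2.2.2 * b.2.1 : R) - (a.2.2.1 * b.2.2.2 + a.2.2.2 * b.2.2.1) * θ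
    - a.2.2.2 * b.2.2.2 * θ ^ 2) * h

lemma cast_mod4 (h4 : (4 : R) = 0) (n : ℕ) : ((n % 4 : ℕ) : R) = n := by
  conv_rhs => rw [← Nat.div_add_mod n 4]
  push_cast
  rw [h4]; ring

lemma evq_red (θ : R) (h4 : (4 : R) = 0) (a) : evq θ (redq a) = evq θ a := by
  simp only [evq, redq, cast_mod4 h4]

lemma evq_int (h4 : (4 : R) = 0) (b : ℤ) : ∃ n : ℕ, n < 4 ∧ (n : ℤ) % 2 = b % 2 ∧ (n : R) = b := by
  refine ⟨(b % 4).toNat, by omega, by omega, ?_⟩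
  have h1 : (((b % 4).toNat : ℤ)) = b % 4 := Int.toNat_of_nonneg (by omega)
  have h2 : (((b % 4).toNat : ℕ) : R) = ((b % 4 : ℤ) : R) := by rw [← Int.cast_natCast, h1]
  rw [h2]
  conv_rhs => rw [← Int.mul_ediv_add_emod b 4]
  push_cast
  rw [h4]; ring
end

/-- every odd element of `ℤ[θ]` is a square modulo 4 up to units -/
lemma odd_sq_mod {A : Type*} [CommRing A] (θ : A) (h : θ ^ 4 - 4 * θ ^ 2 + 2 = 0) (b0 b1 b2 b3 : ℤ) (hb : Odd b0) :
    ∃ w y z : A, IsUnit w ∧ (w * (b0 + b1 * θ + b2 * θ ^ 2 + b3 * θ ^ 3) = y ^ 2 + 4 * z) := by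
  let φ := Ideal.Quotient.mk (Ideal.span {(4 : A)})
  have h4 : (4 : A ⧸ Ideal.span {(4 : A)}) = 0 := by
    have : φ 4 = 0 := Ideal.Quotient.eq_zero_iff_mem.2 (Ideal.mem_span_singleton_self _)
    rwa [map_ofNat] at this
  have hθ : (φ θ) ^ 4 = 2 := by
    have := congrArg φ h
    simp only [map_add, map_sub, map_mul, map_pow, map_ofNat, map_zero] at this
    linear_combination this + ((φ θ) ^ 2 - 1) * h4
  obtain ⟨n0, hn0, hm0, e0⟩ := evq_int h4 b0
  obtain ⟨n1, hn1, hm1, e1⟩ := evq_int h4 b1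
  obtain ⟨n2, hn2, hm2, e2⟩ := evq_int h4 b2
  obtain ⟨n3, hn3, hm3, e3⟩ := evq_int h4 b3
  obtain ⟨e1', e2', e3', e4', y1, y2, y3, e⟩ :=
    tabq ⟨n0, hn0⟩ ⟨n1, hn1⟩ ⟨n2, hn2⟩ ⟨n3, hn3⟩ (by have := Int.odd_iff.1 hb; simp; omega)
  have E := congrArg (evq (φ θ)) e
  rw [evq_red _ h4, evq_red _ h4] at E
  simp only [evq_mul _ hθ] at E
  have f1 : ∃ w : A, IsUnit w ∧ φ w = evq (φ θ) (1, e1'.val, 0, 0) := by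
    fin_cases e1'
    · exact ⟨1, isUnit_one, by simp [evq]⟩
    · exact ⟨1 + θ, .of_mul_eq_one (θ ^ 3 - θ ^ 2 - 3 * θ + 3) (by linear_combination h), by simp [evq]⟩
  have f2 : ∃ w : A, IsUnit w ∧ φ w = evq (φ θ) (1 + 2 * e2'.val, e2'.val, e2'.val, 0) := by
    fin_cases e2'
    · exact ⟨1, isUnit_one, by simp [evq]⟩
    · exact ⟨-1 + θ + θ ^ 2, .of_mul_eq_one (1 + 3 * θ - θ ^ 3) (by linear_combination (-θ - 1) * h), by
        simp [evq]; linear_combination -h4⟩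
  have f3 : ∃ w : A, IsUnit w ∧ φ w = evq (φ θ) (1 + 2 * e3'.val, 0, e3'.val, 0) := by
    fin_cases e3'
    · exact ⟨1, isUnit_one, by simp [evq]⟩
    · exact ⟨-1 + θ ^ 2, .of_mul_eq_one (θ ^ 2 - 3) (by linear_combination h), by
        simp [evq]; linear_combination -h4⟩
  have f4 : ∃ w : A, IsUnit w ∧ φ w = evq (φ θ) (1 + 2 * e4'.val, 0, 0, 0) := by
    fin_cases e4'
    · exact ⟨1, isUnit_one, by simp [evq]⟩
    · exact ⟨-1, isUnit_one.neg, by simp [evq]; linear_combination -h4⟩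
  obtain ⟨w1, g1, i1⟩ := f1
  obtain ⟨w2, g2, i2⟩ := f2
  obtain ⟨w3, g3, i3⟩ := f3
  obtain ⟨w4, g4, i4⟩ := f4
  have k : φ (w1 * w2 * w3 * w4 * (b0 + b1 * θ + b2 * θ ^ 2 + b3 * θ ^ 3)) = φ ((1 + (y1.val : A) * θ + (y2.val : A) * θ ^ 2 + (y3.val : A) * θ ^ 3) ^ 2) := by
    have E0 : φ (b0 + b1 * θ + b2 * θ ^ 2 + b3 * θ ^ 3) = evq (φ θ) (n0, n1, n2, n3) := by
      simp [evq, e0, e1, e2, e3]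
    have E1 : φ (1 + (y1.val : A) * θ + (y2.val : A) * θ ^ 2 + (y3.val : A) * θ ^ 3) = evq (φ θ) (1, y1.val, y2.val, y3.val) := by
      simp [evq]
    rw [map_mul, map_mul, map_mul, map_mul, E0, i1, i2, i3, i4, map_pow, E1, pow_two, ← E]
    ring
  rw [Ideal.Quotient.eq, Ideal.mem_span_singleton] at k
  obtain ⟨z, hz⟩ := k
  exact ⟨w1 * w2 * w3 * w4, 1 + (y1.val : A) * θ + (y2.val : A) * θ ^ 2 + (y3.val : A) * θ ^ 3, z, ((g1.mul g2).mul g3).mul g4, by linear_combination hz⟩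
end CG

open NumberField nonZeroDivisors
set_option linter.all false
namespace CG
open IsDedekindDomain

lemma pow_principal {A : Type*} [CommRing A] [IsDedekindDomain A] [Finite (ClassGroup A)] (I : Ideal A) (hI : I ≠ ⊥) :
    ∃ ρ, I ^ (Nat.card (ClassGroup A)) = Ideal.span {ρ} := by
  have h0 : I ∈ nonZeroDivisors (Ideal A) := mem_nonZeroDivisors_iff_ne_zero.2 hI
  have h1 : ClassGroup.mk0 ((⟨I, h0⟩ : nonZeroDivisors (Ideal A)) ^ (Nat.card (ClassGroup A))) = 1 := by
    rw [map_pow, pow_card_eq_one']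
  obtain ⟨ρ, hρ⟩ := (ClassGroup.mk0_eq_one_iff (by exact ((⟨I, h0⟩ : nonZeroDivisors (Ideal A)) ^ (Nat.card (ClassGroup A))).2)).1 h1
  exact ⟨ρ, by simpa [Ideal.submodule_span_eq] using hρ⟩

section
variable {M : Type*} [Field M] [NumberField M] {η : 𝓞 M} [IsCyclotomicExtension {2 ^ (0 + 4)} ℚ M]

/-- elements fixed by complex conjugation -/
lemma real_rep (hη : IsPrimitiveRoot η (2 ^ (0 + 4))) {τ : 𝓞 M →+* 𝓞 M} (hτ : τ η = η ^ 15) (x : 𝓞 M) (hx : τ x = x) :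
    ∃ b0 b1 b2 b3 : ℤ, x = b0 + b1 * (η - η ^ 7) + b2 * (η - η ^ 7) ^ 2 + b3 * (η - η ^ 7) ^ 3 := by
  have h8 : η ^ 8 = -1 := zeta_half hη
  obtain ⟨f, rfl⟩ := rep8 hη x
  have key := indep8 hη (fun i => if i = 0 then 0 else f i + f (8 - i)) (by
    rw [map_sum] at hx
    simp only [map_mul, map_intCast, map_pow, hτ] at hx
    simp only [Finset.sum_range_succ, Finset.sum_range_zero] at hx ⊢
    simp
    have h16 : η ^ 16 = 1 := hη.pow_eq_one
    have c : ∀ m n : ℕ, m + n = 8 → (η ^ 15) ^ m = - η ^ n := by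
      intro m n h
      have e : η ^ m * (η ^ 15) ^ m = 1 := by rw [← mul_pow, ← pow_succ', h16, one_pow]
      have e2 : η ^ m * η ^ n = -1 := by rw [← pow_add, h, h8]
      calc (η ^ 15) ^ m = - (η ^ m * η ^ n) * (η ^ 15) ^ m := by rw [e2]; ring
        _ = - (η ^ m * (η ^ 15) ^ m) * η ^ n := by ring
        _ = - η ^ n := by rw [e]; ring
    rw [c 1 7 rfl, c 2 6 rfl, c 3 5 rfl, c 4 4 rfl, c 5 3 rfl, c 6 2 rfl, c 7 1 rfl] at hx
    linear_combination -hx)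
  have k1 := key 1 (by norm_num)
  have k2 := key 2 (by norm_num)
  have k3 := key 3 (by norm_num)
  have k4 := key 4 (by norm_num)
  norm_num at k1 k2 k3 k4
  have k4' : f 4 = 0 := by omega
  have e7 : f 7 = - f 1 := by omega
  have e6 : f 6 = - f 2 := by omega
  have e5 : f 5 = - f 3 := by omega
  refine ⟨f 0 - 2 * f 2, f 1 - 3 * f 3, f 2, f 3, ?_⟩
  simp only [Finset.sum_range_succ, Finset.sum_range_zero]
  rw [k4', e7, e6, e5]
  push_cast
  linear_combination (2 * (f 2 : 𝓞 M) - (f 2 : 𝓞 M) * η ^ 6 + (f 3 : 𝓞 M) * (3 * η - 3 * η ^ 7 - η ^ 5 + η ^ 13)) * h8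

lemma lam_theta : (1 - η) ∣ (η - η ^ 7) := by
  have := sub_dvd_pow_sub_pow 1 η 6
  rw [one_pow] at this
  have h2 : η - η ^ 7 = (1 - η ^ 6) * η := by ring
  rw [h2]
  exact this.mul_right _

lemma theta_eq (hη : IsPrimitiveRoot η (2 ^ (0 + 4))) : (η - η ^ 7) ^ 4 - 4 * (η - η ^ 7) ^ 2 + 2 = 0 := by
  have h8 : η ^ 8 = -1 := zeta_half hη
  have h2 : (η - η ^ 7) ^ 2 = η ^ 2 - η ^ 6 + 2 := by linear_combination (η ^ 6 - 2) * h8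
  have : (η - η ^ 7) ^ 4 - 4 * (η - η ^ 7) ^ 2 + 2 = ((η - η ^ 7) ^ 2 - 2) ^ 2 - 2 := by ring
  rw [this, h2]
  linear_combination (η ^ 4 - 2) * h8

/-- a generator of an odd power of a prime above `p ≡ 15 mod 16` which is a square modulo 4 -/
lemma exists_rho (hη : IsPrimitiveRoot η (2 ^ (0 + 4))) {p : ℕ} (hp : p.Prime) (h : p % 16 = 15) (P : Ideal (𝓞 M))
    (hP : P.IsPrime) (hpP : (p : 𝓞 M) ∈ P) :
    ∃ (ρ : 𝓞 M) (n : ℕ), Odd n ∧ P ^ n = Ideal.span {ρ} ∧ ∃ y z, ρ = y ^ 2 + 4 * z := by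
  obtain ⟨τ, hτ, hττ⟩ := exists_conj hη
  have h16 : η ^ 16 = 1 := hη.pow_eq_one
  have hodd : Odd (Nat.card (ClassGroup (𝓞 M))) := odd_cyc 2 M
  have hPb : P ≠ ⊥ := by
    rintro rfl
    rw [Ideal.mem_bot] at hpP
    exact hp.ne_zero (by exact_mod_cast hpP)
  obtain ⟨ρ0, hρ0⟩ := pow_principal P hPb
  set n := Nat.card (ClassGroup (𝓞 M)) with hn
  have hρne : ρ0 ≠ 0 := by
    rintro rfl
    rw [Set.singleton_zero, Ideal.span_zero, ← Ideal.zero_eq_bot] at hρ0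
    exact hPb ((pow_eq_zero_iff hodd.pos.ne').1 hρ0)
  have hτρ : ρ0 ∣ τ ρ0 := by
    rw [← Ideal.mem_span_singleton, ← hρ0]
    have h1 : P.map τ ≤ P := Ideal.map_le_iff_le_comap.2 fun x hx => conj_stable hη hτ hp h P hP hpP x hx
    have h2 : ρ0 ∈ P ^ n := by rw [hρ0]; exact Ideal.mem_span_singleton_self _
    have h3 := Ideal.mem_map_of_mem τ h2
    rw [Ideal.map_pow] at h3
    exact Ideal.pow_right_mono h1 n h3
  obtain ⟨u, hu⟩ := hτρ
  have huu : u * τ u = 1 := by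
    apply mul_left_cancel₀ hρne
    have := hττ ρ0
    rw [hu, map_mul, hu] at this
    linear_combination this
  obtain ⟨j, hj⟩ := unit_norm_one hη hτ u huu
  have hlam : ¬ (1 - η) ∣ ρ0 := by
    intro hd
    have h1 : ρ0 ∣ (((p : ℤ) ^ n : ℤ) : 𝓞 M) := by
      rw [← Ideal.mem_span_singleton, ← hρ0]
      push_cast
      exact Ideal.pow_mem_pow hpP n
    refine lam_odd hη _ ?_ (hd.trans h1)
    have : Odd (p : ℤ) := by rw [Int.odd_iff]; omega
    exact this.pow
  obtain ⟨m, hm⟩ := j_even hη hτ ρ0 hlam j (by rw [hu, hj]; ring)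
  have hηu : IsUnit η := .of_mul_eq_one (η ^ 15) (by rw [← pow_succ', h16])
  have hfix : τ (η ^ m * ρ0) = η ^ m * ρ0 := by
    rw [map_mul, map_pow, hτ, hu, hj, hm]
    have : (η ^ 15) ^ m * (ρ0 * η ^ (m + m)) = (η ^ 16) ^ m * (η ^ m * ρ0) := by ring
    rw [this, h16, one_pow, one_mul]
  have hlam' : ¬ (1 - η) ∣ η ^ m * ρ0 := by
    rw [(hηu.pow m).dvd_mul_left]; exact hlam
  obtain ⟨b0, b1, b2, b3, hb⟩ := real_rep hη hτ _ hfix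
  have hb0 : Odd b0 := by
    rw [← Int.not_even_iff_odd]
    rintro ⟨c, rfl⟩
    apply hlam'
    rw [hb]
    have t := lam_theta (η := η)
    refine dvd_add (dvd_add (dvd_add ?_ (t.mul_left _)) ((dvd_pow t (by norm_num)).mul_left _)) ((dvd_pow t (by norm_num)).mul_left _)
    have := (lam_two hη).mul_right (c : 𝓞 M)
    rw [two_mul] at this
    push_cast; exact this
  obtain ⟨w, y, z, hw, hwe⟩ := odd_sq_mod (η - η ^ 7) (theta_eq hη) b0 b1 b2 b3 hb0
  rw [← hb] at hwe
  refine ⟨w * (η ^ m * ρ0), n, hodd, ?_, y, z, hwe⟩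
  rw [hρ0, Ideal.span_singleton_mul_left_unit hw, Ideal.span_singleton_mul_left_unit (hηu.pow m)]
end
end CG

open NumberField nonZeroDivisors
set_option linter.all false
namespace CG
open IsDedekindDomain

section
variable {M : Type*} [Field M] [NumberField M] {η : 𝓞 M} [IsCyclotomicExtension {2 ^ (0 + 4)} ℚ M]

lemma theta_int (hη : IsPrimitiveRoot η (2 ^ (0 + 4))) {p : ℕ} (hp : p.Prime) (h : p % 16 = 15) (P : Ideal (𝓞 M))
    (hP : P.IsPrime) (hpP : (p : 𝓞 M) ∈ P) : ∃ t : ℤ, (η - η ^ 7) - t ∈ P := by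
  have h8 : η ^ 8 = -1 := zeta_half hη
  obtain ⟨τ, hτ, -⟩ := exists_conj hη
  have hfr := frob_conj hη hτ hp h P hP hpP (η - η ^ 7)
  have e : τ (η - η ^ 7) = η - η ^ 7 := by
    rw [map_sub, map_pow, hτ]
    have e1 : η ^ 15 = - η ^ 7 := by linear_combination η ^ 7 * h8
    have e2 : (-η ^ 7) ^ 7 = - η := by
      have : (-η ^ 7) ^ 7 = - ((η ^ 8) ^ 6 * η) := by ring
      rw [this, h8]; ring
    rw [e1, e2]; ring
  rw [e] at hfr
  have := Fact.mk hp
  have hm : P.IsMaximal := hP.isMaximal (ne_bot_of_mem hp.ne_zero hpP)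
  have : CharP (𝓞 M ⧸ P) p := by
    have h0 : ((p : ℕ) : 𝓞 M ⧸ P) = 0 := by
      rw [← map_natCast (Ideal.Quotient.mk P)]; exact Ideal.Quotient.eq_zero_iff_mem.2 hpP
    exact (CharP.charP_iff_prime_eq_zero hp).2 h0
  letI : Field (𝓞 M ⧸ P) := Ideal.Quotient.field P
  have h1 : (Ideal.Quotient.mk P (η - η ^ 7)) ^ p = Ideal.Quotient.mk P (η - η ^ 7) := by
    rw [← map_pow, eq_comm, Ideal.Quotient.eq]
    exact hfr
  have h2 := (Subfield.mem_bot_iff_pow_eq_self (𝓞 M ⧸ P) p).2 h1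
  obtain ⟨t, ht⟩ := (mem_bot_iff_intCast p (𝓞 M ⧸ P)).1 h2
  refine ⟨t, ?_⟩
  rw [← Ideal.Quotient.eq, map_intCast]
  exact ht.symm

lemma rho_cop {p : ℕ} (hp : p.Prime) (hp2 : Odd p) (P : Ideal (𝓞 M))
    (hP : P.IsPrime) (hpP : (p : 𝓞 M) ∈ P) (ρ ρ' : 𝓞 M) (n : ℕ) (hρ : P ^ n = Ideal.span {ρ}) (h : (p : 𝓞 M) ^ n = ρ * ρ') : ρ' ∉ P := by
  intro h1
  have hPb := ne_bot_of_mem hp.ne_zero hpP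
  obtain ⟨J, hJ⟩ := (Ideal.dvd_span_singleton (I := P) (x := (p : 𝓞 M))).2 hpP
  have e : P ^ n * J ^ n = P ^ n * Ideal.span {ρ'} := by
    rw [← mul_pow, ← hJ, Ideal.span_singleton_pow, h, hρ, Ideal.span_singleton_mul_span_singleton]
  have e2 : J ^ n = Ideal.span {ρ'} := mul_left_cancel₀ (pow_ne_zero n hPb) e
  have h2 : J ^ n ≤ P := by rw [e2, Ideal.span_singleton_le_iff_mem]; exact h1
  have h3 : J ≤ P := hP.le_of_pow_le h2
  apply (d_notMem_sq 0 hp.prime.squarefree hp2 P hpP).1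
  have h4 : P * J ≤ P ^ 2 := by rw [pow_two]; exact Ideal.mul_mono_right h3
  apply h4
  rw [← hJ]
  exact Ideal.mem_span_singleton_self _
end

section
variable {K : Type*} [Field K] [NumberField K] {k : ℕ} {ζ : 𝓞 K} [IsCyclotomicExtension {2 ^ (k + 4)} ℚ K]

lemma exists_j (hζ : IsPrimitiveRoot ζ (2 ^ (k + 4))) {M : Type*} [Field M] [NumberField M] [IsCyclotomicExtension {2 ^ (0 + 4)} ℚ M] :
    ∃ (η : 𝓞 M) (j : 𝓞 M →+* 𝓞 K), IsPrimitiveRoot η (2 ^ (0 + 4)) ∧ j η = ζ ^ 2 ^ k := by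
  have hζK : IsPrimitiveRoot (ζ : K) (2 ^ (k + 4)) := hζ.map_of_injective RingOfIntegers.coe_injective
  have hw : IsPrimitiveRoot ((ζ : K) ^ 2 ^ k) (2 ^ (0 + 4)) :=
    hζK.pow (by positivity) (by rw [← pow_add])
  have hM := IsCyclotomicExtension.zeta_spec (2 ^ (0 + 4)) ℚ M
  have hirr : Irreducible (Polynomial.cyclotomic (2 ^ (0 + 4)) ℚ) :=
    Polynomial.cyclotomic.irreducible_rat (by positivity)
  have hc : Polynomial.aeval ((ζ : K) ^ 2 ^ k) (minpoly ℚ (hM.powerBasis ℚ).gen) = 0 := by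
    rw [IsPrimitiveRoot.powerBasis_gen ℚ hM, ← hM.minpoly_eq_cyclotomic_of_irreducible hirr,
      hw.minpoly_eq_cyclotomic_of_irreducible hirr]
    exact minpoly.aeval _ _
  let f := (hM.powerBasis ℚ).lift _ hc
  have hf : f (IsCyclotomicExtension.zeta (2 ^ (0 + 4)) ℚ M) = (ζ : K) ^ 2 ^ k := by
    have := (hM.powerBasis ℚ).lift_gen _ hc
    rwa [IsPrimitiveRoot.powerBasis_gen ℚ hM] at this
  refine ⟨hM.toInteger, RingOfIntegers.mapRingHom f, hM.toInteger_isPrimitiveRoot, ?_⟩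
  apply RingOfIntegers.coe_injective
  rw [map_pow]
  exact hf

variable {L : Type*} [Field L] [NumberField L] [Algebra K L] [Algebra.IsQuadraticExtension K L] [IsTotallyComplex L]
  {r : L}

lemma good_rho (hζ : IsPrimitiveRoot ζ (2 ^ (k + 4))) {p : ℕ} (hp : p.Prime) (hp2 : Odd p)
    (hr : r ^ 2 = algebraMap K L (((p : 𝓞 K)) : K)) (γ γ' : 𝓞 K) (n : ℕ) (hn : Odd n)
    (h : γ * γ' = p ^ n) (hγ : ∃ y z, γ = y ^ 2 + 4 * z)
    (hcop : ∀ P : Ideal (𝓞 K), P.IsPrime → γ ∈ P → γ' ∉ P) : Good L p γ := by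
  have hp0 : (p : 𝓞 K) ≠ 0 := Nat.cast_ne_zero.2 hp.ne_zero
  have hγ0 : γ ≠ 0 := by rintro rfl; rw [zero_mul] at h; exact pow_ne_zero n hp0 h.symm
  have hγ0' : γ' ≠ 0 := by rintro rfl; rw [mul_zero] at h; exact pow_ne_zero n hp0 h.symm
  refine ⟨?_, hγ0, ?_⟩
  · obtain ⟨m, rfl⟩ := hn
    refine unr_of_base hr γ γ' ((p : 𝓞 K) ^ m) (pow_ne_zero _ hp0) hp0 (by rw [h]; ring) hcop hγ ?_
    obtain ⟨y, z, hyz⟩ := hγ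
    have hpo : Odd ((p : ℤ) ^ (2 * m + 1)) := (show Odd (p : ℤ) by exact_mod_cast hp2).pow
    obtain ⟨y', z', hyz'⟩ := sq_mod4 hζ _ hpo
    push_cast at hyz'
    obtain ⟨c, hc⟩ := Int.even_mul_pred_self (((p : ℤ) ^ (2 * m + 1)))
    obtain ⟨s, hs⟩ : ∃ s : ℤ, ((p : ℤ) ^ (2 * m + 1)) * ((p : ℤ) ^ (2 * m + 1)) = 1 + 4 * s := by
      obtain ⟨a, ha⟩ := hpo
      exact ⟨a ^ 2 + a, by rw [ha]; ring⟩
    have hs' := congrArg (Int.cast (R := 𝓞 K)) hs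
    push_cast at hs'
    exact sq_mod_four_div γ γ' _ (s : 𝓞 K) y z y' z' (γ' * p ^ (2 * m + 1)) h hyz' hyz (by rw [← hs', ← h]; ring)
  · intro v hv hγv
    have h1 := hcop _ v.isPrime hγv
    have h2 : od v ((γ : K) * (γ' : K)) = od v (γ : K) + od v (γ' : K) := by
      rw [od_mul v (by simpa using hγ0) (by simpa using hγ0')]
    have h3 : (γ : K) * (γ' : K) = (((p : 𝓞 K)) : K) ^ n := by
      rw [← map_mul, h, map_pow]
    rw [od_notMem v h1, add_zero, h3, od_pow] at h2
    rw [← h2]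
    exact (show Odd (n : ℤ) by exact_mod_cast hn).mul (od_d k hp.prime.squarefree hp2 v hv)

theorem nc_fifteen_aux (M : Type*) [Field M] [NumberField M] [IsCyclotomicExtension {2 ^ (0 + 4)} ℚ M] (hζ : IsPrimitiveRoot ζ (2 ^ (k + 4))) {p : ℕ} (hp : p.Prime) (h : p % 16 = 15)
    (hr : r ^ 2 = algebraMap K L (((p : 𝓞 K)) : K)) :
    ¬ IsCyclic (CommGroup.primaryComponent (ClassGroup (𝓞 L)) 2) := by
  have hp2 : Odd p := by rw [Nat.odd_iff]; omega
  obtain ⟨η, j, hη, hj⟩ := exists_j hζ (M := M)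
  have h8 : η ^ 8 = -1 := zeta_half hη
  have hs : (j η ^ 2 - j η ^ 6) ^ 2 = 2 := by
    rw [← map_pow, ← map_pow, ← map_sub, ← map_pow]
    have : (η ^ 2 - η ^ 6) ^ 2 = 2 := by linear_combination (η ^ 4 - 2) * h8
    rw [this, map_ofNat]
  have h8' : j η ^ 8 = -1 := by rw [← map_pow, h8]; simp
  obtain ⟨σ, hσ⟩ := exists_aut hζ 9 (by decide)
  obtain ⟨τ, hτ⟩ := exists_aut hζ 3 (by decide)
  have eσ : σ (j η) = - j η := by
    have : σ (j η) = (j η) ^ 9 := by rw [hj, map_pow, hσ, ← pow_mul, ← pow_mul, mul_comm]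
    rw [this]; linear_combination j η * h8'
  have eτ : τ (j η) = (j η) ^ 3 := by rw [hj, map_pow, hτ, ← pow_mul, ← pow_mul, mul_comm]
  obtain ⟨a, b, hab, hsq⟩ := pi_two hζ hp (by omega) hs
  have good1 := good_of_dvd hζ hp.prime.squarefree hp2 hr _ _ hab hsq
  set π : 𝓞 K := (a : 𝓞 K) + b * (j η ^ 2 - j η ^ 6) with hπ
  have eπj : j ((a : 𝓞 M) + b * (η ^ 2 - η ^ 6)) = π := by simp [hπ]
  have eτπ : τ π = a + b * (-(j η ^ 2 - j η ^ 6)) := by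
    rw [hπ]
    simp only [map_add, map_mul, map_sub, map_intCast, map_pow, eτ]
    linear_combination -(b : 𝓞 K) * (j η ^ 10 - j η ^ 2) * h8'
  have eσπ : σ π = π := by
    rw [hπ]
    simp only [map_add, map_mul, map_sub, map_intCast, map_pow, eσ]
    ring
  have hcm : ∀ (σ : 𝓞 K →+* 𝓞 K) (P : Ideal (𝓞 K)), P.IsPrime → (p : 𝓞 K) ∈ P → (P.comap σ).IsPrime ∧ (p : 𝓞 K) ∈ P.comap σ := by
    intro σ P hP hpP
    exact ⟨hP.comap σ, by rw [Ideal.mem_comap, map_natCast]; exact hpP⟩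
  obtain ⟨P0, hP0, hpP0, hπP0⟩ : ∃ P : Ideal (𝓞 K), P.IsPrime ∧ (p : 𝓞 K) ∈ P ∧ π ∈ P := by
    obtain ⟨P, hP, hpP⟩ := exists_P (K := K) k hp hp2
    by_cases hm : π ∈ P
    · exact ⟨P, hP, hpP, hm⟩
    · refine ⟨P.comap τ, (hcm τ P hP hpP).1, (hcm τ P hP hpP).2, ?_⟩
      rw [Ideal.mem_comap, eτπ]
      exact (conj_mem k hp hp2 P hP hpP _ _ hab).1 hm
  have hq : (P0.comap j).IsPrime := hP0.comap j
  have hpq : (p : 𝓞 M) ∈ P0.comap j := by rw [Ideal.mem_comap, map_natCast]; exact hpP0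
  obtain ⟨ρ, n, hn, hρ, y, z, hyz⟩ := exists_rho hη hp h _ hq hpq
  obtain ⟨ρ', hρ'⟩ : ρ ∣ (p : 𝓞 M) ^ n := by
    rw [← Ideal.mem_span_singleton, ← hρ]; exact Ideal.pow_mem_pow hpq n
  have key : ∀ P : Ideal (𝓞 K), P.IsPrime → j ρ ∈ P → P0.comap j ≤ P.comap j := by
    intro P hP hm x hx
    have h1 : x ^ n ∈ Ideal.span {ρ} := by rw [← hρ]; exact Ideal.pow_mem_pow hx n
    obtain ⟨c, hc⟩ := Ideal.mem_span_singleton.1 h1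
    have h2 : (j x) ^ n ∈ P := by rw [← map_pow, hc, map_mul]; exact P.mul_mem_right _ hm
    exact hP.mem_of_pow_mem n h2
  have good2 : Good L p (j ρ) := by
    refine good_rho hζ hp hp2 hr (j ρ) (j ρ') n hn (by rw [← map_mul, ← hρ', map_pow, map_natCast]) ⟨j y, j z, ?_⟩ ?_
    · rw [hyz, map_add, map_mul, map_pow, map_ofNat]
    · intro P hP h1 h2
      have hmax : (P0.comap j).IsMaximal := hq.isMaximal (ne_bot_of_mem hp.ne_zero hpq)
      have he := hmax.eq_of_le (hP.comap j).ne_top (key P hP h1)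
      exact rho_cop hp hp2 _ hq hpq ρ ρ' n hρ hρ' (by rw [he]; exact h2)
  have hjρ : j ρ ∈ P0 := by
    have : ρ ∈ P0.comap j := by
      have h1 : ρ ∈ (P0.comap j) ^ n := by rw [hρ]; exact Ideal.mem_span_singleton_self _
      exact Ideal.pow_le_self hn.pos.ne' h1
    exact this
  have h1 := hcm σ P0 hP0 hpP0
  have h2 := hcm τ P0 hP0 hpP0
  have hπτ : π ∉ P0.comap τ := by
    rw [Ideal.mem_comap, eτπ]
    intro hm
    exact (conj_mem k hp hp2 P0 hP0 hpP0 _ _ hab).2 hm hπP0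
  refine V4a hζ hp.prime.squarefree hp2 hr good1 good2 P0 _ _ hP0 h1.1 h2.1 hpP0 h1.2 h2.2 ⟨hπP0, hjρ⟩
    ⟨by rw [Ideal.mem_comap, eσπ]; exact hπP0, fun hm => ?_⟩ ⟨hπτ, fun hm => ?_⟩
  · obtain ⟨t, ht⟩ := theta_int hη hp h _ hq hpq
    have hle := key _ h1.1 hm ht
    rw [Ideal.mem_comap] at ht
    rw [Ideal.mem_comap, Ideal.mem_comap] at hle
    simp only [map_sub, map_pow, map_intCast, eσ] at ht hle
    have h3 := P0.sub_mem ht hle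
    have h4 : 2 * (j η - j η ^ 7) ∈ P0 := by
      convert! h3 using 1
      ring
    have h2P := two_notMem hp2 hP0 hpP0
    have h5 := (hP0.mem_or_mem h4).resolve_left h2P
    apply h2P
    have h6 := congrArg j (theta_eq hη)
    simp only [map_add, map_sub, map_mul, map_pow, map_ofNat, map_zero] at h6
    have h7 : (2 : 𝓞 K) = (j η - j η ^ 7) * (4 * (j η - j η ^ 7) - (j η - j η ^ 7) ^ 3) := by linear_combination h6
    rw [h7]
    exact P0.mul_mem_right _ h5
  · apply hπτ
    have : ((a : 𝓞 M) + b * (η ^ 2 - η ^ 6)) ∈ P0.comap j := by rw [Ideal.mem_comap, eπj]; exact hπP0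
    have h3 := key _ h2.1 hm this
    rwa [Ideal.mem_comap, eπj] at h3

theorem nc_fifteen (hζ : IsPrimitiveRoot ζ (2 ^ (k + 4))) {p : ℕ} (hp : p.Prime) (h : p % 16 = 15)
    (hr : r ^ 2 = algebraMap K L (((p : 𝓞 K)) : K)) :
    ¬ IsCyclic (CommGroup.primaryComponent (ClassGroup (𝓞 L)) 2) := by
  have : NeZero (((2 ^ (0 + 4) : ℕ)) : ℚ) := ⟨by norm_num⟩
  have : IsCyclotomicExtension {2 ^ (0 + 4)} ℚ (CyclotomicField (2 ^ (0 + 4)) ℚ) := CyclotomicField.isCyclotomicExtension _ _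
  exact nc_fifteen_aux (CyclotomicField (2 ^ (0 + 4)) ℚ) hζ hp h hr
end
end CG

open NumberField nonZeroDivisors
set_option linter.all false
namespace CG
open IsDedekindDomain

section
variable {K : Type*} [Field K] [NumberField K] {k : ℕ} {ζ : 𝓞 K} [IsCyclotomicExtension {2 ^ (k + 4)} ℚ K] [IsTotallyComplex K]
variable {L : Type*} [Field L] [NumberField L] [Algebra K L] [Algebra.IsQuadraticExtension K L]
  {r : L}

theorem main_abs (hζ : IsPrimitiveRoot ζ (2 ^ (k + 4))) (d : ℕ) (hd2 : 2 < d) (hodd : Odd d) (hsf : Squarefree d)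
    (hr : r ^ 2 = algebraMap K L (((d : 𝓞 K)) : K)) :
    (IsCyclic (CommGroup.primaryComponent (ClassGroup (𝓞 L)) 2) ∧
      Nontrivial (CommGroup.primaryComponent (ClassGroup (𝓞 L)) 2)) ↔
      ((d.Prime ∧ d % 16 = 7) ∨
       (∃ p q : ℕ, p.Prime ∧ q.Prime ∧ p % 8 = 5 ∧ q % 8 = 3 ∧ d = p * q)) := by
  have : IsTotallyComplex L := isTC K L
  constructor
  · rintro ⟨hc, hnt⟩
    obtain ⟨p, hp, m, hm⟩ := Nat.exists_prime_and_dvd (show d ≠ 1 by omega)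
    have hpo : Odd p := hodd.of_dvd_nat ⟨m, hm⟩
    by_cases hm1 : m = 1
    · left
      have hdp : d = p := by rw [hm, hm1, mul_one]
      subst hdp
      refine ⟨hp, ?_⟩
      have ho := Nat.odd_iff.1 hpo
      have hcases : d % 8 = 1 ∨ (d % 8 = 3 ∨ d % 8 = 5) ∨ d % 16 = 7 ∨ d % 16 = 15 := by omega
      rcases hcases with h | h | h | h
      · exact absurd hc (nc_one hζ hp h hr)
      · have h1 := odd_of_N2 L (bound_prime hζ hp h hr)
        rw [nontrivial_iff_even] at hnt
        exact absurd hnt (Nat.not_even_iff_odd.2 h1)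
      · exact h
      · exact absurd hc (nc_fifteen hζ hp h hr)
    · right
      obtain ⟨q, hq, l, hl⟩ := Nat.exists_prime_and_dvd hm1
      have hqd : q ∣ d := ⟨p * l, by rw [hm, hl]; ring⟩
      have hqo : Odd q := hodd.of_dvd_nat hqd
      have sq_free : ∀ x : ℕ, x.Prime → ¬ x * x ∣ d := by
        intro x hx h
        have := Nat.isUnit_iff.1 (hsf x h)
        exact hx.one_lt.ne' this
      have hpq : p ≠ q := by
        rintro rfl
        exact sq_free p hp ⟨l, by rw [hm, hl]; ring⟩
      by_cases hl1 : l = 1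
      · have hdpq : d = p * q := by rw [hm, hl, hl1, mul_one]
        have hr1 : r ^ 2 = algebraMap K L ((((p * q : ℕ) : 𝓞 K)) : K) := by rw [hr, hdpq]
        have hr2 : r ^ 2 = algebraMap K L ((((q * p : ℕ) : 𝓞 K)) : K) := by rw [hr, hdpq, mul_comm]
        have ho := Nat.odd_iff.1 hpo
        have ho' := Nat.odd_iff.1 hqo
        have h1 : ¬ (p % 8 = 1 ∨ p % 8 = 7) := fun h => nc_pq_one hζ hp hq hpq hqo h hr1 hc
        have h2 : ¬ (q % 8 = 1 ∨ q % 8 = 7) := fun h => nc_pq_one hζ hq hp hpq.symm hpo h hr2 hc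
        have h3 : ¬ (p % 8 = 3 ∧ q % 8 = 3) := fun h => nc_pq_three hζ hp hq hpq h.1 h.2 hr1 hc
        have h4 : ¬ (p % 8 = 5 ∧ q % 8 = 5) := fun h => nc_pq_five hζ hp hq hpq h.1 h.2 hr1 hc
        have h5 : (p % 8 = 5 ∧ q % 8 = 3) ∨ (q % 8 = 5 ∧ p % 8 = 3) := by omega
        rcases h5 with h5 | h5
        · exact ⟨p, q, hp, hq, h5.1, h5.2, hdpq⟩
        · exact ⟨q, p, hq, hp, h5.1, h5.2, by rw [hdpq, mul_comm]⟩
      · exfalso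
        obtain ⟨s, hs, t, ht⟩ := Nat.exists_prime_and_dvd hl1
        have hsd : s ∣ d := ⟨p * q * t, by rw [hm, hl, ht]; ring⟩
        have hps : p ≠ s := by
          rintro rfl
          exact sq_free p hp ⟨q * t, by rw [hm, hl, ht]; ring⟩
        have hqs : q ≠ s := by
          rintro rfl
          exact sq_free q hq ⟨p * t, by rw [hm, hl, ht]; ring⟩
        exact nc_three hζ hsf hodd hr hp hq hs ⟨m, hm⟩ hqd hsd hpq hps hqs hc
  · rintro (⟨hp, h⟩ | ⟨p, q, hp, hq, h5, h3, rfl⟩)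
    · exact ⟨cyclic_of_ker (bound_seven hζ hp h hr), nontriv_seven hζ hp (by omega) hr⟩
    · exact ⟨cyclic_of_ker (bound_two hζ hp hq h5 h3 hr),
        nontriv_two hζ hsf hodd hr hp hq (Dvd.intro _ rfl) (Dvd.intro_left _ rfl) (by rintro rfl; omega)⟩
end

lemma quad_adjoin (F E : Type*) [Field F] [Field E] [Algebra F E] (r : E) (c : F) (hr : r ^ 2 = algebraMap F E c)
    (hc : ¬ IsSquare c) : Module.finrank F (IntermediateField.adjoin F {r}) = 2 := by
  have hm : (Polynomial.X ^ 2 - Polynomial.C c).Monic := Polynomial.monic_X_pow_sub_C c two_ne_zero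
  have h0 : Polynomial.aeval r (Polynomial.X ^ 2 - Polynomial.C c) = 0 := by simp [hr]
  have hi : IsIntegral F r := ⟨_, hm, by simpa [Polynomial.aeval_def] using h0⟩
  rw [IntermediateField.adjoin.finrank hi]
  have h1 : (minpoly F r).natDegree ≤ 2 := by
    have := Polynomial.natDegree_le_of_dvd (minpoly.dvd F r h0) hm.ne_zero
    rwa [Polynomial.natDegree_X_pow_sub_C] at this
  have h2 := minpoly.natDegree_pos hi
  have h3 : (minpoly F r).natDegree ≠ 1 := by
    intro h
    obtain ⟨a, ha⟩ := minpoly.natDegree_eq_one_iff.1 h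
    apply hc
    refine ⟨a, (algebraMap F E).injective ?_⟩
    rw [← hr, ← ha, map_mul, pow_two]
  omega

theorem Lfield_eq (N : ℕ) (d : ℕ) (z r : ℂ) (hz : IsPrimitiveRoot z N) (hN : 0 < N) (hr : r ^ 2 = (((d : ℤ)) : ℂ)) :
    IntermediateField.adjoin ℚ ({z : ℂ | z ^ N = 1} ∪ {z : ℂ | z ^ 2 = (((d : ℤ)) : ℂ)}) =
      (IntermediateField.adjoin (IntermediateField.adjoin ℚ {z}) {r}).restrictScalars ℚ := by
  have e := IntermediateField.adjoin_adjoin_left ℚ ({z} : Set ℂ) ({r} : Set ℂ)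
  refine Eq.trans ?_ e.symm
  apply le_antisymm
  · rw [IntermediateField.adjoin_le_iff]
    rintro x (hx | hx)
    · have : NeZero N := ⟨hN.ne'⟩
      obtain ⟨i, -, rfl⟩ := hz.eq_pow_of_pow_eq_one hx
      have hzm : z ∈ IntermediateField.adjoin ℚ ({z} ∪ {r} : Set ℂ) := IntermediateField.subset_adjoin _ _ (Or.inl rfl)
      exact pow_mem hzm i
    · have hrm : r ∈ IntermediateField.adjoin ℚ ({z} ∪ {r} : Set ℂ) := IntermediateField.subset_adjoin _ _ (Or.inr rfl)
      have hx' : x ^ 2 = r ^ 2 := by rw [hr]; exact hx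
      rcases sq_eq_sq_iff_eq_or_eq_neg.1 hx' with h | h
      · rw [h]; exact hrm
      · rw [h]; exact neg_mem hrm
  · apply IntermediateField.adjoin.mono
    rintro x (hx | hx)
    · left; rw [Set.mem_singleton_iff.1 hx]; exact hz.pow_eq_one
    · right; rw [Set.mem_singleton_iff.1 hx]; exact hr

theorem main_concrete (k d : ℕ) (hd2 : 2 < d) (hodd : Odd d) (hsf : Squarefree d) (z r : ℂ)
    (hz : IsPrimitiveRoot z (2 ^ (k + 4))) (hr : r ^ 2 = (((d : ℤ)) : ℂ)) :
    (IsCyclic (CommGroup.primaryComponent (ClassGroup (𝓞 (IntermediateField.adjoin (IntermediateField.adjoin ℚ {z}) {r}))) 2) ∧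
      Nontrivial (CommGroup.primaryComponent (ClassGroup (𝓞 (IntermediateField.adjoin (IntermediateField.adjoin ℚ {z}) {r}))) 2)) ↔
      ((d.Prime ∧ d % 16 = 7) ∨
       (∃ p q : ℕ, p.Prime ∧ q.Prime ∧ p % 8 = 5 ∧ q % 8 = 3 ∧ d = p * q)) := by
  set K := IntermediateField.adjoin ℚ {z} with hK
  have hcyc : IsCyclotomicExtension {2 ^ (k + 4)} ℚ K := by
    have hi : IsAlgebraic ℚ z := ((hz.isIntegral (by positivity)).tower_top (A := ℚ)).isAlgebraic
    change IsCyclotomicExtension {2 ^ (k + 4)} ℚ (IntermediateField.adjoin ℚ {z}).toSubalgebra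
    rw [IntermediateField.adjoin_simple_toSubalgebra_of_isAlgebraic hi]
    exact hz.adjoin_isCyclotomicExtension ℚ
  have hnf : NumberField K := IsCyclotomicExtension.numberField {2 ^ (k + 4)} ℚ K
  have htc : IsTotallyComplex K := IsCyclotomicExtension.Rat.isTotallyComplex K (n := 2 ^ (k + 4)) (by
    have : 2 ^ 4 ≤ 2 ^ (k + 4) := Nat.pow_le_pow_right (by norm_num) (by omega)
    omega)
  have hr' : r ^ 2 = algebraMap K ℂ (((d : 𝓞 K)) : K) := by rw [hr]; simp
  have hf := quad_adjoin K ℂ r _ hr' (nonsq_d k hsf hodd (by omega))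
  have hq : Algebra.IsQuadraticExtension K (IntermediateField.adjoin K {r}) := ⟨hf⟩
  have hfd : FiniteDimensional K (IntermediateField.adjoin K {r}) := Module.finite_of_finrank_pos (by omega)
  have hnf2 : NumberField (IntermediateField.adjoin K {r}) := NumberField.of_module_finite K _
  have hζ := (IsCyclotomicExtension.zeta_spec (2 ^ (k + 4)) ℚ K).toInteger_isPrimitiveRoot
  have hr2 : (⟨r, IntermediateField.mem_adjoin_simple_self K r⟩ : IntermediateField.adjoin K {r}) ^ 2 =
      algebraMap K (IntermediateField.adjoin K {r}) (((d : 𝓞 K)) : K) := Subtype.ext hr'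
  exact main_abs hζ d hd2 hodd hsf hr2
end CG

/-- for odd squarefree `d > 2` and `n ≥ 2`, the 2-class group of
`L_{n,d}` is cyclic nontrivial iff `d` is a prime `≡ 7 (mod 16)` or
`d = pq` with primes `p ≡ 5 (mod 8)` and `q ≡ 3 (mod 8)`. -/
theorem twoClassGroup_Lfield_cyclic_nontrivial_iff
    (d : ℕ) (hd2 : 2 < d) (hodd : Odd d) (hsf : Squarefree d)
    (n : ℕ) (hn : 2 ≤ n) :
    (IsCyclic (twoClassGroup (Lfield n (d : ℤ))) ∧
        Nontrivial (twoClassGroup (Lfield n (d : ℤ)))) ↔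
      ((d.Prime ∧ d % 16 = 7) ∨
       (∃ p q : ℕ, p.Prime ∧ q.Prime ∧ p % 8 = 5 ∧ q % 8 = 3 ∧ d = p * q)) := by
  obtain ⟨k, rfl⟩ : ∃ k, n = k + 2 := ⟨n - 2, by omega⟩
  have hz := Complex.isPrimitiveRoot_exp (2 ^ (k + 4)) (by positivity)
  obtain ⟨r, hr⟩ : ∃ r : ℂ, r ^ 2 = (((d : ℤ)) : ℂ) := IsAlgClosed.exists_pow_nat_eq _ two_pos
  have hL : Lfield (k + 2) (d : ℤ) = _ := CG.Lfield_eq (2 ^ (k + 4)) d _ r hz (by positivity) hr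
  rw [hL]
  exact CG.main_concrete k d hd2 hodd hsf _ r hz hr
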